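/- Let V be an n-dimensional real vector space, j ∈ {0,1,…,n−1}, and let φ : 𝒦(V) → ℝ be a continuous, translation invariant valuation homogeneous of degree j. (a) If φ(K) = 0 whenever dim K = j, then φ(K) + φ(−K) = 0 for all K ∈ 𝒦(V). (b) If φ(K) = 0 whenever dim K = j+1, then φ ≡ 0. -/

import Mathlib

open scoped Pointwise
open MeasureTheory Module

noncomputable section

section CommonDefs

variable {V V' A : Type*}
variable [NormedAddCommGroup V] [NormedSpace ℝ V]
variable [NormedAddCommGroup V'] [NormedSpace ℝ V']
variable [NormedAddCommGroup A] [NormedSpace ℝ A]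

/-- The supremum of a (pairing) functional over a convex body; used to express the
support function `h(K, ξ) = sup_{x ∈ K} ⟨ξ, x⟩` for the various pairings `p = ⟨ξ, ·⟩`. -/
def hSupp (K : ConvexBody V) (p : V → ℝ) : ℝ := sSup (p '' (K : Set V))

/-- The translate `x + K` of a convex body. -/
def ConvexBody.translate (K : ConvexBody V) (x : V) : ConvexBody V :=
  ⟨(fun y => x + y) '' (K : Set V), K.convex.translate x,
    K.isCompact.image (continuous_const.add continuous_id),
    K.nonempty.image _⟩

/-- The image of a convex body under a continuous linear map. -/
def ConvexBody.mapCLM (f : V →L[ℝ] V') (K : ConvexBody V) : ConvexBody V' :=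
  ⟨f '' (K : Set V), K.convex.linear_image (f : V →ₗ[ℝ] V'),
    K.isCompact.image f.continuous, K.nonempty.image _⟩

/-- The reflection `-K` of a convex body about the origin. -/
def ConvexBody.neg (K : ConvexBody V) : ConvexBody V :=
  K.mapCLM (-(ContinuousLinearMap.id ℝ V))

/-- The union of two convex bodies (a convex body provided it is convex). -/
def ConvexBody.union (K L : ConvexBody V) (h : Convex ℝ ((K : Set V) ∪ (L : Set V))) :
    ConvexBody V :=
  ⟨(K : Set V) ∪ (L : Set V), h, K.isCompact.union L.isCompact,
    K.nonempty.mono Set.subset_union_left⟩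

/-- The intersection of two convex bodies (a convex body provided it is nonempty). -/
def ConvexBody.inter (K L : ConvexBody V) (h : ((K : Set V) ∩ (L : Set V)).Nonempty) :
    ConvexBody V :=
  ⟨(K : Set V) ∩ (L : Set V), K.convex.inter L.convex,
    K.isCompact.inter_right L.isClosed, h⟩

/-- A Minkowski valuation: `Z(K ∪ L) + Z(K ∩ L) = Z(K) + Z(L)` (Minkowski addition)
whenever `K, L, K ∪ L` are convex bodies. -/
def IsMinkowskiValuation (Z : ConvexBody V → ConvexBody A) : Prop :=
  ∀ (K L : ConvexBody V) (hU : Convex ℝ ((K : Set V) ∪ (L : Set V)))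
    (hI : ((K : Set V) ∩ (L : Set V)).Nonempty),
    Z (K.union L hU) + Z (K.inter L hI) = Z K + Z L

/-- A real-valued valuation: `φ(K ∪ L) + φ(K ∩ L) = φ(K) + φ(L)`
whenever `K, L, K ∪ L` are convex bodies. -/
def IsValuation (φ : ConvexBody V → ℝ) : Prop :=
  ∀ (K L : ConvexBody V) (hU : Convex ℝ ((K : Set V) ∪ (L : Set V)))
    (hI : ((K : Set V) ∩ (L : Set V)).Nonempty),
    φ (K.union L hU) + φ (K.inter L hI) = φ K + φ L

/-- Translation invariance of a map defined on convex bodies. -/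
def IsTranslationInvariant {α : Type*} (Z : ConvexBody V → α) : Prop :=
  ∀ (K : ConvexBody V) (x : V), Z (K.translate x) = Z K

/-- The mixed volume (w.r.t. the Lebesgue (Haar) measure `μ`) of an `n`-tuple of convex
bodies, given by the polarization formula
`V(K₁, …, Kₙ) = (1/n!) ∑_{S ⊆ {1,…,n}} (-1)^{n - |S|} vol(∑_{i ∈ S} K_i)`. -/
def mixedVol [MeasurableSpace V] (μ : Measure V) {n : ℕ} (K : Fin n → ConvexBody V) : ℝ :=
  (n.factorial : ℝ)⁻¹ *
    ∑ S : Finset (Fin n), (-1 : ℝ) ^ (n - S.card) * (μ (∑ i ∈ S, (K i : Set V))).toReal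

/-- The extension `V(K, …, K, f)` (with `n - 1` copies of `K`) of the mixed volume to
continuous positively `1`-homogeneous functions `f` on the dual space, defined via
Aleksandrov's variational formula: `V(K,…,K,f)` is `1/n` times the right derivative at
`t = 0` of the volume of the Wulff shape (aka Aleksandrov body) of `h_K + t f`.
For `f = h_L` the Wulff shape is `K + t L`, so this indeed extends `L ↦ V(K, …, K, L)`. -/
def mixedVolFn [MeasurableSpace V] (μ : Measure V) (K : ConvexBody V)
    (f : (V →L[ℝ] ℝ) → ℝ) : ℝ :=
  (Module.finrank ℝ V : ℝ)⁻¹ *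
    derivWithin (fun t : ℝ =>
        (μ {x : V | ∀ ξ : V →L[ℝ] ℝ, ξ x ≤ hSupp K ξ + t * f ξ}).toReal)
      (Set.Ici 0) 0

/-- The dimension of a convex body: the dimension of (the direction of) its affine hull. -/
def bodyDim (K : ConvexBody V) : ℕ := Module.finrank ℝ (vectorSpan ℝ (K : Set V))

/-- A convex body contained in a subspace `E`, viewed as a convex body of `E`. -/
def bodyIn (E : Submodule ℝ V) (K : ConvexBody V) (h : (K : Set V) ⊆ (E : Set V)) :
    ConvexBody ↥E :=
  ⟨Subtype.val ⁻¹' (K : Set V),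
    K.convex.linear_preimage (E.subtype),
    by
      rw [Topology.IsEmbedding.subtypeVal.isCompact_iff,
        Set.image_preimage_eq_of_subset (by rw [Subtype.range_coe]; exact h)]
      exact K.isCompact,
    by obtain ⟨x, hx⟩ := K.nonempty; exact ⟨⟨x, h hx⟩, hx⟩⟩

/-- The properties of the components of McMullen's decomposition of (the support function
of) a Minkowski valuation: each `fᵢ(·, u)` is a continuous, translation invariant
valuation, homogeneous of degree `i`, and each `fᵢ(K, ·)` is continuous and positively
`1`-homogeneous. -/
def McMullenProps (f : ℕ → ConvexBody V → V → ℝ) : Prop :=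
  (∀ (i : ℕ) (u : V), Continuous fun K : ConvexBody V => f i K u) ∧
  (∀ (i : ℕ) (u : V), IsValuation fun K : ConvexBody V => f i K u) ∧
  (∀ (i : ℕ) (u : V), IsTranslationInvariant fun K : ConvexBody V => f i K u) ∧
  (∀ (i : ℕ) (K : ConvexBody V) (u : V) (t : ℝ), 0 < t → f i (t • K) u = t ^ i * f i K u) ∧
  (∀ (i : ℕ) (K : ConvexBody V), Continuous fun u : V => f i K u) ∧
  (∀ (i : ℕ) (K : ConvexBody V) (u : V) (t : ℝ), 0 < t → f i K (t • u) = t * f i K u)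

end CommonDefs

/-- The surface area measure `S(M, ·)` on `S¹ ⊆ ℂ` of a planar convex body `M`,
characterized (uniquely) by the property that it is a finite measure concentrated on the
unit circle with `∫_{S¹} h(L, α) dσ(α) = 2 V(M, L)` for every planar convex body `L`. -/
def IsSurfaceAreaMeasure (M : ConvexBody ℂ) (σ : Measure ℂ) : Prop :=
  IsFiniteMeasure σ ∧ σ (Metric.sphere (0 : ℂ) 1)ᶜ = 0 ∧
    ∀ L : ConvexBody ℂ,
      (∫ α, hSupp L (fun c => (c * (starRingEnd ℂ) α).re) ∂σ) = 2 * mixedVol volume ![M, L]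

namespace ConvexBody

variable {V V' : Type*} [NormedAddCommGroup V] [NormedSpace ℝ V]
  [NormedAddCommGroup V'] [NormedSpace ℝ V']

@[simp] theorem coe_mapCLM (f : V →L[ℝ] V') (K : ConvexBody V) :
    (K.mapCLM f : Set V') = f '' (K : Set V) := rfl

@[simp] theorem coe_neg (K : ConvexBody V) : (K.neg : Set V) = -(K : Set V) := by
  ext x
  simp [neg, Set.mem_neg]

@[simp] theorem coe_union (K L : ConvexBody V) (h) :
    (K.union L h : Set V) = (K : Set V) ∪ L := rfl

@[simp] theorem coe_inter (K L : ConvexBody V) (h) :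
    (K.inter L h : Set V) = (K : Set V) ∩ L := rfl

@[simp] theorem coe_translate (K : ConvexBody V) (x : V) :
    (K.translate x : Set V) = (fun y => x + y) '' (K : Set V) := rfl

/-- The convex body consisting of a single point. -/
def point (x : V) : ConvexBody V :=
  ⟨{x}, convex_singleton x, isCompact_singleton, Set.singleton_nonempty x⟩

@[simp] theorem coe_point (x : V) : (point x : Set V) = {x} := rfl

theorem point_add (x : V) (K : ConvexBody V) : point x + K = K.translate x := by
  ext1; simp [Set.singleton_add]

theorem translate_add_body (x : V) (K L : ConvexBody V) :
    K.translate x + L = (K + L).translate x := by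
  rw [← point_add, ← point_add, add_assoc]

theorem mapCLM_add (f : V →L[ℝ] V') (K L : ConvexBody V) :
    (K + L).mapCLM f = K.mapCLM f + L.mapCLM f := by
  ext1; simp [Set.image_add]

theorem mapCLM_smul (f : V →L[ℝ] V') (t : ℝ) (K : ConvexBody V) :
    (t • K).mapCLM f = t • K.mapCLM f := by
  ext1; simp [← Set.image_smul, Set.image_image]

theorem mapCLM_translate (f : V →L[ℝ] V') (x : V) (K : ConvexBody V) :
    (K.translate x).mapCLM f = (K.mapCLM f).translate (f x) := by
  simp only [← point_add, mapCLM_add]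
  congr 1
  ext1; simp

theorem neg_add_body (K L : ConvexBody V) : (K + L).neg = K.neg + L.neg := mapCLM_add _ _ _

theorem neg_smul' (t : ℝ) (K : ConvexBody V) : (t • K).neg = t • K.neg := mapCLM_smul _ _ _

@[simp] theorem neg_neg' (K : ConvexBody V) : K.neg.neg = K := by
  ext1; simp

theorem mapCLM_neg (f : V →L[ℝ] V') (K : ConvexBody V) : K.neg.mapCLM f = (K.mapCLM f).neg := by
  ext1
  simp [Set.image_neg_of_apply_neg_eq_neg]

theorem dist_le_iff {K L : ConvexBody V} {ε : ℝ} (hε : 0 ≤ ε) :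
    dist K L ≤ ε ↔ (∀ x ∈ K, ∃ y ∈ L, dist x y ≤ ε) ∧ (∀ y ∈ L, ∃ x ∈ K, dist y x ≤ ε) := by
  rw [← hausdorffDist_coe]
  constructor
  · intro h
    have key : ∀ K L : ConvexBody V, Metric.hausdorffDist (K : Set V) L ≤ ε →
        ∀ x ∈ K, ∃ y ∈ L, dist x y ≤ ε := by
      intro K L h x hx
      obtain ⟨y, hy, e⟩ := L.isCompact.exists_infDist_eq_dist L.nonempty x
      refine ⟨y, hy, e ▸ (Metric.infDist_le_hausdorffDist_of_mem hx hausdorffEDist_ne_top).trans h⟩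
    exact ⟨key K L h, key L K (by rwa [Metric.hausdorffDist_comm])⟩
  · rintro ⟨h1, h2⟩
    exact Metric.hausdorffDist_le_of_mem_dist hε h1 h2

theorem dist_add_le (K L K' L' : ConvexBody V) :
    dist (K + L) (K' + L') ≤ dist K K' + dist L L' := by
  rw [dist_le_iff (by positivity)]
  obtain ⟨a, b⟩ := (dist_le_iff dist_nonneg).1 (le_refl (dist K K'))
  obtain ⟨c, d⟩ := (dist_le_iff dist_nonneg).1 (le_refl (dist L L'))
  constructor
  · rintro _ ⟨x, hx, y, hy, rfl⟩
    obtain ⟨x', hx', h1⟩ := a x hx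
    obtain ⟨y', hy', h2⟩ := c y hy
    exact ⟨x' + y', ⟨x', hx', y', hy', rfl⟩, (_root_.dist_add_add_le _ _ _ _).trans (add_le_add h1 h2)⟩
  · rintro _ ⟨x, hx, y, hy, rfl⟩
    obtain ⟨x', hx', h1⟩ := b x hx
    obtain ⟨y', hy', h2⟩ := d y hy
    exact ⟨x' + y', ⟨x', hx', y', hy', rfl⟩, (_root_.dist_add_add_le _ _ _ _).trans (add_le_add h1 h2)⟩

instance : ContinuousAdd (ConvexBody V) where
  continuous_add := by
    refine (LipschitzWith.of_dist_le_mul (K := 2) fun p q => ?_).continuous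
    refine (dist_add_le _ _ _ _).trans ?_
    rw [Prod.dist_eq]
    have := le_max_left (dist p.1 q.1) (dist p.2 q.2)
    have := le_max_right (dist p.1 q.1) (dist p.2 q.2)
    push_cast; linarith

theorem dist_mapCLM_le (f : V →L[ℝ] V') (K L : ConvexBody V) :
    dist (K.mapCLM f) (L.mapCLM f) ≤ ‖f‖ * dist K L := by
  rw [dist_le_iff (by positivity)]
  obtain ⟨a, b⟩ := (dist_le_iff dist_nonneg).1 (le_refl (dist K L))
  constructor
  · rintro _ ⟨x, hx, rfl⟩
    obtain ⟨x', hx', h1⟩ := a x hx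
    exact ⟨f x', ⟨x', hx', rfl⟩, (f.dist_le_opNorm _ _).trans (by gcongr)⟩
  · rintro _ ⟨x, hx, rfl⟩
    obtain ⟨x', hx', h1⟩ := b x hx
    exact ⟨f x', ⟨x', hx', rfl⟩, (f.dist_le_opNorm _ _).trans (by gcongr)⟩

theorem continuous_mapCLM (f : V →L[ℝ] V') : Continuous (mapCLM f) :=
  (LipschitzWith.of_dist_le_mul (K := ⟨‖f‖, norm_nonneg _⟩)
    fun K L => dist_mapCLM_le f K L).continuous

theorem continuous_neg' : Continuous (neg : ConvexBody V → ConvexBody V) := continuous_mapCLM _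

theorem continuous_smul_const (K : ConvexBody V) : Continuous fun t : ℝ => t • K := by
  obtain ⟨R, hR0, hR⟩ := K.isBounded.exists_pos_norm_le
  refine (LipschitzWith.of_dist_le_mul (K := ⟨R, hR0.le⟩) fun s t => ?_).continuous
  have key : ∀ s t : ℝ, ∀ x ∈ s • K, ∃ y ∈ t • K, dist x y ≤ R * dist s t := by
    rintro s t _ ⟨x, hx, rfl⟩
    refine ⟨t • x, ⟨x, hx, rfl⟩, ?_⟩
    simp only
    rw [dist_eq_norm, ← sub_smul, norm_smul, mul_comm, dist_eq_norm]
    gcongr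
    exact hR x hx
  rw [dist_le_iff (by positivity)]
  refine ⟨key s t, ?_⟩
  rw [dist_comm s t]
  exact key t s

theorem zero_smul_body (K : ConvexBody V) : (0 : ℝ) • K = 0 := by
  ext1; simp [Set.zero_smul_set K.nonempty]

theorem add_smul_body (K : ConvexBody V) {s t : ℝ} (hs : 0 ≤ s) (ht : 0 ≤ t) :
    (s + t) • K = s • K + t • K :=
  ConvexBody.ext (K.convex.add_smul hs ht)

theorem exists_mem_segment_inter {s t : Set V} (hs : IsClosed s) (ht : IsClosed t)
    (hc : Convex ℝ (s ∪ t)) {x y : V} (hx : x ∈ s) (hy : y ∈ t) :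
    ∃ z ∈ segment ℝ x y, z ∈ s ∩ t := by
  have h := isPreconnected_closed_iff.1 (convex_segment (𝕜 := ℝ) x y).isPreconnected s t hs ht
    (hc.segment_subset (Or.inl hx) (Or.inr hy)) ⟨x, left_mem_segment ℝ x y, hx⟩
    ⟨y, right_mem_segment ℝ x y, hy⟩
  exact h

theorem image_inter_of_convex_union (f : V →L[ℝ] V') (K L : ConvexBody V)
    (hU : Convex ℝ ((K : Set V) ∪ L)) :
    f '' ((K : Set V) ∩ L) = f '' K ∩ f '' L := by
  refine (Set.image_inter_subset _ _ _).antisymm ?_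
  rintro _ ⟨⟨x, hx, rfl⟩, ⟨y, hy, e⟩⟩
  obtain ⟨z, hz, hz'⟩ := exists_mem_segment_inter K.isClosed L.isClosed hU hx hy
  refine ⟨z, hz', ?_⟩
  obtain ⟨a, b, ha, hb, hab, rfl⟩ := hz
  rw [map_add, map_smul, map_smul, e, ← add_smul, hab, one_smul]

theorem inter_add_of_convex_union (K L S : ConvexBody V) (hU : Convex ℝ ((K : Set V) ∪ L)) :
    ((K : Set V) ∩ L) + S = ((K : Set V) + S) ∩ (L + S) := by
  refine Set.inter_add_subset.antisymm ?_
  rintro _ ⟨⟨x, hx, s, hs, rfl⟩, ⟨y, hy, s', hs', e⟩⟩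
  obtain ⟨z, hz, hz'⟩ := exists_mem_segment_inter K.isClosed L.isClosed hU hx hy
  obtain ⟨a, b, ha, hb, hab, rfl⟩ := hz
  refine ⟨_, hz', a • s + b • s', S.convex hs hs' ha hb hab, ?_⟩
  simp only at e ⊢
  calc a • x + b • y + (a • s + b • s') = a • (x + s) + b • (y + s') := by module
    _ = x + s := by rw [e, ← add_smul, hab, one_smul]

end ConvexBody

section

open ConvexBody

/-- Continuous, translation invariant valuations on convex bodies. -/
structure IsCTValuation {V : Type*} [NormedAddCommGroup V] [NormedSpace ℝ V]
    (φ : ConvexBody V → ℝ) : Prop where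
  cont : Continuous φ
  trans : IsTranslationInvariant φ
  val : IsValuation φ

/-- Homogeneity of degree `j` under nonnegative dilations. -/
def IsHomogeneousOfDegree {V : Type*} [NormedAddCommGroup V] [NormedSpace ℝ V]
    (φ : ConvexBody V → ℝ) (j : ℕ) : Prop :=
  ∀ (K : ConvexBody V) (t : ℝ), 0 ≤ t → φ (t • K) = t ^ j * φ K

namespace IsCTValuation

variable {V V' : Type*} [NormedAddCommGroup V] [NormedSpace ℝ V]
  [NormedAddCommGroup V'] [NormedSpace ℝ V'] {φ ψ : ConvexBody V → ℝ}

theorem val' (h : IsCTValuation φ) {K L U I : ConvexBody V} (hU : (U : Set V) = (K : Set V) ∪ L)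
    (hI : (I : Set V) = (K : Set V) ∩ L) : φ U + φ I = φ K + φ L := by
  have h1 : Convex ℝ ((K : Set V) ∪ L) := hU ▸ U.convex
  have h2 : ((K : Set V) ∩ L).Nonempty := hI ▸ I.nonempty
  have e1 : U = K.union L h1 := ConvexBody.ext hU
  have e2 : I = K.inter L h2 := ConvexBody.ext hI
  rw [e1, e2, h.val]

theorem add (h : IsCTValuation φ) (h' : IsCTValuation ψ) :
    IsCTValuation fun K => φ K + ψ K where
  cont := h.cont.add h'.cont
  trans K x := by simp only [h.trans K x, h'.trans K x]
  val K L hU hI := by linarith [h.val K L hU hI, h'.val K L hU hI]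

theorem sub (h : IsCTValuation φ) (h' : IsCTValuation ψ) :
    IsCTValuation fun K => φ K - ψ K where
  cont := h.cont.sub h'.cont
  trans K x := by simp only [h.trans K x, h'.trans K x]
  val K L hU hI := by linarith [h.val K L hU hI, h'.val K L hU hI]

theorem comp_mapCLM {φ : ConvexBody V' → ℝ} (h : IsCTValuation φ) (f : V →L[ℝ] V') :
    IsCTValuation fun K => φ (K.mapCLM f) where
  cont := h.cont.comp (continuous_mapCLM f)
  trans K x := by simp only [mapCLM_translate]; rw [h.trans]
  val K L hU hI := h.val' (Set.image_union _ _ _) (image_inter_of_convex_union f K L hU)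

theorem comp_neg (h : IsCTValuation φ) : IsCTValuation fun K => φ K.neg := h.comp_mapCLM _

theorem comp_add (h : IsCTValuation φ) (S : ConvexBody V) :
    IsCTValuation fun K => φ (K + S) where
  cont := h.cont.comp (continuous_id.add continuous_const)
  trans K x := by simp only [translate_add_body]; rw [h.trans]
  val K L hU hI := h.val' (Set.union_add) (inter_add_of_convex_union K L S hU)

theorem diff (h : IsCTValuation φ) (S : ConvexBody V) :
    IsCTValuation fun K => φ (K + S) - φ K := (h.comp_add S).sub h

theorem point (h : IsCTValuation φ) (x : V) : φ (ConvexBody.point x) = φ 0 := by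
  rw [← h.trans 0 x, ← point_add, add_zero]

end IsCTValuation

end

namespace ConvexBody

variable {V : Type*} [NormedAddCommGroup V] [NormedSpace ℝ V]

/-- The unit interval as a convex body. -/
def unitIcc : ConvexBody ℝ := ⟨Set.Icc 0 1, convex_Icc 0 1, isCompact_Icc, ⟨0, by simp⟩⟩

/-- The standard triangle in the plane. -/
def stdTriangle : ConvexBody (ℝ × ℝ) :=
  ⟨{p | 0 ≤ p.1 ∧ 0 ≤ p.2 ∧ p.1 + p.2 ≤ 1}, by
    rintro ⟨x, y⟩ ⟨h1, h2, h3⟩ ⟨x', y'⟩ ⟨h1', h2', h3'⟩ a b ha hb hab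
    simp only [Set.mem_ofPred_eq, Prod.fst_add, Prod.snd_add, Prod.smul_fst, Prod.smul_snd,
      smul_eq_mul] at *
    refine ⟨by positivity, by positivity, ?_⟩
    nlinarith, by
    refine (isCompact_Icc (a := (0 : ℝ × ℝ)) (b := 1)).of_isClosed_subset ?_ ?_
    · exact (isClosed_le continuous_const continuous_fst).inter
        ((isClosed_le continuous_const continuous_snd).inter
        (isClosed_le (continuous_fst.add continuous_snd) continuous_const))
    · rintro ⟨x, y⟩ ⟨h1, h2, h3⟩
      simp only at h1 h2 h3
      exact ⟨⟨h1, h2⟩, ⟨by simp only [Prod.fst_one]; linarith, by simp only [Prod.snd_one]; linarith⟩⟩,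
    ⟨0, by simp⟩⟩

/-- The linear map from the plane sending the standard basis to `a, b`. -/
def planeMap (a b : V) : ℝ × ℝ →L[ℝ] V :=
  (ContinuousLinearMap.toSpanSingleton ℝ a).coprod (ContinuousLinearMap.toSpanSingleton ℝ b)

@[simp] theorem planeMap_apply (a b : V) (p : ℝ × ℝ) : planeMap a b p = p.1 • a + p.2 • b := by
  simp [planeMap]

/-- The segment from `0` to `a`. -/
def seg (a : V) : ConvexBody V := unitIcc.mapCLM (ContinuousLinearMap.toSpanSingleton ℝ a)

/-- The triangle with vertices `0, a, b`. -/
def tri (a b : V) : ConvexBody V := stdTriangle.mapCLM (planeMap a b)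

theorem mem_seg {a x : V} : x ∈ seg a ↔ ∃ t : ℝ, (0 ≤ t ∧ t ≤ 1) ∧ t • a = x := Iff.rfl

theorem mem_tri {a b x : V} :
    x ∈ tri a b ↔ ∃ s t : ℝ, 0 ≤ s ∧ 0 ≤ t ∧ s + t ≤ 1 ∧ s • a + t • b = x := by
  constructor
  · rintro ⟨p, ⟨h1, h2, h3⟩, rfl⟩
    exact ⟨p.1, p.2, h1, h2, h3, by simp⟩
  · rintro ⟨s, t, h1, h2, h3, rfl⟩
    exact ⟨(s, t), ⟨h1, h2, h3⟩, by simp⟩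

theorem mem_smul_body {t : ℝ} {K : ConvexBody V} {x : V} :
    x ∈ t • K ↔ ∃ y ∈ K, t • y = x := Iff.rfl

theorem mem_add_body {K L : ConvexBody V} {x : V} :
    x ∈ K + L ↔ ∃ y ∈ K, ∃ z ∈ L, y + z = x := Iff.rfl

theorem mem_translate {K : ConvexBody V} {x y : V} : y ∈ K.translate x ↔ y - x ∈ K := by
  constructor
  · rintro ⟨z, hz, rfl⟩; simpa using hz
  · intro h; exact ⟨y - x, h, by simp⟩

theorem mem_neg_body {K : ConvexBody V} {x : V} : x ∈ K.neg ↔ -x ∈ K := by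
  rw [← SetLike.mem_coe, coe_neg]; rfl

theorem mem_smul_unitIcc {t x : ℝ} (ht : 0 ≤ t) : x ∈ t • unitIcc ↔ 0 ≤ x ∧ x ≤ t := by
  rw [mem_smul_body]
  constructor
  · rintro ⟨y, ⟨h0, h1⟩, rfl⟩
    simp only [smul_eq_mul]
    exact ⟨by positivity, by nlinarith⟩
  · rintro ⟨h0, h1⟩
    rcases ht.eq_or_lt with rfl | ht
    · exact ⟨0, ⟨le_rfl, zero_le_one⟩, by simp; linarith⟩
    · exact ⟨x / t, ⟨by positivity, by rw [div_le_one ht]; exact h1⟩, by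
        simp only [smul_eq_mul]; field_simp⟩

theorem mem_smul_stdTriangle {t : ℝ} {p : ℝ × ℝ} (ht : 0 ≤ t) :
    p ∈ t • stdTriangle ↔ 0 ≤ p.1 ∧ 0 ≤ p.2 ∧ p.1 + p.2 ≤ t := by
  rw [mem_smul_body]
  obtain ⟨x, y⟩ := p
  constructor
  · rintro ⟨⟨x', y'⟩, ⟨h0, h1, h2⟩, e⟩
    simp only [Prod.smul_mk, smul_eq_mul, Prod.mk.injEq] at e h0 h1 h2 ⊢
    obtain ⟨rfl, rfl⟩ := e
    exact ⟨by positivity, by positivity, by nlinarith⟩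
  · rintro ⟨h0, h1, h2⟩
    simp only at h0 h1 h2
    rcases ht.eq_or_lt with rfl | ht
    · exact ⟨0, ⟨le_rfl, le_rfl, by simp⟩, by
        rw [zero_smul]; ext <;> simp <;> linarith⟩
    · exact ⟨(x / t, y / t), ⟨by simp only; positivity, by simp only; positivity, by
        simp only; rw [← add_div, div_le_one ht]; exact h2⟩, by
        simp only [Prod.smul_mk, smul_eq_mul]; congr 1 <;> field_simp⟩

theorem mem_smul_seg_snd {t : ℝ} {p : ℝ × ℝ} (ht : 0 ≤ t) :
    p ∈ t • seg ((0, 1) : ℝ × ℝ) ↔ p.1 = 0 ∧ 0 ≤ p.2 ∧ p.2 ≤ t := by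
  rw [seg, ← mapCLM_smul]
  constructor
  · rintro ⟨x, hx, rfl⟩
    rw [SetLike.mem_coe, mem_smul_unitIcc ht] at hx
    simpa using hx
  · rintro ⟨h0, h1, h2⟩
    refine ⟨p.2, ?_, ?_⟩
    · rw [SetLike.mem_coe, mem_smul_unitIcc ht]; exact ⟨h1, h2⟩
    · ext <;> simp [h0]

theorem mapCLM_seg {V' : Type*} [NormedAddCommGroup V'] [NormedSpace ℝ V'] (f : V →L[ℝ] V')
    (a : V) : (seg a).mapCLM f = seg (f a) := by
  ext1
  simp only [seg, coe_mapCLM, Set.image_image]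
  simp [ContinuousLinearMap.toSpanSingleton]

theorem mapCLM_point {V' : Type*} [NormedAddCommGroup V'] [NormedSpace ℝ V'] (f : V →L[ℝ] V')
    (a : V) : (point a).mapCLM f = point (f a) := by
  ext1; simp

theorem seg_neg (a : V) : (seg a).neg = (seg a).translate (-a) := by
  refine SetLike.ext fun x => ?_
  rw [mem_neg_body, mem_translate, mem_seg, mem_seg]
  constructor
  · rintro ⟨t, h, e⟩
    refine ⟨1 - t, ⟨by linarith, by linarith⟩, ?_⟩
    rw [sub_smul, one_smul, e]; abel
  · rintro ⟨t, h, e⟩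
    refine ⟨1 - t, ⟨by linarith, by linarith⟩, ?_⟩
    rw [sub_smul, one_smul, e]; abel

end ConvexBody

section

open ConvexBody

/-- Minkowski addition of `L` leaves `φ` unchanged. -/
def IsNeutralFor {V : Type*} [NormedAddCommGroup V] [NormedSpace ℝ V]
    (φ : ConvexBody V → ℝ) (L : ConvexBody V) : Prop := ∀ K, φ (K + L) = φ K

theorem eq_mul_of_additive_nonneg {f : ℝ → ℝ} (hc : Continuous f)
    (hadd : ∀ s t, 0 ≤ s → 0 ≤ t → f (s + t) = f s + f t) {t : ℝ} (ht : 0 ≤ t) :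
    f t = t * f 1 := by
  have h0 : f 0 = 0 := by have := hadd 0 0 le_rfl le_rfl; simp at this; exact this
  let g : ℝ →+ ℝ :=
    { toFun := fun t => f (max t 0) - f (max (-t) 0)
      map_zero' := by simp
      map_add' := fun a b => by
        have e : max (a + b) 0 + (max (-a) 0 + max (-b) 0) =
            max (-(a + b)) 0 + (max a 0 + max b 0) := by
          have := max_zero_sub_max_neg_zero_eq_self a
          have := max_zero_sub_max_neg_zero_eq_self b
          have := max_zero_sub_max_neg_zero_eq_self (a + b)
          linarith
        have h := congrArg f e
        rw [hadd _ _ (by positivity) (by positivity), hadd _ _ (by positivity) (by positivity),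
          hadd _ _ (by positivity) (by positivity), hadd _ _ (by positivity) (by positivity)] at h
        linarith }
  have hg : Continuous g := by
    change Continuous fun t => f (max t 0) - f (max (-t) 0)
    fun_prop
  have := map_real_smul g hg t 1
  change f (max (t • 1) 0) - f (max (-(t • 1)) 0) = t * (f (max 1 0) - f (max (-1) 0)) at this
  simp only [smul_eq_mul, mul_one] at this
  rw [max_eq_left ht, max_eq_right (by linarith), max_eq_left zero_le_one,
    max_eq_right (by norm_num), h0] at this
  linarith

namespace IsCTValuation

variable {V : Type*} [NormedAddCommGroup V] [NormedSpace ℝ V] {φ ψ : ConvexBody V → ℝ}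

theorem const_add (h : IsCTValuation φ) (K : ConvexBody V) :
    IsCTValuation fun L => φ (K + L) := by
  simpa only [add_comm] using h.comp_add K

theorem smul_seg_add (h : IsCTValuation φ) (a : V) {s t : ℝ} (hs : 0 ≤ s) (ht : 0 ≤ t) :
    φ ((s + t) • seg a) + φ 0 = φ (s • seg a) + φ (t • seg a) := by
  let f := ContinuousLinearMap.toSpanSingleton ℝ a
  have h' := h.comp_mapCLM f
  have key := h'.val' (K := s • unitIcc) (L := (t • unitIcc).translate s) (U := (s + t) • unitIcc)
    (I := ConvexBody.point s) (by
      ext x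
      simp only [Set.mem_union, SetLike.mem_coe, mem_translate, mem_smul_unitIcc hs,
        mem_smul_unitIcc ht, mem_smul_unitIcc (add_nonneg hs ht)]
      constructor
      · rintro ⟨h1, h2⟩
        rcases le_total x s with h3 | h3
        · exact Or.inl ⟨h1, h3⟩
        · exact Or.inr ⟨by linarith, by linarith⟩
      · rintro (⟨h1, h2⟩ | ⟨h1, h2⟩) <;> constructor <;> linarith) (by
      ext x
      simp only [Set.mem_inter_iff, SetLike.mem_coe, mem_translate, mem_smul_unitIcc hs,
        mem_smul_unitIcc ht, coe_point, Set.mem_singleton_iff]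
      constructor
      · rintro rfl; refine ⟨⟨?_, ?_⟩, ?_, ?_⟩ <;> linarith
      · rintro ⟨⟨h1, h2⟩, h3, h4⟩; linarith)
  have e := h'.trans (t • unitIcc) s
  rw [e, mapCLM_smul, mapCLM_smul, mapCLM_smul, mapCLM_point, h.point] at key
  exact key

theorem smul_tri_add (h : IsCTValuation φ) (a b : V) {s t : ℝ} (hs : 0 ≤ s) (ht : 0 ≤ t) :
    φ ((s + t) • tri a b) + φ (t • seg b) = φ (s • tri a b + t • seg b) + φ (t • tri a b) := by
  let f := planeMap a b
  have h' := h.comp_mapCLM f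
  have key := h'.val' (K := s • stdTriangle + t • seg ((0, 1) : ℝ × ℝ))
    (L := (t • stdTriangle).translate (s, 0)) (U := (s + t) • stdTriangle)
    (I := (t • seg ((0, 1) : ℝ × ℝ)).translate (s, 0))
  have hB : ∀ p, p ∈ s • stdTriangle + t • seg ((0, 1) : ℝ × ℝ) ↔
      (0 ≤ p.1 ∧ p.1 ≤ s) ∧ 0 ≤ p.2 ∧ p.1 + p.2 ≤ s + t := by
    rintro ⟨x, y⟩
    rw [mem_add_body]
    simp only [mem_smul_stdTriangle hs, mem_smul_seg_snd ht]
    constructor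
    · rintro ⟨⟨x1, y1⟩, h1, ⟨x2, y2⟩, h2, e⟩
      simp only [Prod.mk_add_mk, Prod.mk.injEq] at h1 h2 e
      obtain ⟨rfl, rfl⟩ := e
      refine ⟨⟨?_, ?_⟩, ?_, ?_⟩ <;> linarith
    · rintro ⟨⟨h1, h2⟩, h3, h4⟩
      refine ⟨(x, y - min y t), ⟨h1, ?_, ?_⟩, (0, min y t), ⟨rfl, le_min h3 ht, min_le_right _ _⟩,
        by simp⟩
      · simp
      · rcases min_choice y t with e | e <;> rw [e] <;> linarith
  specialize key (by
    ext ⟨x, y⟩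
    simp only [Set.mem_union, SetLike.mem_coe, mem_translate, hB,
        mem_smul_stdTriangle ht, mem_smul_stdTriangle (add_nonneg hs ht), Prod.fst_sub,
        Prod.snd_sub]
    constructor
    · rintro ⟨h1, h2, h3⟩
      rcases le_total x s with h4 | h4
      · exact Or.inl ⟨⟨h1, h4⟩, h2, h3⟩
      · exact Or.inr ⟨by linarith, by linarith, by linarith⟩
    · rintro (⟨⟨h1, h2⟩, h3, h4⟩ | ⟨h1, h2, h3⟩) <;> refine ⟨?_, ?_, ?_⟩ <;> linarith)
  specialize key (by
    ext ⟨x, y⟩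
    simp only [Set.mem_inter_iff, SetLike.mem_coe, mem_translate, hB,
        mem_smul_stdTriangle ht, mem_smul_seg_snd ht, Prod.fst_sub,
        Prod.snd_sub]
    constructor
    · rintro ⟨h1, h2, h3⟩
      refine ⟨⟨⟨?_, ?_⟩, ?_, ?_⟩, ?_, ?_, ?_⟩ <;> linarith
    · rintro ⟨⟨⟨h1, h2⟩, h3, h4⟩, h5, h6, h7⟩
      refine ⟨?_, ?_, ?_⟩ <;> linarith)
  have e1 := h'.trans (t • stdTriangle) (s, 0)
  have e2 := h'.trans (t • seg ((0, 1) : ℝ × ℝ)) (s, 0)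
  rw [e1, e2, mapCLM_smul, mapCLM_smul, mapCLM_smul, mapCLM_add, mapCLM_smul, mapCLM_smul,
    mapCLM_seg] at key
  simpa [f, tri] using key

theorem seg_add_seg (h : IsCTValuation φ) (a b : V) :
    φ (seg a + seg b) + φ (seg (b - a)) = φ (tri a b) + φ (tri a b).neg := by
  let f := planeMap a b
  have h' := h.comp_mapCLM f
  have hS : ∀ p, p ∈ seg ((1, 0) : ℝ × ℝ) + seg ((0, 1) : ℝ × ℝ) ↔
      (0 ≤ p.1 ∧ p.1 ≤ 1) ∧ 0 ≤ p.2 ∧ p.2 ≤ 1 := by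
    rintro ⟨x, y⟩
    rw [mem_add_body]
    simp only [mem_seg]
    constructor
    · rintro ⟨_, ⟨s, hs, rfl⟩, _, ⟨t, ht, rfl⟩, e⟩
      simp only [Prod.smul_mk, smul_eq_mul, Prod.mk_add_mk, Prod.mk.injEq] at e
      obtain ⟨rfl, rfl⟩ := e
      simpa using ⟨hs, ht⟩
    · rintro ⟨hs, ht⟩
      exact ⟨_, ⟨x, hs, rfl⟩, _, ⟨y, ht, rfl⟩, by simp⟩
  have hT : ∀ p, p ∈ stdTriangle ↔ 0 ≤ p.1 ∧ 0 ≤ p.2 ∧ p.1 + p.2 ≤ 1 := fun p => Iff.rfl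
  have key := h'.val' (K := stdTriangle) (L := stdTriangle.neg.translate (1, 1))
    (U := seg ((1, 0) : ℝ × ℝ) + seg ((0, 1) : ℝ × ℝ))
    (I := (seg ((-1, 1) : ℝ × ℝ)).translate (1, 0)) (by
      ext ⟨x, y⟩
      simp only [Set.mem_union, SetLike.mem_coe, mem_translate, hS, hT, mem_neg_body,
        Prod.fst_neg, Prod.snd_neg, Prod.fst_sub, Prod.snd_sub]
      constructor
      · rintro ⟨⟨h1, h2⟩, h3, h4⟩
        rcases le_total (x + y) 1 with h5 | h5
        · exact Or.inl ⟨h1, h3, h5⟩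
        · exact Or.inr ⟨by linarith, by linarith, by linarith⟩
      · rintro (⟨h1, h2, h3⟩ | ⟨h1, h2, h3⟩) <;> refine ⟨⟨?_, ?_⟩, ?_, ?_⟩ <;> linarith) (by
      ext ⟨x, y⟩
      simp only [Set.mem_inter_iff, SetLike.mem_coe, mem_translate, hT, mem_neg_body,
        Prod.fst_neg, Prod.snd_neg, Prod.fst_sub, Prod.snd_sub, mem_seg]
      constructor
      · rintro ⟨t, ht, e⟩
        simp only [Prod.smul_mk, smul_eq_mul, Prod.mk_sub_mk, Prod.mk.injEq] at e
        obtain ⟨e1, e2⟩ := e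
        refine ⟨⟨?_, ?_, ?_⟩, ?_, ?_, ?_⟩ <;> linarith
      · rintro ⟨⟨h1, h2, h3⟩, h4, h5, h6⟩
        refine ⟨y, ⟨by linarith, by linarith⟩, ?_⟩
        simp only [Prod.smul_mk, smul_eq_mul, Prod.mk_sub_mk, Prod.mk.injEq]
        constructor <;> linarith)
  have e1 := h'.trans stdTriangle.neg (1, 1)
  have e2 := h'.trans (seg ((-1, 1) : ℝ × ℝ)) (1, 0)
  rw [e1, e2, mapCLM_add, mapCLM_seg, mapCLM_seg, mapCLM_seg, mapCLM_neg] at key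
  simp only [f, planeMap_apply, one_smul, zero_smul, add_zero, zero_add, neg_smul,
    ← sub_eq_neg_add] at key
  exact key

/-- Additivity of `t ↦ φ(K + tL) - φ(K)` makes the difference linear in `t`. -/
theorem diff_smul (h : IsCTValuation φ) {K L : ConvexBody V}
    (hadd : ∀ s t : ℝ, 0 ≤ s → 0 ≤ t →
      φ (K + (s + t) • L) + φ K = φ (K + s • L) + φ (K + t • L)) {t : ℝ} (ht : 0 ≤ t) :
    φ (K + t • L) - φ K = t * (φ (K + L) - φ K) := by
  have hc : Continuous fun t : ℝ => φ (K + t • L) - φ K :=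
    (h.cont.comp (continuous_const.add (continuous_smul_const L))).sub continuous_const
  have := eq_mul_of_additive_nonneg hc (fun s t hs ht => by linarith [hadd s t hs ht]) ht
  simpa using this

theorem diff_homogeneous (h : IsCTValuation φ) {j : ℕ} (hφ : IsHomogeneousOfDegree φ (j + 1))
    {L : ConvexBody V}
    (hadd : ∀ K, ∀ s t : ℝ, 0 ≤ s → 0 ≤ t →
      φ (K + (s + t) • L) + φ K = φ (K + s • L) + φ (K + t • L)) :
    IsHomogeneousOfDegree (fun K => φ (K + L) - φ K) j := by
  intro K
  have hpos : ∀ t : ℝ, 0 < t → φ (t • K + L) - φ (t • K) - t ^ j * (φ (K + L) - φ K) = 0 := by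
    intro t ht
    have e : t • K + L = t • (K + t⁻¹ • L) := by
      rw [smul_add, smul_smul, mul_inv_cancel₀ ht.ne', one_smul]
    have := h.diff_smul (K := K) (hadd K) (inv_nonneg.2 ht.le)
    rw [e, hφ _ _ ht.le, hφ _ _ ht.le, ← mul_sub, this, pow_succ]
    field_simp
    ring
  have hc : Continuous fun t : ℝ =>
      φ (t • K + L) - φ (t • K) - t ^ j * (φ (K + L) - φ K) := by
    have h1 := h.cont.comp (continuous_smul_const K)
    have h2 := h.cont.comp ((continuous_smul_const K).add (continuous_const (y := L)))
    exact (h2.sub h1).sub ((continuous_pow j).mul continuous_const)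
  have hcl : Set.Ici (0 : ℝ) ⊆
      {t | φ (t • K + L) - φ (t • K) - t ^ j * (φ (K + L) - φ K) = 0} := by
    rw [← closure_Ioi]
    exact closure_minimal hpos (isClosed_eq hc continuous_const)
  intro t ht
  have := hcl ht
  simp only [Set.mem_ofPred_eq] at this
  simp only
  linarith

theorem diff_seg_homogeneous (h : IsCTValuation φ) {j : ℕ}
    (hφ : IsHomogeneousOfDegree φ (j + 1)) (a : V) :
    IsHomogeneousOfDegree (fun K => φ (K + seg a) - φ K) j :=
  h.diff_homogeneous hφ fun K s t hs ht => by
    simpa using (h.const_add K).smul_seg_add a hs ht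

theorem smul_seg (a : V) (t : ℝ) : t • seg a = seg (t • a) := by
  ext1
  simp only [seg, coe_smul, coe_mapCLM, ← Set.image_smul, Set.image_image]
  simp [smul_smul, mul_comm, ContinuousLinearMap.toSpanSingleton]

theorem diff_tri_homogeneous (h : IsCTValuation φ) {j : ℕ}
    (hφ : IsHomogeneousOfDegree φ (j + 1)) (hseg : ∀ a, IsNeutralFor φ (seg a)) (a b : V) :
    IsHomogeneousOfDegree (fun K => φ (K + tri a b) - φ K) j :=
  h.diff_homogeneous hφ fun K s t hs ht => by
    have := (h.const_add K).smul_tri_add a b hs ht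
    simp only [smul_seg, ← add_assoc] at this
    rwa [hseg, hseg] at this

theorem diff_tri_add_diff_tri_neg (h : IsCTValuation φ)
    (hseg : ∀ a, IsNeutralFor φ (seg a)) (a b : V) (K : ConvexBody V) :
    (φ (K + tri a b) - φ K) + (φ (K + (tri a b).neg) - φ K) = 0 := by
  have := (h.const_add K).seg_add_seg a b
  simp only [← add_assoc] at this
  rw [hseg, hseg, hseg] at this
  linarith

end IsCTValuation

end

namespace ConvexBody

variable {W : Type*} [NormedAddCommGroup W] [InnerProductSpace ℝ W]

/-- The support function of a convex body in an inner product space. -/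
def supp (K : ConvexBody W) (x : W) : ℝ := hSupp K (inner ℝ x)

theorem inner_le_supp {K : ConvexBody W} (x : W) {y : W} (hy : y ∈ K) : inner ℝ x y ≤ K.supp x :=
  le_csSup (K.isCompact.image (by fun_prop)).bddAbove (Set.mem_image_of_mem _ hy)

theorem exists_supp_eq (K : ConvexBody W) (x : W) : ∃ y ∈ K, K.supp x = inner ℝ x y := by
  obtain ⟨y, hy, h⟩ := (K.isCompact.image (f := inner ℝ x) (by fun_prop)).sSup_mem
    (K.nonempty.image _)
  exact ⟨y, hy, h.symm⟩

theorem supp_le_iff {K : ConvexBody W} {x : W} {c : ℝ} :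
    K.supp x ≤ c ↔ ∀ y ∈ K, inner ℝ x y ≤ c := by
  constructor
  · intro h y hy; exact (inner_le_supp x hy).trans h
  · intro h
    obtain ⟨y, hy, e⟩ := K.exists_supp_eq x
    exact e ▸ h y hy

theorem supp_eq_of {K : ConvexBody W} {x : W} {c : ℝ} (h : ∀ y ∈ K, inner ℝ x y ≤ c)
    (h' : ∃ y ∈ K, inner ℝ x y = c) : K.supp x = c := by
  obtain ⟨y, hy, rfl⟩ := h'
  exact le_antisymm (supp_le_iff.2 h) (inner_le_supp x hy)

theorem supp_add (K L : ConvexBody W) (x : W) : (K + L).supp x = K.supp x + L.supp x := by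
  obtain ⟨y, hy, e⟩ := K.exists_supp_eq x
  obtain ⟨z, hz, e'⟩ := L.exists_supp_eq x
  refine supp_eq_of ?_ ⟨y + z, ⟨y, hy, z, hz, rfl⟩, by rw [inner_add_right, e, e']⟩
  rintro _ ⟨a, ha, b, hb, rfl⟩
  simp only [inner_add_right]
  exact add_le_add (inner_le_supp x ha) (inner_le_supp x hb)

theorem supp_smul {t : ℝ} (ht : 0 ≤ t) (K : ConvexBody W) (x : W) :
    (t • K).supp x = t * K.supp x := by
  obtain ⟨y, hy, e⟩ := K.exists_supp_eq x
  refine supp_eq_of ?_ ⟨t • y, ⟨y, hy, rfl⟩, by rw [inner_smul_right, e]⟩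
  rintro _ ⟨a, ha, rfl⟩
  simp only [inner_smul_right]
  exact mul_le_mul_of_nonneg_left (inner_le_supp x ha) ht

theorem supp_point (a x : W) : (point a).supp x = inner ℝ x a :=
  supp_eq_of (by rintro _ rfl; exact le_rfl) ⟨a, rfl, rfl⟩

theorem supp_translate (K : ConvexBody W) (a x : W) :
    (K.translate a).supp x = inner ℝ x a + K.supp x := by
  rw [← point_add, supp_add, supp_point]

theorem supp_neg (K : ConvexBody W) (x : W) : K.neg.supp x = K.supp (-x) := by
  obtain ⟨y, hy, e⟩ := K.exists_supp_eq (-x)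
  refine supp_eq_of ?_ ⟨-y, mem_neg_body.2 (by simpa), by rw [e]; simp⟩
  intro z hz
  have := inner_le_supp (-x) (mem_neg_body.1 hz)
  simpa using this

theorem supp_smul_right {t : ℝ} (ht : 0 ≤ t) (K : ConvexBody W) (x : W) :
    K.supp (t • x) = t * K.supp x := by
  obtain ⟨y, hy, e⟩ := K.exists_supp_eq x
  refine supp_eq_of ?_ ⟨y, hy, by rw [real_inner_smul_left, e]⟩
  intro z hz
  rw [real_inner_smul_left]
  exact mul_le_mul_of_nonneg_left (inner_le_supp x hz) ht

theorem supp_add_right (K : ConvexBody W) (x y : W) : K.supp (x + y) ≤ K.supp x + K.supp y := by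
  refine supp_le_iff.2 fun z hz => ?_
  rw [inner_add_left]
  exact add_le_add (inner_le_supp x hz) (inner_le_supp y hz)

theorem supp_zero_right (K : ConvexBody W) : K.supp 0 = 0 := by
  simpa using K.supp_smul_right le_rfl 0

theorem supp_nonneg {K : ConvexBody W} (h : 0 ∈ K) (x : W) : 0 ≤ K.supp x := by
  simpa using inner_le_supp x h

theorem abs_supp_le {K : ConvexBody W} {R : ℝ} (h : ∀ y ∈ K, ‖y‖ ≤ R) (x : W) :
    |K.supp x| ≤ R * ‖x‖ := by
  obtain ⟨y, hy, e⟩ := K.exists_supp_eq x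
  rw [e, mul_comm]
  exact (abs_real_inner_le_norm x y).trans (by gcongr; exact h y hy)

theorem supp_seg (a x : W) : (seg a).supp x = max 0 (inner ℝ x a) := by
  apply le_antisymm
  · refine supp_le_iff.2 ?_
    rintro _ ⟨t, ⟨h0, h1⟩, rfl⟩
    simp only [ContinuousLinearMap.toSpanSingleton_apply, inner_smul_right]
    rcases le_total 0 (inner ℝ x a) with h | h
    · exact le_max_of_le_right (by nlinarith)
    · exact le_max_of_le_left (by nlinarith)
  · refine max_le ?_ ?_
    · exact supp_nonneg (mem_seg.2 ⟨0, by simp⟩) x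
    · exact inner_le_supp x (mem_seg.2 ⟨1, by simp⟩)

theorem supp_tri (a b x : W) : (tri a b).supp x = max 0 (max (inner ℝ x a) (inner ℝ x b)) := by
  apply le_antisymm
  · refine supp_le_iff.2 fun y hy => ?_
    obtain ⟨s, t, hs, ht, hst, rfl⟩ := mem_tri.1 hy
    rw [inner_add_right, inner_smul_right, inner_smul_right]
    set m := max 0 (max (inner ℝ x a) (inner ℝ x b))
    have h0 : 0 ≤ m := le_max_left _ _
    have h1 : inner ℝ x a ≤ m := (le_max_left _ _).trans (le_max_right _ _)
    have h2 : inner ℝ x b ≤ m := (le_max_right _ _).trans (le_max_right _ _)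
    nlinarith [mul_le_mul_of_nonneg_left h1 hs, mul_le_mul_of_nonneg_left h2 ht]
  · refine max_le ?_ (max_le ?_ ?_)
    · exact supp_nonneg (mem_tri.2 ⟨0, 0, by simp⟩) x
    · exact inner_le_supp x (mem_tri.2 ⟨1, 0, by simp⟩)
    · exact inner_le_supp x (mem_tri.2 ⟨0, 1, by simp⟩)

theorem continuous_supp (K : ConvexBody W) : Continuous K.supp := by
  obtain ⟨R, hR0, hR⟩ := K.isBounded.exists_pos_norm_le
  refine (LipschitzWith.of_dist_le_mul (K := ⟨R, hR0.le⟩) fun x y => ?_).continuous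
  rw [Real.dist_eq, dist_eq_norm]
  change _ ≤ R * ‖x - y‖
  have key : ∀ x y, K.supp x - K.supp y ≤ R * ‖x - y‖ := fun x y => by
    have h1 := K.supp_add_right (x - y) y
    have h2 := (abs_le.1 (abs_supp_le hR (x - y))).2
    rw [sub_add_cancel] at h1
    linarith
  rw [abs_sub_le_iff]
  exact ⟨key x y, by rw [norm_sub_rev]; exact key y x⟩

variable [FiniteDimensional ℝ W]

theorem mem_of_forall_inner_le {K : ConvexBody W} {y : W} (h : ∀ x, inner ℝ x y ≤ K.supp x) :
    y ∈ K := by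
  by_contra hy
  obtain ⟨f, u, h1, h2⟩ := geometric_hahn_banach_point_closed K.convex K.isClosed hy
  obtain ⟨z, hz, e⟩ := K.exists_supp_eq (-(InnerProductSpace.toDual ℝ W).symm f)
  have h3 := h (-(InnerProductSpace.toDual ℝ W).symm f)
  rw [e, inner_neg_left, inner_neg_left, InnerProductSpace.toDual_symm_apply,
    InnerProductSpace.toDual_symm_apply] at h3
  linarith [h2 z hz]

theorem le_of_supp_le {K L : ConvexBody W} (h : ∀ x, K.supp x ≤ L.supp x) {y : W} (hy : y ∈ K) :
    y ∈ L :=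
  mem_of_forall_inner_le fun x => (inner_le_supp x hy).trans (h x)

theorem supp_injective {K L : ConvexBody W} (h : ∀ x, K.supp x = L.supp x) : K = L :=
  SetLike.ext fun _ => ⟨le_of_supp_le fun x => (h x).le, le_of_supp_le fun x => (h x).ge⟩

/-- The closed ball of radius `r` around the origin. -/
def ball (r : ℝ) (hr : 0 ≤ r) : ConvexBody W :=
  ⟨Metric.closedBall 0 r, convex_closedBall 0 r, isCompact_closedBall 0 r, ⟨0, by simpa⟩⟩

theorem le_supp_ball (r : ℝ) (hr : 0 ≤ r) (x : W) : r * ‖x‖ ≤ (ball r hr).supp x := by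
  rcases eq_or_ne x 0 with rfl | hx
  · simp [supp_zero_right]
  have h : (r / ‖x‖) • x ∈ (ball r hr : ConvexBody W) := by
    have hx' := norm_pos_iff.2 hx
    change _ ∈ Metric.closedBall 0 r
    rw [mem_closedBall_zero_iff, norm_smul, Real.norm_of_nonneg (by positivity)]
    field_simp
    exact le_rfl
  refine le_trans (le_of_eq ?_) (inner_le_supp x h)
  rw [inner_smul_right, real_inner_self_eq_norm_sq]
  have hx' := norm_pos_iff.2 hx
  field_simp

theorem dist_le_of_supp {K L : ConvexBody W} {ε : ℝ} (hε : 0 ≤ ε)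
    (h : ∀ x, |K.supp x - L.supp x| ≤ ε * ‖x‖) : dist K L ≤ ε := by
  have key : ∀ K L : ConvexBody W, (∀ x, K.supp x - L.supp x ≤ ε * ‖x‖) →
      ∀ x ∈ K, ∃ y ∈ L, dist x y ≤ ε := by
    intro K L h x hx
    obtain ⟨y, hy, z, hz, rfl⟩ := le_of_supp_le (K := K) (L := L + ball ε hε) (fun x => by
      rw [supp_add]; linarith [h x, le_supp_ball ε hε x]) hx
    refine ⟨y, hy, ?_⟩
    rw [dist_eq_norm]
    simpa using mem_closedBall_zero_iff.1 hz
  rw [dist_le_iff hε]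
  exact ⟨key K L fun x => (abs_le.1 (h x)).2, key L K fun x => by linarith [(abs_le.1 (h x)).1]⟩

omit [FiniteDimensional ℝ W] in
theorem abs_supp_sub_le (K L : ConvexBody W) (x : W) :
    |K.supp x - L.supp x| ≤ dist K L * ‖x‖ := by
  obtain ⟨h1, h2⟩ := (dist_le_iff dist_nonneg).1 (le_refl (dist K L))
  have key : ∀ K L : ConvexBody W, ∀ d, (∀ x ∈ K, ∃ y ∈ L, dist x y ≤ d) →
      K.supp x - L.supp x ≤ d * ‖x‖ := by
    intro K L d h
    obtain ⟨y, hy, e⟩ := K.exists_supp_eq x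
    obtain ⟨z, hz, hd⟩ := h y hy
    have h1 := inner_le_supp x hz
    have h2 := real_inner_le_norm x (y - z)
    rw [inner_sub_right, ← dist_eq_norm] at h2
    nlinarith [norm_nonneg x]
  rw [abs_sub_le_iff]
  exact ⟨key K L _ h1, key L K _ h2⟩

theorem exists_supp_eq_of_sublinear (p : W → ℝ) {R : ℝ}
    (hsmul : ∀ t : ℝ, 0 < t → ∀ x, p (t • x) = t * p x) (hadd : ∀ x y, p (x + y) ≤ p x + p y)
    (hR : ∀ x, p x ≤ R * ‖x‖) : ∃ K : ConvexBody W, ∀ x, K.supp x = p x := by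
  have h0 : p 0 = 0 := by have := hsmul 2 two_pos 0; rw [smul_zero] at this; linarith
  let S : Set W := {y | ∀ x, inner ℝ x y ≤ p x}
  have hatt : ∀ x, ∃ y ∈ S, inner ℝ x y = p x := by
    intro x
    have H : ∀ c : ℝ, c • x = 0 → (RingHom.id ℝ) c • p x = 0 := by
      intro c hc
      rcases smul_eq_zero.1 hc with rfl | rfl
      · simp
      · simp [h0]
    let f := LinearPMap.mkSpanSingleton' x (p x) H
    obtain ⟨g, hg, hle⟩ := exists_extension_of_le_sublinear f p hsmul hadd (by
      rintro ⟨z, hz⟩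
      obtain ⟨c, rfl⟩ := Submodule.mem_span_singleton.1 hz
      change f ⟨c • x, hz⟩ ≤ p (c • x)
      rw [LinearPMap.mkSpanSingleton'_apply]
      change c * p x ≤ _
      rcases lt_trichotomy c 0 with hc | rfl | hc
      · have h1 := hadd (c • x) ((-c) • x)
        rw [← add_smul, add_neg_cancel, zero_smul, h0, hsmul (-c) (by linarith)] at h1
        linarith
      · simp [h0]
      · rw [hsmul c hc])
    refine ⟨(InnerProductSpace.toDual ℝ W).symm (LinearMap.toContinuousLinearMap g), ?_, ?_⟩
    · intro z
      rw [real_inner_comm, InnerProductSpace.toDual_symm_apply]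
      exact hle z
    · rw [real_inner_comm, InnerProductSpace.toDual_symm_apply]
      have hx : x ∈ f.domain := Submodule.mem_span_singleton_self x
      refine (hg ⟨x, hx⟩).trans ?_
      exact LinearPMap.mkSpanSingleton'_apply_self x (p x) H hx
  have hSc : IsClosed S := by
    have : S = ⋂ x, {y | inner ℝ x y ≤ p x} := by ext; simp [S]
    rw [this]
    exact isClosed_iInter fun x => isClosed_le (by fun_prop) continuous_const
  have hSb : S ⊆ Metric.closedBall 0 (max R 0) := by
    intro y hy
    rw [mem_closedBall_zero_iff]
    have h1 := (hy y).trans (hR y)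
    rw [real_inner_self_eq_norm_sq] at h1
    rcases (norm_nonneg y).eq_or_lt with h | h
    · rw [← h]; exact le_max_right _ _
    · exact le_max_of_le_left (by nlinarith)
  refine ⟨⟨S, ?_, (isCompact_closedBall 0 (max R 0)).of_isClosed_subset hSc hSb, ?_⟩, ?_⟩
  · intro y hy z hz a b ha hb hab x
    rw [inner_add_right, inner_smul_right, inner_smul_right]
    have : p x = a * p x + b * p x := by rw [← add_mul, hab, one_mul]
    rw [this]
    exact add_le_add (mul_le_mul_of_nonneg_left (hy x) ha) (mul_le_mul_of_nonneg_left (hz x) hb)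
  · obtain ⟨y, hy, -⟩ := hatt 0
    exact ⟨y, hy⟩
  · intro x
    exact supp_eq_of (fun y hy => hy x) (hatt x)

end ConvexBody

section

open ConvexBody

variable {W : Type*} [NormedAddCommGroup W] [InnerProductSpace ℝ W]

/-- Classes of convex bodies which are closed convex cones with cancellation, and contain all
points and triangles. -/
structure IsMinkowskiClass (G : Set (ConvexBody W)) : Prop where
  add_mem : ∀ {K L}, K ∈ G → L ∈ G → K + L ∈ G
  smul_mem : ∀ {t : ℝ} {K}, 0 ≤ t → K ∈ G → t • K ∈ G
  isClosed : IsClosed G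
  cancel : ∀ {C K L}, C + K = L → K ∈ G → L ∈ G → C ∈ G
  point_mem : ∀ a, point a ∈ G
  tri_mem : ∀ a b, tri a b ∈ G

theorem ConvexBody.continuous_supp_left (x : W) : Continuous fun K : ConvexBody W => K.supp x := by
  refine (LipschitzWith.of_dist_le_mul (K := ⟨‖x‖, norm_nonneg x⟩) fun K L => ?_).continuous
  rw [Real.dist_eq]
  exact (abs_supp_sub_le K L x).trans (mul_comm _ _).le

/-- The restriction of the support function to the unit ball. -/
def ConvexBody.suppMap (K : ConvexBody W) : C(Metric.closedBall (0 : W) 1, ℝ) :=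
  ⟨fun x => K.supp x, K.continuous_supp.comp continuous_subtype_val⟩

theorem integrable_supp {Ω : Type*} [MeasurableSpace Ω] [TopologicalSpace Ω]
    [OpensMeasurableSpace Ω] {μ : Measure Ω} {T : Ω → ConvexBody W}
    (hT : Continuous T) {g : Ω → ℝ} (hg : Integrable g μ) (hb : ∀ ω, ∀ y ∈ T ω, ‖y‖ ≤ g ω) (x : W) :
    Integrable (fun ω => (T ω).supp x) μ := by
  refine (hg.mul_const ‖x‖).mono' ((continuous_supp_left x).comp hT).aestronglyMeasurable ?_
  exact Filter.Eventually.of_forall fun ω => abs_supp_le (hb ω) x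

variable [FiniteDimensional ℝ W]

theorem ConvexBody.dist_suppMap_le (K L : ConvexBody W) : dist K.suppMap L.suppMap ≤ dist K L := by
  rw [ContinuousMap.dist_le dist_nonneg]
  rintro ⟨x, hx⟩
  rw [Real.dist_eq]
  refine (abs_supp_sub_le K L x).trans ?_
  rw [mem_closedBall_zero_iff] at hx
  nlinarith [dist_nonneg (x := K) (y := L)]

theorem ConvexBody.dist_le_dist_suppMap (K L : ConvexBody W) :
    dist K L ≤ dist K.suppMap L.suppMap := by
  refine dist_le_of_supp dist_nonneg fun x => ?_
  rcases eq_or_ne x 0 with rfl | hx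
  · simp [supp_zero_right]
  have hx' := norm_pos_iff.2 hx
  have hm : ‖x‖⁻¹ • x ∈ Metric.closedBall (0 : W) 1 := by
    rw [mem_closedBall_zero_iff, norm_smul, norm_inv, norm_norm, inv_mul_cancel₀ hx'.ne']
  have h := (ContinuousMap.dist_apply_le_dist (f := K.suppMap) (g := L.suppMap) ⟨_, hm⟩)
  rw [Real.dist_eq] at h
  change |K.supp (‖x‖⁻¹ • x) - L.supp (‖x‖⁻¹ • x)| ≤ _ at h
  rw [supp_smul_right (by positivity), supp_smul_right (by positivity), ← mul_sub, abs_mul,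
    abs_of_pos (by positivity : 0 < ‖x‖⁻¹), inv_mul_le_iff₀ hx'] at h
  linarith

namespace IsMinkowskiClass

variable {G : Set (ConvexBody W)}

omit [FiniteDimensional ℝ W] in
theorem translate_mem (hG : IsMinkowskiClass G) {K : ConvexBody W} (hK : K ∈ G) (a : W) :
    K.translate a ∈ G := by
  rw [← point_add]; exact hG.add_mem (hG.point_mem a) hK

theorem exists_mem_supp_eq_integral (hG : IsMinkowskiClass G)
    {Ω : Type*} [MeasurableSpace Ω] [TopologicalSpace Ω]
    [OpensMeasurableSpace Ω] [SecondCountableTopology Ω] {μ : Measure Ω} [IsFiniteMeasure μ]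
    {T : Ω → ConvexBody W}
    (hT : Continuous T) (hTG : ∀ ω, T ω ∈ G) {g : Ω → ℝ} (hg : Integrable g μ)
    (hb : ∀ ω, ∀ y ∈ T ω, ‖y‖ ≤ g ω) :
    ∃ M ∈ G, ∀ x, M.supp x = ∫ ω, (T ω).supp x ∂μ := by
  have hint := integrable_supp hT hg hb
  obtain ⟨M, hM⟩ := exists_supp_eq_of_sublinear (R := ∫ ω, g ω ∂μ)
    (fun x => ∫ ω, (T ω).supp x ∂μ)
    (fun t ht x => by simp only [supp_smul_right ht.le, integral_const_mul])
    (fun x y => by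
      rw [← integral_add (hint x) (hint y)]
      exact integral_mono (hint _) ((hint x).add (hint y)) fun ω => supp_add_right _ _ _)
    (fun x => by
      rw [← integral_mul_const]
      exact integral_mono (hint x) (hg.mul_const _) fun ω =>
        (le_abs_self _).trans (abs_supp_le (hb ω) x))
  refine ⟨M, ?_, hM⟩
  by_cases hμ : μ = 0
  · have : M = point 0 := supp_injective fun x => by rw [hM, supp_point, hμ]; simp
    rw [this]; exact hG.point_mem 0
  have : NeZero μ := ⟨hμ⟩
  have hcont : Continuous fun ω => (T ω).suppMap := by
    have : LipschitzWith 1 (suppMap : ConvexBody W → _) :=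
      LipschitzWith.of_dist_le_mul fun K L => by simpa using dist_suppMap_le K L
    exact this.continuous.comp hT
  have hintF : Integrable (fun ω => (T ω).suppMap) μ := by
    refine hg.mono' hcont.aestronglyMeasurable (Filter.Eventually.of_forall fun ω => ?_)
    have hg0 : 0 ≤ g ω := by
      obtain ⟨y, hy⟩ := (T ω).nonempty
      exact (norm_nonneg y).trans (hb ω y hy)
    rw [ContinuousMap.norm_le _ hg0]
    rintro ⟨x, hx⟩
    rw [mem_closedBall_zero_iff] at hx
    exact (abs_supp_le (hb ω) x).trans (by nlinarith)
  have hconv : Convex ℝ (suppMap '' G) := by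
    rintro _ ⟨K, hK, rfl⟩ _ ⟨L, hL, rfl⟩ a b ha hb hab
    refine ⟨a • K + b • L, hG.add_mem (hG.smul_mem ha hK) (hG.smul_mem hb hL), ?_⟩
    ext x
    change supp _ _ = a * K.supp x + b * L.supp x
    rw [supp_add, supp_smul ha, supp_smul hb]
  have havg := hconv.closure.average_mem isClosed_closure (μ := μ)
    (Filter.Eventually.of_forall fun ω => subset_closure ⟨T ω, hTG ω, rfl⟩) hintF
  set c := μ.real Set.univ
  have hc : 0 < c := by simp [c]
  have hN : (⨍ ω, (T ω).suppMap ∂μ) = (c⁻¹ • M).suppMap := by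
    rw [average_eq]
    ext x
    change c⁻¹ * (∫ ω, (T ω).suppMap ∂μ) x = (c⁻¹ • M).supp x
    rw [supp_smul (by positivity), hM]
    congr 1
    exact ((ContinuousMap.evalCLM ℝ x).integral_comp_comm hintF).symm
  have hmem : c⁻¹ • M ∈ G := by
    rw [← hG.isClosed.closure_eq, Metric.mem_closure_iff]
    intro ε hε
    rw [hN] at havg
    obtain ⟨_, ⟨L, hL, rfl⟩, hd⟩ := Metric.mem_closure_iff.1 havg ε hε
    exact ⟨L, hL, (dist_le_dist_suppMap _ _).trans_lt hd⟩
  have : M = c • c⁻¹ • M := by rw [smul_smul, mul_inv_cancel₀ hc.ne', one_smul]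
  rw [this]
  exact hG.smul_mem hc.le hmem

end IsMinkowskiClass

/-- Differences of support functions of bodies in `G`. -/
def IsSuppDiff (G : Set (ConvexBody W)) (f : W → ℝ) : Prop :=
  ∃ K ∈ G, ∃ L ∈ G, ∀ x, f x = L.supp x - K.supp x

namespace IsSuppDiff

variable {G : Set (ConvexBody W)} {f g : W → ℝ}

omit [FiniteDimensional ℝ W] in
theorem add (hG : IsMinkowskiClass G) (hf : IsSuppDiff G f) (hg : IsSuppDiff G g) :
    IsSuppDiff G fun x => f x + g x := by
  obtain ⟨K, hK, L, hL, h⟩ := hf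
  obtain ⟨K', hK', L', hL', h'⟩ := hg
  exact ⟨K + K', hG.add_mem hK hK', L + L', hG.add_mem hL hL', fun x => by
    simp only [supp_add, h, h']; ring⟩

omit [FiniteDimensional ℝ W] in
theorem const_mul (hG : IsMinkowskiClass G) (hf : IsSuppDiff G f) (c : ℝ) :
    IsSuppDiff G fun x => c * f x := by
  obtain ⟨K, hK, L, hL, h⟩ := hf
  rcases le_total 0 c with hc | hc
  · exact ⟨c • K, hG.smul_mem hc hK, c • L, hG.smul_mem hc hL, fun x => by
      simp only [supp_smul hc, h]; ring⟩
  · have hc' : 0 ≤ -c := by linarith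
    exact ⟨(-c) • L, hG.smul_mem hc' hL, (-c) • K, hG.smul_mem hc' hK, fun x => by
      simp only [supp_smul hc', h]; ring⟩

omit [FiniteDimensional ℝ W] in
theorem sum (hG : IsMinkowskiClass G) {ι : Type*} (s : Finset ι) {f : ι → W → ℝ}
    (hf : ∀ i ∈ s, IsSuppDiff G (f i)) : IsSuppDiff G fun x => ∑ i ∈ s, f i x := by
  classical
  induction s using Finset.induction_on with
  | empty => exact ⟨point 0, hG.point_mem 0, point 0, hG.point_mem 0, fun x => by simp⟩
  | insert i s hi ih =>
    simp only [Finset.sum_insert hi]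
    exact add hG (hf i (by simp)) (ih fun k hk => hf k (by simp [hk]))

theorem mem (hG : IsMinkowskiClass G) {C : ConvexBody W} (h : IsSuppDiff G C.supp) : C ∈ G := by
  obtain ⟨K, hK, L, hL, h⟩ := h
  exact hG.cancel (supp_injective fun x => by rw [supp_add, h]; ring) hK hL

end IsSuppDiff

end

section GaussianTent

open ConvexBody ProbabilityTheory

theorem integral_max_zero_sub_abs {a : ℝ} (ha : 0 ≤ a) : ∫ r : ℝ, max 0 (a - |r|) = a ^ 2 := by
  rw [integral_comp_abs (f := fun x => max 0 (a - x))]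
  have h : ∫ x in Set.Ioi (0 : ℝ), max 0 (a - x) = ∫ x in Set.Ioc (0 : ℝ) a, (a - x) := by
    rw [setIntegral_eq_of_subset_of_forall_sdiff_eq_zero (t := Set.Ioi (0 : ℝ))
      (f := fun x => max 0 (a - x)) measurableSet_Ioi
      (Set.Ioc_subset_Ioi_self (a := a) (b := (0 : ℝ)))]
    swap
    · rintro x ⟨hx, hx'⟩
      have : a < x := by
        by_contra! h
        exact hx' ⟨hx, h⟩
      exact max_eq_left (by linarith)
    exact setIntegral_congr_fun measurableSet_Ioc fun x hx => max_eq_right (by linarith [hx.2])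
  rw [h, ← intervalIntegral.integral_of_le ha]
  rw [intervalIntegral.integral_sub (by simp) (by simp), intervalIntegral.integral_const,
    integral_id, smul_eq_mul]
  ring

theorem integrable_max_zero_sub_abs (a : ℝ) : Integrable fun r : ℝ => max 0 (a - |r|) := by
  refine Continuous.integrable_of_hasCompactSupport (by fun_prop) ?_
  refine HasCompactSupport.intro (isCompact_Icc (a := -a) (b := a)) fun x hx => ?_
  refine max_eq_left ?_
  by_contra! h
  exact hx (abs_le.1 (by linarith))

theorem gaussianPDFReal_zero_one (x : ℝ) :
    gaussianPDFReal 0 1 x = (√(2 * Real.pi))⁻¹ * Real.exp (-x ^ 2 / 2) := by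
  simp [gaussianPDFReal]

theorem abs_gaussianPDFReal_sub_le (x y : ℝ) :
    |gaussianPDFReal 0 1 x - gaussianPDFReal 0 1 y| ≤ |x - y| := by
  have hd : ∀ x : ℝ, HasDerivAt (gaussianPDFReal 0 1)
      ((√(2 * Real.pi))⁻¹ * (Real.exp (-x ^ 2 / 2) * (-x))) x := by
    intro x
    have e : gaussianPDFReal 0 1 = fun x => (√(2 * Real.pi))⁻¹ * Real.exp (-x ^ 2 / 2) :=
      funext gaussianPDFReal_zero_one
    rw [e]
    have h : HasDerivAt (fun x : ℝ => -x ^ 2 / 2) (-x) x := by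
      have := ((hasDerivAt_pow 2 x).neg).div_const 2
      refine this.congr_deriv ?_
      simp
      ring
    exact (h.exp).const_mul _
  have hle : ∀ x : ℝ, ‖(√(2 * Real.pi))⁻¹ * (Real.exp (-x ^ 2 / 2) * (-x))‖ ≤ 1 := by
    intro x
    have h1 : (√(2 * Real.pi))⁻¹ ≤ 1 := by
      apply inv_le_one_of_one_le₀
      rw [Real.one_le_sqrt]
      linarith [Real.pi_gt_three]
    have h2 : |Real.exp (-x ^ 2 / 2) * (-x)| ≤ 1 := by
      rw [abs_mul, abs_neg, Real.abs_exp, neg_div, Real.exp_neg, inv_mul_le_iff₀ (Real.exp_pos _),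
        mul_one]
      have := Real.add_one_le_exp (x ^ 2 / 2)
      rw [← sq_abs] at this ⊢
      nlinarith [sq_nonneg (|x| - 1)]
    rw [norm_mul, Real.norm_eq_abs, Real.norm_eq_abs, abs_of_nonneg (by positivity)]
    exact mul_le_one₀ h1 (abs_nonneg _) h2
  have := Convex.norm_image_sub_le_of_norm_hasDerivWithin_le (f := gaussianPDFReal 0 1)
    (fun x _ => (hd x).hasDerivWithinAt) (fun x _ => hle x) convex_univ
    (Set.mem_univ y) (Set.mem_univ x)
  simpa using this

/-- The Gaussian average of a tent of half-width `δ s` centred at `τ s`. -/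
def gaussianTent (δ τ s : ℝ) : ℝ := ∫ t, max 0 (δ * s - |t - τ * s|) ∂(gaussianReal 0 1)

theorem integrable_abs_sub_gaussianReal (c : ℝ) :
    Integrable (fun t : ℝ => |t - c|) (gaussianReal 0 1) :=
  (((memLp_id_gaussianReal (μ := 0) (v := 1) 1).integrable le_rfl).sub
    (integrable_const c)).abs

theorem integrable_tent_gaussianReal (a c : ℝ) :
    Integrable (fun t : ℝ => max 0 (a - |t - c|)) (gaussianReal 0 1) := by
  refine (integrable_const |a|).mono' (by fun_prop) (Filter.Eventually.of_forall fun t => ?_)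
  rw [Real.norm_of_nonneg (le_max_left _ _)]
  exact max_le (abs_nonneg _) (by linarith [le_abs_self a, abs_nonneg (t - c)])

theorem continuous_gaussianTent (δ τ : ℝ) : Continuous (gaussianTent δ τ) := by
  refine (LipschitzWith.of_dist_le_mul (K := ⟨|δ| + |τ|, by positivity⟩) fun s s' => ?_).continuous
  change _ ≤ (|δ| + |τ|) * dist s s'
  rw [Real.dist_eq, Real.dist_eq, gaussianTent, gaussianTent,
    ← integral_sub (integrable_tent_gaussianReal _ _) (integrable_tent_gaussianReal _ _)]
  suffices key : ∀ t : ℝ, ‖max 0 (δ * s - |t - τ * s|) - max 0 (δ * s' - |t - τ * s'|)‖ ≤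
      (|δ| + |τ|) * |s - s'| by
    have := norm_integral_le_of_norm_le_const (μ := gaussianReal 0 1)
      (Filter.Eventually.of_forall key)
    rwa [probReal_univ, mul_one] at this
  intro t
  rw [Real.norm_eq_abs]
  refine (abs_max_sub_max_le_max _ _ _ _).trans (max_le (by rw [sub_self, abs_zero]; positivity) ?_)
  have h1 : |(|t - τ * s'| - |t - τ * s|)| ≤ |τ| * |s - s'| := by
    refine (abs_abs_sub_abs_le _ _).trans ?_
    rw [← abs_mul]
    apply le_of_eq; congr 1; ring
  have h2 : |δ * (s - s')| = |δ| * |s - s'| := abs_mul _ _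
  have : δ * s - |t - τ * s| - (δ * s' - |t - τ * s'|) =
    δ * (s - s') + (|t - τ * s'| - |t - τ * s|) := by ring
  rw [this]
  refine (abs_add_le _ _).trans ?_
  linarith

theorem abs_gaussianTent_sub_le {δ : ℝ} (hδ : 0 ≤ δ) (τ : ℝ) {s : ℝ} (hs : |s| ≤ 1) :
    |gaussianTent δ τ s - δ ^ 2 * ((max s 0) ^ 2 * gaussianPDFReal 0 1 (τ * s))| ≤ δ ^ 3 := by
  rcases le_total s 0 with h | h
  · have : gaussianTent δ τ s = 0 := by
      rw [gaussianTent]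
      refine integral_eq_zero_of_ae (Filter.Eventually.of_forall fun t => max_eq_left ?_)
      nlinarith [abs_nonneg (t - τ * s)]
    rw [this, max_eq_right h]
    simp
    positivity
  rw [max_eq_left h]
  have hs1 : s ≤ 1 := (abs_le.1 hs).2
  set a := δ * s with ha
  have ha0 : 0 ≤ a := by positivity
  have had : a ≤ δ := by nlinarith
  have e1 : gaussianTent δ τ s = ∫ r, gaussianPDFReal 0 1 (r + τ * s) * max 0 (a - |r|) := by
    rw [gaussianTent, integral_gaussianReal_eq_integral_smul one_ne_zero,
      ← integral_add_right_eq_self _ (τ * s)]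
    simp [ha]
  have e2 : δ ^ 2 * (s ^ 2 * gaussianPDFReal 0 1 (τ * s)) =
      ∫ r, gaussianPDFReal 0 1 (τ * s) * max 0 (a - |r|) := by
    rw [integral_const_mul, integral_max_zero_sub_abs ha0, ha]; ring
  have hI := integrable_max_zero_sub_abs a
  have hle : ∀ r : ℝ, |gaussianPDFReal 0 1 (r + τ * s) * max 0 (a - |r|) -
      gaussianPDFReal 0 1 (τ * s) * max 0 (a - |r|)| ≤ a * max 0 (a - |r|) := by
    intro r
    rw [← sub_mul, abs_mul, abs_of_nonneg (le_max_left 0 (a - |r|))]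
    rcases le_total (a - |r|) 0 with h' | h'
    · simp [max_eq_left h']
    · have := abs_gaussianPDFReal_sub_le (r + τ * s) (τ * s)
      rw [add_sub_cancel_right] at this
      gcongr
      linarith
  have hc : Continuous (gaussianPDFReal 0 1) := by
    have e : gaussianPDFReal 0 1 = fun x => (√(2 * Real.pi))⁻¹ * Real.exp (-x ^ 2 / 2) :=
      funext gaussianPDFReal_zero_one
    rw [e]; fun_prop
  have hI2 := hI.const_mul (gaussianPDFReal 0 1 (τ * s))
  have hI3 : Integrable (fun r => gaussianPDFReal 0 1 (r + τ * s) * max 0 (a - |r|)) := by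
    have : Integrable (fun r => gaussianPDFReal 0 1 (r + τ * s) * max 0 (a - |r|) -
        gaussianPDFReal 0 1 (τ * s) * max 0 (a - |r|)) := by
      refine (hI.const_mul a).mono' ?_ (Filter.Eventually.of_forall hle)
      exact Continuous.aestronglyMeasurable (by fun_prop)
    refine (this.add hI2).congr (Filter.Eventually.of_forall fun r => ?_)
    simp only [Pi.add_apply, sub_add_cancel]
  rw [e1, e2, ← integral_sub hI3 hI2]
  refine (abs_integral_le_integral_abs).trans ?_
  refine (integral_mono (hI3.sub hI2).abs (hI.const_mul a) hle).trans ?_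
  rw [integral_const_mul, integral_max_zero_sub_abs ha0]
  calc a * a ^ 2 = a ^ 3 := by ring
    _ ≤ δ ^ 3 := by gcongr

end GaussianTent

section Kernel

open ConvexBody ProbabilityTheory

variable {W : Type*} [NormedAddCommGroup W] [InnerProductSpace ℝ W]

theorem ConvexBody.norm_le_of_mem_point_add_tri {c a b y : W} (hy : y ∈ point c + tri a b) :
    ‖y‖ ≤ ‖c‖ + ‖a‖ + ‖b‖ := by
  obtain ⟨z, hz, u, hu, rfl⟩ := mem_add_body.1 hy
  obtain ⟨s, t, hs, ht, hst, rfl⟩ := mem_tri.1 hu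
  have hz' : z = c := by simpa [← SetLike.mem_coe, coe_point] using hz
  rw [hz']
  have h1 : ‖s • a‖ ≤ ‖a‖ := by
    rw [norm_smul, Real.norm_of_nonneg hs]
    exact mul_le_of_le_one_left (norm_nonneg a) (by linarith)
  have h2 : ‖t • b‖ ≤ ‖b‖ := by
    rw [norm_smul, Real.norm_of_nonneg ht]
    exact mul_le_of_le_one_left (norm_nonneg b) (by linarith)
  linarith [norm_add_le c (s • a + t • b), norm_add_le (s • a) (t • b)]

variable [FiniteDimensional ℝ W]

theorem ConvexBody.dist_point_add_tri_le (c a b c' a' b' : W) :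
    dist (point c + tri a b) (point c' + tri a' b') ≤ ‖c - c'‖ + (‖a - a'‖ + ‖b - b'‖) := by
  refine dist_le_of_supp (by positivity) fun x => ?_
  rw [supp_add, supp_add, supp_point, supp_point, supp_tri, supp_tri, add_sub_add_comm, add_mul,
    add_mul, ← inner_sub_right]
  have h : ∀ u v : W, |inner ℝ x u - inner ℝ x v| ≤ ‖u - v‖ * ‖x‖ := fun u v => by
    rw [← inner_sub_right, mul_comm]; exact abs_real_inner_le_norm _ _
  refine (abs_add_le _ _).trans (add_le_add ?_ ?_)
  · rw [mul_comm]; exact abs_real_inner_le_norm _ _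
  refine (abs_max_sub_max_le_max _ _ _ _).trans (max_le (by rw [sub_self, abs_zero]; positivity) ?_)
  refine (abs_max_sub_max_le_max _ _ _ _).trans (max_le ?_ ?_)
  · exact (h a a').trans (le_add_of_nonneg_right (by positivity))
  · exact (h b b').trans (le_add_of_nonneg_left (by positivity))

theorem ConvexBody.continuous_point_add_tri {Ω : Type*} [TopologicalSpace Ω] {c a b : Ω → W}
    (hc : Continuous c) (ha : Continuous a) (hb : Continuous b) :
    Continuous fun ω => point (c ω) + tri (a ω) (b ω) := by
  have : Continuous fun p : W × W × W => point p.1 + tri p.2.1 p.2.2 := by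
    refine (LipschitzWith.of_dist_le_mul (K := 3) fun p q => ?_).continuous
    refine (dist_point_add_tri_le _ _ _ _ _ _).trans ?_
    rw [dist_eq_norm]
    have h1 := norm_fst_le (p - q)
    have h2 := norm_snd_le (p - q)
    have h3 := norm_fst_le (p - q).2
    have h4 := norm_snd_le (p - q).2
    simp only [Prod.fst_sub, Prod.snd_sub] at h1 h2 h3 h4
    simp only [NNReal.coe_ofNat]
    linarith
  exact this.comp (hc.prodMk (ha.prodMk hb))

variable [MeasurableSpace W] [BorelSpace W]

theorem integral_inner_stdGaussian {f : ℝ → ℝ} (hf : Continuous f) (x : W) :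
    ∫ y, f (inner ℝ x y) ∂(stdGaussian W) = ∫ t, f (‖x‖ * t) ∂(gaussianReal 0 1) := by
  have h1 : (stdGaussian W).map (innerSL ℝ x) = gaussianReal 0 (NNReal.mk (‖x‖ ^ 2) (sq_nonneg _) * 1) := by
    rw [IsGaussian.map_eq_gaussianReal, integral_strongDual_stdGaussian,
      variance_dual_stdGaussian, innerSL_apply_norm]
    congr 1
    ext
    simp
  have h2 := gaussianReal_map_const_mul (μ := 0) (v := 1) ‖x‖
  rw [mul_zero] at h2
  have e1 : ∫ y, f (inner ℝ x y) ∂(stdGaussian W) =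
      ∫ t, f t ∂((stdGaussian W).map (innerSL ℝ x)) := by
    rw [integral_map (innerSL ℝ x).continuous.aemeasurable hf.aestronglyMeasurable]
    rfl
  rw [e1, h1, ← h2, integral_map (by fun_prop) hf.aestronglyMeasurable]

/-- Volume restricted to the unit ball. -/
def ballMeasure (W : Type*) [NormedAddCommGroup W] [InnerProductSpace ℝ W] [FiniteDimensional ℝ W]
    [MeasurableSpace W] [BorelSpace W] : Measure W :=
  volume.restrict (Metric.closedBall 0 1)

instance : IsFiniteMeasure (ballMeasure W) :=
  isFiniteMeasure_restrict.2 (isCompact_closedBall (0 : W) 1).measure_lt_top.ne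

theorem Continuous.integrable_ballMeasure {f : W → ℝ} (hf : Continuous f) :
    Integrable f (ballMeasure W) :=
  hf.continuousOn.integrableOn_compact (isCompact_closedBall (0 : W) 1)

/-- The integral transform on homogeneous functions with weight `w` and zonal kernel `κ`. -/
def smoothing (w : W → ℝ) (κ : ℝ → ℝ) (x : W) : ℝ :=
  ∫ v, w v * (‖x‖ * κ (inner ℝ x v / ‖x‖)) ∂(ballMeasure W)

/-- Kernels for which smoothing yields differences of support functions of bodies in `G`. -/
def IsKernel (G : Set (ConvexBody W)) (κ : ℝ → ℝ) : Prop :=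
  Continuous κ ∧ ∀ w : W → ℝ, Continuous w → (∀ v, 0 ≤ w v) → IsSuppDiff G (smoothing w κ)

namespace IsKernel

variable {G : Set (ConvexBody W)}

omit [FiniteDimensional ℝ W] [MeasurableSpace W] [BorelSpace W] in
theorem _root_.continuous_smoothing_integrand {w : W → ℝ} {κ : ℝ → ℝ} (hw : Continuous w)
    (hκ : Continuous κ) (x : W) : Continuous fun v => w v * (‖x‖ * κ (inner ℝ x v / ‖x‖)) := by
  fun_prop

theorem add (hG : IsMinkowskiClass G) {κ κ' : ℝ → ℝ} (h : IsKernel G κ) (h' : IsKernel G κ') :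
    IsKernel G fun s => κ s + κ' s := by
  refine ⟨h.1.add h'.1, fun w hw hw0 => ?_⟩
  have e : smoothing w (fun s => κ s + κ' s) = fun x => smoothing w κ x + smoothing w κ' x := by
    funext x
    simp only [smoothing]
    rw [← integral_add (continuous_smoothing_integrand hw h.1 x).integrable_ballMeasure
      (continuous_smoothing_integrand hw h'.1 x).integrable_ballMeasure]
    congr 1; funext v; ring
  rw [e]
  exact (h.2 w hw hw0).add hG (h'.2 w hw hw0)

theorem const_mul (hG : IsMinkowskiClass G) {κ : ℝ → ℝ} (h : IsKernel G κ) (c : ℝ) :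
    IsKernel G fun s => c * κ s := by
  refine ⟨h.1.const_mul c, fun w hw hw0 => ?_⟩
  have e : smoothing w (fun s => c * κ s) = fun x => c * smoothing w κ x := by
    funext x
    simp only [smoothing]
    rw [← integral_const_mul]
    congr 1; funext v; ring
  rw [e]
  exact (h.2 w hw hw0).const_mul hG c

theorem sum (hG : IsMinkowskiClass G) {ι : Type*} (s : Finset ι) {κ : ι → ℝ → ℝ}
    (h : ∀ i ∈ s, IsKernel G (κ i)) : IsKernel G fun t => ∑ i ∈ s, κ i t := by
  classical
  induction s using Finset.induction_on with
  | empty =>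
    refine ⟨by simpa using continuous_const, fun w _ _ => ?_⟩
    refine ⟨point 0, hG.point_mem 0, point 0, hG.point_mem 0, fun x => by simp [smoothing]⟩
  | insert i s hi ih =>
    simp only [Finset.sum_insert hi]
    exact add hG (h i (by simp)) (ih fun k hk => h k (by simp [hk]))

theorem _root_.integrable_norm_stdGaussian : Integrable (fun y : W => ‖y‖) (stdGaussian W) :=
  (IsGaussian.integrable_id (μ := stdGaussian W)).norm

theorem _root_.IsMinkowskiClass.isSuppDiff_norm (hG : IsMinkowskiClass G) :
    IsSuppDiff G fun x : W => ‖x‖ := by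
  set T : W → ConvexBody W := fun y => point (-y) + tri ((2 : ℝ) • y) 0 with hT
  obtain ⟨M, hM, hMs⟩ := hG.exists_mem_supp_eq_integral (μ := stdGaussian W) (T := T)
    (g := fun y => 3 * ‖y‖)
    (continuous_point_add_tri (by fun_prop) (by fun_prop) (by fun_prop))
    (fun y => hG.add_mem (hG.point_mem _) (hG.tri_mem _ _))
    (integrable_norm_stdGaussian.const_mul 3)
    (fun ω y hy => (norm_le_of_mem_point_add_tri hy).trans (by
      rw [norm_neg, norm_smul, norm_zero, Real.norm_ofNat]; linarith))
  set c := ∫ t, |t| ∂(gaussianReal 0 1)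
  have hc : 0 < c := by
    have hi : Integrable (fun t : ℝ => |t|) (gaussianReal 0 1) := by
      simpa using integrable_abs_sub_gaussianReal 0
    rw [integral_pos_iff_support_of_nonneg (fun t => abs_nonneg t) hi]
    have : Function.support (fun t : ℝ => |t|) = {0}ᶜ := by
      ext t; simp
    rw [this, prob_compl_eq_one_sub (measurableSet_singleton 0)]
    have := nullSingletonClass_gaussianReal (μ := 0) (v := 1) one_ne_zero
    simp
  have key : ∀ x, M.supp x = c * ‖x‖ := by
    intro x
    rw [hMs]
    have : ∀ y, (T y).supp x = |inner ℝ x y| := by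
      intro y
      simp only [hT, supp_add, supp_point, supp_tri, inner_neg_right, inner_smul_right,
        inner_zero_right]
      rcases le_total 0 (inner ℝ x y) with h | h
      · rw [abs_of_nonneg h, max_eq_left (by linarith : (0 : ℝ) ≤ 2 * inner ℝ x y),
          max_eq_right (by linarith)]
        ring
      · rw [abs_of_nonpos h, max_eq_right (by linarith : 2 * inner ℝ x y ≤ (0 : ℝ))]
        simp
    simp only [this]
    rw [integral_inner_stdGaussian continuous_abs]
    simp only [abs_mul, abs_norm, integral_const_mul]
    ring
  have : (fun x : W => ‖x‖) = fun x => c⁻¹ * M.supp x := by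
    funext x
    rw [key, ← mul_assoc, inv_mul_cancel₀ hc.ne', one_mul]
  rw [this]
  refine IsSuppDiff.const_mul hG ⟨point 0, hG.point_mem 0, M, hM, fun x => by
    rw [supp_point, inner_zero_right, sub_zero]⟩ _

theorem const (hG : IsMinkowskiClass G) (c : ℝ) : IsKernel G fun _ => c := by
  refine ⟨continuous_const, fun w _ _ => ?_⟩
  have : smoothing w (fun _ => c) = fun x => ((∫ v, w v ∂(ballMeasure W)) * c) * ‖x‖ := by
    funext x
    simp only [smoothing]
    rw [integral_mul_const]
    ring
  rw [this]
  exact hG.isSuppDiff_norm.const_mul hG _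

theorem gaussianTent (hG : IsMinkowskiClass G) (δ τ : ℝ) : IsKernel G (gaussianTent δ τ) := by
  refine ⟨continuous_gaussianTent δ τ, fun w hw hw0 => ?_⟩
  set β : W × W → W := fun p => p.2 - τ • p.1 with hβ
  have hβc : Continuous β := by fun_prop
  set T₁ : W × W → ConvexBody W := fun p => point (-(w p.1 • β p)) +
    tri (w p.1 • (δ • p.1 + β p)) ((2 * w p.1) • β p) with hT₁
  set T₂ : W × W → ConvexBody W := fun p => point (-(w p.1 • β p)) +
    tri ((2 * w p.1) • β p) 0 with hT₂
  have h₁ : Continuous T₁ := continuous_point_add_tri (by fun_prop) (by fun_prop) (by fun_prop)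
  have h₂ : Continuous T₂ := continuous_point_add_tri (by fun_prop) (by fun_prop) (by fun_prop)
  set g : W × W → ℝ := fun p => w p.1 * (4 * ‖p.2‖) + w p.1 * ((4 * |τ| + |δ|) * ‖p.1‖) * 1 with hg
  have hgi : Integrable g ((ballMeasure W).prod (stdGaussian W)) := by
    refine Integrable.add ?_ ?_
    · exact hw.integrable_ballMeasure.mul_prod (integrable_norm_stdGaussian.const_mul 4)
    · refine Integrable.mul_prod (f := fun v => w v * ((4 * |τ| + |δ|) * ‖v‖)) (g := fun _ => 1)
        (Continuous.integrable_ballMeasure (by fun_prop)) (integrable_const 1)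
  have hβn : ∀ p, w p.1 * ‖β p‖ ≤ w p.1 * (‖p.2‖ + |τ| * ‖p.1‖) := fun p => by
    refine mul_le_mul_of_nonneg_left ((norm_sub_le _ _).trans ?_) (hw0 _)
    rw [norm_smul, Real.norm_eq_abs]
  have n1 : ∀ p, ‖-(w p.1 • β p)‖ = w p.1 * ‖β p‖ := fun p => by
    rw [norm_neg, norm_smul, Real.norm_of_nonneg (hw0 _)]
  have n2 : ∀ p, ‖(2 * w p.1) • β p‖ = 2 * (w p.1 * ‖β p‖) := fun p => by
    rw [norm_smul, Real.norm_of_nonneg (mul_nonneg zero_le_two (hw0 _)), mul_assoc]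
  have n3 : ∀ p, ‖w p.1 • (δ • p.1 + β p)‖ ≤ w p.1 * (|δ| * ‖p.1‖) + w p.1 * ‖β p‖ := fun p => by
    rw [norm_smul, Real.norm_of_nonneg (hw0 _), ← mul_add]
    refine mul_le_mul_of_nonneg_left ((norm_add_le _ _).trans ?_) (hw0 _)
    rw [norm_smul, Real.norm_eq_abs]
  have hb₁ : ∀ p, ∀ y ∈ T₁ p, ‖y‖ ≤ g p := fun p y hy => by
    have := norm_le_of_mem_point_add_tri hy
    rw [n1, n2] at this
    have := n3 p
    have := hβn p
    simp only [hg]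
    linarith
  have hb₂ : ∀ p, ∀ y ∈ T₂ p, ‖y‖ ≤ g p := fun p y hy => by
    have := norm_le_of_mem_point_add_tri hy
    rw [n1, n2, norm_zero] at this
    have := hβn p
    have : 0 ≤ w p.1 * (|δ| * ‖p.1‖) := mul_nonneg (hw0 _) (by positivity)
    have : 0 ≤ w p.1 * ‖β p‖ := mul_nonneg (hw0 _) (by positivity)
    simp only [hg]
    linarith
  obtain ⟨L, hL, hLs⟩ := hG.exists_mem_supp_eq_integral h₁
    (fun y => hG.add_mem (hG.point_mem _) (hG.tri_mem _ _)) hgi hb₁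
  obtain ⟨K, hK, hKs⟩ := hG.exists_mem_supp_eq_integral h₂
    (fun y => hG.add_mem (hG.point_mem _) (hG.tri_mem _ _)) hgi hb₂
  refine ⟨K, hK, L, hL, fun x => ?_⟩
  have hi₁ := integrable_supp h₁ hgi hb₁ x
  have hi₂ := integrable_supp h₂ hgi hb₂ x
  rw [hLs, hKs, ← integral_sub hi₁ hi₂]
  refine Eq.trans ?_ (integral_prod _ (hi₁.sub hi₂)).symm
  rw [smoothing]
  congr 1
  funext v
  have e : ∀ y, (T₁ (v, y)).supp x - (T₂ (v, y)).supp x =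
      w v * max 0 (δ * inner ℝ x v - |inner ℝ x y - τ * inner ℝ x v|) := by
    intro y
    have hi : inner ℝ x (β (v, y)) = inner ℝ x y - τ * inner ℝ x v := by
      simp only [hβ, inner_sub_right, inner_smul_right]
    simp only [hT₁, hT₂, supp_add, supp_point, supp_tri, inner_neg_right, inner_smul_right,
      inner_zero_right, inner_add_right, hi]
    set b := inner ℝ x y - τ * inner ℝ x v
    set s := δ * inner ℝ x v
    have m : ∀ a c : ℝ, w v * max a c = max (w v * a) (w v * c) :=
      fun a c => mul_max_of_nonneg a c (hw0 v)
    have e1 : max 0 (max (w v * (s + b)) (2 * w v * b)) =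
        w v * max 0 (max (s + b) (2 * b)) := by
      rw [m, m, mul_zero]; congr 2; ring
    have e2 : max 0 (max (2 * w v * b) 0) = w v * max 0 (max (2 * b) 0) := by
      rw [m, m, mul_zero]; congr 2; ring
    rw [e1, e2]
    have : max 0 (max (s + b) (2 * b)) - max 0 (max (2 * b) 0) = max 0 (s - |b|) := by
      rcases abs_cases b with ⟨h, h'⟩ | ⟨h, h'⟩ <;> rw [h] <;>
      simp only [max_def] <;> split_ifs <;> linarith
    rw [← this]; ring
  simp only [Pi.sub_apply, e]
  rw [integral_const_mul, integral_inner_stdGaussian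
    (f := fun t => max 0 (δ * inner ℝ x v - |t - τ * inner ℝ x v|)) (by fun_prop)]
  congr 1
  rcases eq_or_ne x 0 with rfl | hx
  · simp
  have hx' := norm_pos_iff.2 hx
  rw [_root_.gaussianTent, ← integral_const_mul]
  congr 1
  funext t
  rw [mul_max_of_nonneg _ _ hx'.le, mul_zero, mul_sub]
  congr 2
  · field_simp
  · rw [← abs_of_pos hx', ← abs_mul, abs_of_pos hx']
    congr 1
    field_simp

end IsKernel

end Kernel

section PeakKernel

open ConvexBody ProbabilityTheory

variable {W : Type*} [NormedAddCommGroup W] [InnerProductSpace ℝ W] [FiniteDimensional ℝ W]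
  [MeasurableSpace W] [BorelSpace W] {G : Set (ConvexBody W)}

/-- Kernels whose powers concentrate at `s = 1` on `[-1, 1]`. -/
def peakKernel (k : ℕ) (s : ℝ) : ℝ := (max s 0) ^ 2 * (1 - Real.exp (-s ^ 2 / 2)) ^ k

theorem exp_eq_gaussianPDFReal (n : ℕ) (s : ℝ) :
    Real.exp (-s ^ 2 / 2) ^ n = √(2 * Real.pi) * gaussianPDFReal 0 1 (√n * s) := by
  have : √(2 * Real.pi) ≠ 0 := by positivity
  rw [gaussianPDFReal_zero_one, mul_inv_cancel_left₀ this, ← Real.exp_nat_mul, mul_pow,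
    Real.sq_sqrt (Nat.cast_nonneg n)]
  congr 1; ring

theorem exists_isKernel_near_peakKernel (hG : IsMinkowskiClass G) (k : ℕ) {η : ℝ} (hη : 0 < η) :
    ∃ κ, IsKernel G κ ∧ ∀ s, |s| ≤ 1 → peakKernel k s ≤ κ s ∧ κ s ≤ peakKernel k s + η := by
  set c := √(2 * Real.pi)
  have hc : 0 < c := by positivity
  set δ := η / 2 / (2 ^ k * c)
  have hδ : 0 < δ := by positivity
  refine ⟨fun s => (∑ n ∈ Finset.range (k + 1), ((-1) ^ n * k.choose n * (c * (δ ^ 2)⁻¹)) *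
    gaussianTent δ (√n) s) + η / 2, ?_, fun s hs => ?_⟩
  · exact .add hG (.sum hG _ fun n _ => .const_mul hG (.gaussianTent hG _ _) _) (.const hG _)
  have hexp : peakKernel k s = ∑ n ∈ Finset.range (k + 1),
      ((-1) ^ n * k.choose n * (c * (δ ^ 2)⁻¹)) *
        (δ ^ 2 * ((max s 0) ^ 2 * gaussianPDFReal 0 1 (√n * s))) := by
    rw [peakKernel, sub_eq_neg_add, add_pow, Finset.mul_sum]
    refine Finset.sum_congr rfl fun n _ => ?_
    rw [neg_pow, exp_eq_gaussianPDFReal]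
    field_simp
    ring
  have hsum : ∑ n ∈ Finset.range (k + 1), (k.choose n : ℝ) = 2 ^ k := by
    exact_mod_cast Nat.sum_range_choose k
  have hclose : |(∑ n ∈ Finset.range (k + 1), ((-1) ^ n * k.choose n * (c * (δ ^ 2)⁻¹)) *
      gaussianTent δ (√n) s) - peakKernel k s| ≤ η / 2 := by
    rw [hexp, ← Finset.sum_sub_distrib]
    refine (Finset.abs_sum_le_sum_abs _ _).trans ?_
    have : ∀ n ∈ Finset.range (k + 1), |((-1) ^ n * k.choose n * (c * (δ ^ 2)⁻¹)) *
        gaussianTent δ (√n) s - ((-1) ^ n * k.choose n * (c * (δ ^ 2)⁻¹)) *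
        (δ ^ 2 * ((max s 0) ^ 2 * gaussianPDFReal 0 1 (√n * s)))| ≤ k.choose n * (c * δ) := by
      intro n _
      rw [← mul_sub, abs_mul, abs_mul, abs_mul, abs_pow, abs_neg, abs_one, one_pow, one_mul,
        Nat.abs_cast, abs_of_pos (by positivity : 0 < c * (δ ^ 2)⁻¹), mul_assoc]
      refine mul_le_mul_of_nonneg_left ?_ (Nat.cast_nonneg _)
      refine (mul_le_mul_of_nonneg_left (abs_gaussianTent_sub_le hδ.le (√n) hs)
        (by positivity)).trans (le_of_eq ?_)
      field_simp
    refine (Finset.sum_le_sum this).trans ?_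
    rw [← Finset.sum_mul, hsum]
    apply le_of_eq
    simp only [δ]
    field_simp
  have := abs_le.1 hclose
  constructor <;> linarith

theorem peakKernel_nonneg (k : ℕ) (s : ℝ) : 0 ≤ peakKernel k s := by
  have : Real.exp (-s ^ 2 / 2) ≤ 1 := Real.exp_le_one_iff.2 (by nlinarith [sq_nonneg s])
  exact mul_nonneg (sq_nonneg _) (pow_nonneg (by linarith) _)

end PeakKernel

section Smoothing

open ConvexBody ProbabilityTheory

variable {W : Type*} [NormedAddCommGroup W] [InnerProductSpace ℝ W]

theorem ConvexBody.supp_add_supp_sub_le (K : ConvexBody W) (p q : W) {t s : ℝ} (ht : 0 ≤ t)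
    (hts : t ≤ s) :
    K.supp (p + t • q) + K.supp (p - t • q) ≤ K.supp (p + s • q) + K.supp (p - s • q) := by
  rcases (ht.trans hts).eq_or_lt with rfl | hs
  · rw [le_antisymm hts ht]
  have hr0 : 0 ≤ t / s := div_nonneg ht hs.le
  have hr1 : t / s ≤ 1 := (div_le_one hs).2 hts
  have ha : 0 ≤ (1 + t / s) / 2 := by linarith
  have hb : 0 ≤ (1 - t / s) / 2 := by linarith
  have hm : t / s * s = t := div_mul_cancel₀ t hs.ne'
  have e1 : p + t • q = ((1 + t / s) / 2) • (p + s • q) + ((1 - t / s) / 2) • (p - s • q) := by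
    nth_rewrite 1 [← hm]; module
  have e2 : p - t • q = ((1 - t / s) / 2) • (p + s • q) + ((1 + t / s) / 2) • (p - s • q) := by
    nth_rewrite 1 [← hm]; module
  have h1 := supp_add_right K (((1 + t / s) / 2) • (p + s • q)) (((1 - t / s) / 2) • (p - s • q))
  have h2 := supp_add_right K (((1 - t / s) / 2) • (p + s • q)) (((1 + t / s) / 2) • (p - s • q))
  rw [supp_smul_right ha, supp_smul_right hb] at h1
  rw [supp_smul_right hb, supp_smul_right ha] at h2
  rw [e1, e2]
  linarith

/-- The rotation `e ↦ a e + b f` of the plane spanned by `e` and `f`, extended by the identity on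
the orthogonal complement. -/
def planeRotation (e f : W) (a b : ℝ) : W →ₗ[ℝ] W :=
  LinearMap.id + ((a - 1) • innerₗ W e - b • innerₗ W f).smulRight e +
    (b • innerₗ W e + (a - 1) • innerₗ W f).smulRight f

theorem planeRotation_apply (e f : W) (a b : ℝ) (v : W) :
    planeRotation e f a b v = v + ((a - 1) * inner ℝ e v - b * inner ℝ f v) • e +
      (b * inner ℝ e v + (a - 1) * inner ℝ f v) • f := rfl

/-- The reflection fixing the plane spanned by `e` and `f`. -/
def planeReflection (e f : W) : W →ₗ[ℝ] W :=
  (2 : ℝ) • ((innerₗ W e).smulRight e + (innerₗ W f).smulRight f) - LinearMap.id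

theorem planeReflection_apply (e f v : W) :
    planeReflection e f v = (2 : ℝ) • (inner ℝ e v • e + inner ℝ f v • f) - v := rfl

theorem norm_add_smul_add_smul_sq {e f : W} (he : ‖e‖ = 1) (hef : inner ℝ e f = 0) (v : W)
    (α β : ℝ) : ‖v + α • e + β • f‖ ^ 2 =
      ‖v‖ ^ 2 + 2 * α * inner ℝ e v + 2 * β * inner ℝ f v + α ^ 2 + β ^ 2 * ‖f‖ ^ 2 := by
  rw [norm_add_sq_real, norm_add_sq_real, inner_add_left, inner_smul_right, inner_smul_right,
    inner_smul_left, inner_smul_right, hef, norm_smul, norm_smul, he, mul_pow, mul_pow,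
    Real.norm_eq_abs, Real.norm_eq_abs, sq_abs, sq_abs, real_inner_comm e v, real_inner_comm f v]
  ring

theorem norm_planeRotation {e f : W} (he : ‖e‖ = 1) (hef : inner ℝ e f = 0) {a b : ℝ}
    (hab : a ^ 2 + b ^ 2 = 1) (hf : ‖f‖ = 1 ∨ f = 0 ∧ b = 0) (v : W) :
    ‖planeRotation e f a b v‖ = ‖v‖ := by
  rw [← sq_eq_sq₀ (norm_nonneg _) (norm_nonneg _), planeRotation_apply,
    norm_add_smul_add_smul_sq he hef]
  rcases hf with hf | ⟨rfl, rfl⟩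
  · rw [hf]
    linear_combination ((inner ℝ e v) ^ 2 + (inner ℝ f v) ^ 2) * hab
  · simp only [inner_zero_left, norm_zero]
    linear_combination (inner ℝ e v) ^ 2 * hab

theorem norm_planeReflection {e f : W} (he : ‖e‖ = 1) (hef : inner ℝ e f = 0)
    (hf : ‖f‖ = 1 ∨ f = 0) (v : W) : ‖planeReflection e f v‖ = ‖v‖ := by
  have : planeReflection e f v = -(v + (-2 * inner ℝ e v) • e + (-2 * inner ℝ f v) • f) := by
    rw [planeReflection_apply]; module
  rw [this, norm_neg, ← sq_eq_sq₀ (norm_nonneg _) (norm_nonneg _),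
    norm_add_smul_add_smul_sq he hef]
  rcases hf with hf | rfl
  · rw [hf]; ring
  · simp only [inner_zero_left, norm_zero]; ring

variable [FiniteDimensional ℝ W]

theorem exists_linearIsometryEquiv_of_norm (L : W →ₗ[ℝ] W) (h : ∀ v, ‖L v‖ = ‖v‖) :
    ∃ R : W ≃ₗᵢ[ℝ] W, ∀ v, R v = L v :=
  ⟨(⟨L, h⟩ : W →ₗᵢ[ℝ] W).toLinearIsometryEquiv rfl, fun _ => rfl⟩

variable [MeasurableSpace W] [BorelSpace W]

theorem integral_ballMeasure_comp (R : W ≃ₗᵢ[ℝ] W) (f : W → ℝ) :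
    ∫ v, f (R v) ∂(ballMeasure W) = ∫ v, f v ∂(ballMeasure W) := by
  have h := R.measurePreserving.setIntegral_preimage_emb R.toMeasurableEquiv.measurableEmbedding f
    (Metric.closedBall 0 1)
  have e : R ⁻¹' Metric.closedBall 0 1 = Metric.closedBall 0 1 := by
    ext v; simp
  rw [e] at h
  exact h

omit [FiniteDimensional ℝ W] [MeasurableSpace W] [BorelSpace W] in
theorem abs_inner_le_one {x v : W} (hx : ‖x‖ = 1) (hv : v ∈ Metric.closedBall (0 : W) 1) :
    |inner ℝ x v| ≤ 1 := by
  refine (abs_real_inner_le_norm _ _).trans ?_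
  rw [hx, one_mul]; simpa using hv

theorem smoothing_supp_eq (K : ConvexBody W) (κ : ℝ → ℝ) {x e : W}
    (R : W ≃ₗᵢ[ℝ] W) (hR : ‖x‖ • R e = x) :
    smoothing K.supp κ x = ∫ v, K.supp (‖x‖ • R v) * κ (inner ℝ e v) ∂(ballMeasure W) := by
  rw [smoothing, ← integral_ballMeasure_comp R]
  congr 1
  funext v
  rcases eq_or_ne x 0 with rfl | hx
  · simp [supp_zero_right]
  have : inner ℝ x (R v) / ‖x‖ = inner ℝ e v := by
    have hx' := norm_ne_zero_iff.2 hx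
    rw [← R.inner_map_map e v]
    nth_rewrite 1 [← hR]
    rw [inner_smul_left]
    simp only [conj_trivial]
    field_simp
  rw [this, supp_smul_right (norm_nonneg x)]
  ring

theorem integral_ballMeasure_mono {f g : W → ℝ} (hf : Continuous f) (hg : Continuous g)
    (h : ∀ v ∈ Metric.closedBall (0 : W) 1, f v ≤ g v) :
    ∫ v, f v ∂(ballMeasure W) ≤ ∫ v, g v ∂(ballMeasure W) :=
  setIntegral_mono_on hf.integrable_ballMeasure hg.integrable_ballMeasure
    measurableSet_closedBall h

theorem integral_ballMeasure_nonneg {f : W → ℝ}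
    (h : ∀ v ∈ Metric.closedBall (0 : W) 1, 0 ≤ f v) : 0 ≤ ∫ v, f v ∂(ballMeasure W) :=
  setIntegral_nonneg measurableSet_closedBall h

theorem smoothing_supp_nonneg {K : ConvexBody W} (hK : 0 ∈ K) {κ : ℝ → ℝ}
    (hκ : ∀ s, |s| ≤ 1 → 0 ≤ κ s) (x : W) : 0 ≤ smoothing K.supp κ x := by
  refine integral_ballMeasure_nonneg fun v hv => ?_
  rcases eq_or_ne x 0 with rfl | hx
  · simp
  refine mul_nonneg (supp_nonneg hK v) (mul_nonneg (norm_nonneg x) (hκ _ ?_))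
  have hx' := norm_pos_iff.2 hx
  rw [abs_div, abs_norm, div_le_one hx']
  refine (abs_real_inner_le_norm _ _).trans (mul_le_of_le_one_right (norm_nonneg x) ?_)
  simpa using hv

theorem smoothing_supp_add_le {K : ConvexBody W} (hK : 0 ∈ K) {κ : ℝ → ℝ} (hκc : Continuous κ)
    (hκ : ∀ s, |s| ≤ 1 → 0 ≤ κ s) (x y : W) :
    smoothing K.supp κ (x + y) ≤ smoothing K.supp κ x + smoothing K.supp κ y := by
  rcases eq_or_ne (x + y) 0 with hz | hz
  · have : smoothing K.supp κ 0 = 0 := by simp [smoothing]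
    rw [hz, this]
    exact add_nonneg (smoothing_supp_nonneg hK hκ x) (smoothing_supp_nonneg hK hκ y)
  rcases eq_or_ne x 0 with rfl | hx
  · rw [zero_add]
    linarith [smoothing_supp_nonneg hK hκ 0]
  rcases eq_or_ne y 0 with rfl | hy
  · rw [add_zero]
    linarith [smoothing_supp_nonneg hK hκ 0]
  set z := x + y with hzdef
  have hz' := norm_pos_iff.2 hz
  have hx' := norm_pos_iff.2 hx
  have hy' := norm_pos_iff.2 hy
  obtain ⟨e, he, hze⟩ : ∃ e : W, ‖e‖ = 1 ∧ ‖z‖ • e = z :=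
    ⟨‖z‖⁻¹ • z, by rw [norm_smul, norm_inv, norm_norm, inv_mul_cancel₀ hz'.ne'],
      by rw [smul_smul, mul_inv_cancel₀ hz'.ne', one_smul]⟩
  have hee : inner ℝ e e = 1 := by rw [real_inner_self_eq_norm_sq, he, one_pow]
  obtain ⟨f, x₁, x₂, hef, hf, hxf⟩ : ∃ f : W, ∃ x₁ x₂ : ℝ, inner ℝ e f = 0 ∧
      (‖f‖ = 1 ∨ f = 0 ∧ x₂ = 0) ∧ x = x₁ • e + x₂ • f := by
    set r := x - inner ℝ e x • e with hr
    have her : inner ℝ e r = 0 := by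
      rw [hr, inner_sub_right, inner_smul_right, hee]; ring
    rcases eq_or_ne r 0 with h0 | h0
    · refine ⟨0, inner ℝ e x, 0, inner_zero_right _, Or.inr ⟨rfl, rfl⟩, ?_⟩
      rw [smul_zero, add_zero]; exact sub_eq_zero.1 h0
    · have hr' := norm_pos_iff.2 h0
      refine ⟨‖r‖⁻¹ • r, inner ℝ e x, ‖r‖, ?_, Or.inl ?_, ?_⟩
      · rw [inner_smul_right, her, mul_zero]
      · rw [norm_smul, norm_inv, norm_norm, inv_mul_cancel₀ hr'.ne']
      · rw [smul_smul, mul_inv_cancel₀ hr'.ne', one_smul, hr]; abel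
  have hyf : y = (‖z‖ - x₁) • e + (-x₂) • f := by
    have : y = z - x := by rw [hzdef]; abel
    rw [this, ← hze, hxf, norm_smul, he]
    simp only [norm_norm, mul_one]
    module
  have hfe : inner ℝ f e = 0 := by rw [real_inner_comm, hef]
  have hsq : ∀ a b : ℝ, (‖f‖ = 1 ∨ f = 0 ∧ b = 0) → ‖a • e + b • f‖ ^ 2 = a ^ 2 + b ^ 2 := by
    intro a b h
    have := norm_add_smul_add_smul_sq he hef 0 a b
    rw [zero_add] at this
    rw [this]
    rcases h with h | ⟨h, rfl⟩
    · rw [h]; simp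
    · simp
  -- a rotation carrying the direction of `z` to the direction of `u`
  have hrot : ∀ (u : W) (a b : ℝ), u ≠ 0 → u = a • e + b • f → (‖f‖ = 1 ∨ f = 0 ∧ b = 0) →
      ∃ R : W ≃ₗᵢ[ℝ] W, ‖u‖ • R e = u ∧ ∀ v, ‖u‖ • R v =
        ‖u‖ • v + ((a - ‖u‖) * inner ℝ e v - b * inner ℝ f v) • e +
          (b * inner ℝ e v + (a - ‖u‖) * inner ℝ f v) • f := by
    intro u a b hu hab hb
    have hu' := norm_pos_iff.2 hu
    have hn : (a / ‖u‖) ^ 2 + (b / ‖u‖) ^ 2 = 1 := by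
      have := hsq a b hb
      rw [← hab] at this
      field_simp
      linarith
    obtain ⟨R, hR⟩ := exists_linearIsometryEquiv_of_norm (planeRotation e f (a / ‖u‖) (b / ‖u‖))
      (norm_planeRotation he hef hn (hb.imp id fun h => ⟨h.1, by rw [h.2, zero_div]⟩))
    have key : ∀ v, ‖u‖ • R v =
        ‖u‖ • v + ((a - ‖u‖) * inner ℝ e v - b * inner ℝ f v) • e +
          (b * inner ℝ e v + (a - ‖u‖) * inner ℝ f v) • f := by
      intro v
      rw [hR, planeRotation_apply, smul_add, smul_add, smul_smul, smul_smul]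
      congr 3
      · field_simp
      · field_simp
    refine ⟨R, ?_, key⟩
    refine Eq.trans ?_ hab.symm
    rw [key, hee, hfe]
    module
  obtain ⟨Rx, hRx, hRx'⟩ := hrot x x₁ x₂ hx hxf hf
  obtain ⟨Ry, hRy, hRy'⟩ := hrot y (‖z‖ - x₁) (-x₂) hy hyf
    (hf.imp id fun h => ⟨h.1, by rw [h.2, neg_zero]⟩)
  obtain ⟨σ, hσ⟩ := exists_linearIsometryEquiv_of_norm (planeReflection e f)
    (norm_planeReflection he hef (hf.imp id And.left))
  have hsum : ∀ v, ‖x‖ • Rx v + ‖y‖ • Ry v = ‖z‖ • (inner ℝ e v • e + inner ℝ f v • f) +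
      (‖x‖ + ‖y‖) • (v - (inner ℝ e v • e + inner ℝ f v • f)) := by
    intro v
    rw [hRx', hRy']
    module
  have hσe : ∀ v, inner ℝ e (σ v) = inner ℝ e v := by
    intro v
    rw [hσ, planeReflection_apply, inner_sub_right, inner_smul_right, inner_add_right,
      inner_smul_right, inner_smul_right, hee, hef]
    ring
  have hσf : ∀ v, inner ℝ f (σ v) • f = inner ℝ f v • f := by
    intro v
    rcases hf with hf | ⟨hf, -⟩
    · rw [hσ, planeReflection_apply, inner_sub_right, inner_smul_right, inner_add_right,
        inner_smul_right, inner_smul_right, hfe, real_inner_self_eq_norm_sq, hf]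
      congr 1; ring
    · simp [hf]
  have hpt : ∀ v, K.supp (‖z‖ • v) + K.supp (‖z‖ • σ v) ≤
      (K.supp (‖x‖ • Rx v) + K.supp (‖y‖ • Ry v)) +
        (K.supp (‖x‖ • Rx (σ v)) + K.supp (‖y‖ • Ry (σ v))) := by
    intro v
    have h1 := supp_add_right K (‖x‖ • Rx v) (‖y‖ • Ry v)
    have h2 := supp_add_right K (‖x‖ • Rx (σ v)) (‖y‖ • Ry (σ v))
    rw [hsum] at h1 h2
    rw [hσe, hσf] at h2
    set p := inner ℝ e v • e + inner ℝ f v • f with hp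
    have h3 := supp_add_supp_sub_le K (‖z‖ • p) (v - p) hz'.le (norm_add_le x y)
    have e1 : ‖z‖ • p + ‖z‖ • (v - p) = ‖z‖ • v := by module
    have e2 : ‖z‖ • p - ‖z‖ • (v - p) = ‖z‖ • σ v := by
      rw [hσ, planeReflection_apply, ← hp]; module
    have e3 : (‖x‖ + ‖y‖) • (σ v - p) = -((‖x‖ + ‖y‖) • (v - p)) := by
      rw [hσ, planeReflection_apply, ← hp]; module
    rw [e1, e2] at h3
    rw [e3, ← sub_eq_add_neg] at h2
    linarith
  have hKc := K.continuous_supp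
  have hzi := smoothing_supp_eq K κ (.refl ℝ W) hze
  have hxi := smoothing_supp_eq K κ Rx hRx
  have hyi := smoothing_supp_eq K κ Ry hRy
  simp only [LinearIsometryEquiv.coe_refl, id_eq] at hzi
  have hcz : Continuous fun v => K.supp (‖z‖ • v) * κ (inner ℝ e v) := by fun_prop
  have hcx : Continuous fun v => K.supp (‖x‖ • Rx v) * κ (inner ℝ e v) := by fun_prop
  have hcy : Continuous fun v => K.supp (‖y‖ • Ry v) * κ (inner ℝ e v) := by fun_prop
  have hdouble : ∀ g : W → ℝ, Continuous g →
      ∫ v, (g v + g (σ v)) ∂(ballMeasure W) = 2 * ∫ v, g v ∂(ballMeasure W) := by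
    intro g hg
    rw [integral_add hg.integrable_ballMeasure
      (g := fun v => g (σ v)) (hg.comp σ.continuous).integrable_ballMeasure,
      integral_ballMeasure_comp σ]
    ring
  have hmain := integral_ballMeasure_mono
    (f := fun v => K.supp (‖z‖ • v) * κ (inner ℝ e v) +
      K.supp (‖z‖ • σ v) * κ (inner ℝ e (σ v)))
    (g := fun v => (K.supp (‖x‖ • Rx v) * κ (inner ℝ e v) +
        K.supp (‖y‖ • Ry v) * κ (inner ℝ e v)) +
      (K.supp (‖x‖ • Rx (σ v)) * κ (inner ℝ e (σ v)) +
        K.supp (‖y‖ • Ry (σ v)) * κ (inner ℝ e (σ v))))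
    (by fun_prop) (by fun_prop) (fun v hv => by
      have h1 := hpt v
      have h2 := hκ _ (abs_inner_le_one he hv)
      rw [hσe]
      nlinarith)
  rw [hdouble _ hcz, hdouble (fun v => K.supp (‖x‖ • Rx v) * κ (inner ℝ e v) +
    K.supp (‖y‖ • Ry v) * κ (inner ℝ e v)) (hcx.add hcy), integral_add hcx.integrable_ballMeasure
    hcy.integrable_ballMeasure] at hmain
  rw [hzi, hxi, hyi]
  linarith

end Smoothing

section Density

open ConvexBody ProbabilityTheory

variable {W : Type*} [NormedAddCommGroup W] [InnerProductSpace ℝ W]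

theorem ConvexBody.exists_norm_le (K : ConvexBody W) : ∃ R, 0 ≤ R ∧ ∀ y ∈ K, ‖y‖ ≤ R := by
  obtain ⟨R, hR, h⟩ := K.isCompact.isBounded.exists_pos_norm_le
  exact ⟨R, hR.le, h⟩

theorem ConvexBody.abs_supp_sub_supp_le {K : ConvexBody W} {R : ℝ} (h : ∀ y ∈ K, ‖y‖ ≤ R)
    (x y : W) : |K.supp x - K.supp y| ≤ R * ‖x - y‖ := by
  have key : ∀ x y : W, K.supp x - K.supp y ≤ R * ‖x - y‖ := fun x y => by
    have h1 := supp_add_right K y (x - y)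
    rw [add_sub_cancel] at h1
    have h2 := (abs_le.1 (abs_supp_le h (x - y))).2
    linarith
  rw [abs_sub_le_iff]
  exact ⟨key x y, by rw [norm_sub_rev]; exact key y x⟩

variable [FiniteDimensional ℝ W]

omit [FiniteDimensional ℝ W] in
theorem exists_isometry_smul_eq {x e : W} (he : ‖e‖ = 1) :
    ∃ R : W ≃ₗᵢ[ℝ] W, ‖x‖ • R e = x := by
  rcases eq_or_ne x 0 with rfl | hx
  · exact ⟨.refl ℝ W, by simp⟩
  have hx' := norm_ne_zero_iff.2 hx
  refine ⟨(ℝ ∙ (e - ‖x‖⁻¹ • x))ᗮ.reflection, ?_⟩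
  rw [Submodule.reflection_sub (by
    rw [he, norm_smul, norm_inv, norm_norm, inv_mul_cancel₀ hx']), smul_smul,
    mul_inv_cancel₀ hx', one_smul]

variable [MeasurableSpace W] [BorelSpace W]

theorem abs_smoothing_supp_sub_le {K : ConvexBody W} {r : ℝ} (hr : ∀ y ∈ K, ‖y‖ ≤ r)
    {κ : ℝ → ℝ} (hκc : Continuous κ) (hκ : ∀ s, |s| ≤ 1 → 0 ≤ κ s) {e : W} (he : ‖e‖ = 1) (x : W) :
    |smoothing K.supp κ x - (∫ v, κ (inner ℝ e v) ∂(ballMeasure W)) * K.supp x| ≤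
      r * (∫ v, ‖v - e‖ * κ (inner ℝ e v) ∂(ballMeasure W)) * ‖x‖ := by
  obtain ⟨R, hR⟩ := exists_isometry_smul_eq (x := x) he
  have hKc := K.continuous_supp
  rw [smoothing_supp_eq K κ R hR, ← integral_mul_const, ← integral_sub
    (Continuous.integrable_ballMeasure (by fun_prop))
    (Continuous.integrable_ballMeasure (by fun_prop)), ← integral_const_mul, ← integral_mul_const]
  refine abs_integral_le_integral_abs.trans ?_
  refine integral_ballMeasure_mono (by fun_prop) (by fun_prop) fun v hv => ?_
  have h0 := hκ _ (abs_inner_le_one he hv)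
  have h1 := abs_supp_sub_supp_le hr (‖x‖ • R v) (‖x‖ • R e)
  rw [← smul_sub, ← map_sub, norm_smul, norm_norm, R.norm_map, hR] at h1
  rw [mul_comm (κ _), ← sub_mul, abs_mul, abs_of_nonneg h0]
  calc _ ≤ r * (‖x‖ * ‖v - e‖) * κ (inner ℝ e v) := by gcongr
    _ = _ := by ring

theorem exists_supp_eq_smoothing {K : ConvexBody W} (hK : 0 ∈ K) {κ : ℝ → ℝ} (hκc : Continuous κ)
    (hκ : ∀ s, |s| ≤ 1 → 0 ≤ κ s) {e : W} (he : ‖e‖ = 1) :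
    ∃ C : ConvexBody W, ∀ x, C.supp x = smoothing K.supp κ x := by
  obtain ⟨r, hr0, hr⟩ := K.exists_norm_le
  set c := ∫ v, κ (inner ℝ e v) ∂(ballMeasure W)
  have hc : 0 ≤ c := integral_ballMeasure_nonneg fun v hv => hκ _ (abs_inner_le_one he hv)
  refine exists_supp_eq_of_sublinear (R := c * r +
    r * (∫ v, ‖v - e‖ * κ (inner ℝ e v) ∂(ballMeasure W))) _ (fun t ht x => ?_)
    (smoothing_supp_add_le hK hκc hκ) (fun x => ?_)
  · rw [smoothing, smoothing, ← integral_const_mul]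
    congr 1
    funext v
    rw [norm_smul, Real.norm_of_nonneg ht.le, inner_smul_left, conj_trivial,
      mul_div_mul_left _ _ ht.ne']
    ring
  · have h1 := (abs_le.1 (abs_smoothing_supp_sub_le hr hκc hκ he x)).2
    have h2 := mul_le_mul_of_nonneg_left ((abs_le.1 (abs_supp_le hr x)).2) hc
    linarith

theorem exists_peakKernel_ratio_lt {e : W} (he : ‖e‖ = 1) {ε : ℝ} (hε : 0 < ε) :
    ∃ k, 0 < ∫ v, peakKernel k (inner ℝ e v) ∂(ballMeasure W) ∧
      ∫ v, ‖v - e‖ * peakKernel k (inner ℝ e v) ∂(ballMeasure W) <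
        ε * ∫ v, peakKernel k (inner ℝ e v) ∂(ballMeasure W) := by
  set c : W → ℝ := fun v => 1 - Real.exp (-(max (inner ℝ e v) 0) ^ 2 / 2) with hc
  have hcc : Continuous c := by fun_prop
  have hee : inner ℝ e e = 1 := by rw [real_inner_self_eq_norm_sq, he, one_pow]
  have hpk : ∀ k v, peakKernel k (inner ℝ e v) = c v ^ k * (max (inner ℝ e v) 0) ^ 2 := by
    intro k v
    rw [peakKernel, mul_comm]
    rcases le_total (inner ℝ e v) 0 with h | h
    · simp [max_eq_right h]
    · simp only [hc, max_eq_left h]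
  have hc0 : ∀ v, 0 ≤ c v := fun v => by
    have : Real.exp (-(max (inner ℝ e v) 0) ^ 2 / 2) ≤ 1 :=
      Real.exp_le_one_iff.2 (by nlinarith [sq_nonneg (max (inner ℝ e v) 0)])
    simp only [hc]; linarith
  have hce : 0 < c e := by
    have : Real.exp (-(max (inner ℝ e e) 0) ^ 2 / 2) < 1 := by
      rw [Real.exp_lt_one_iff, hee]; norm_num
    simp only [hc]; linarith
  have hmax : ∀ v ∈ Metric.closedBall (0 : W) 1, v ≠ e → c v < c e := by
    intro v hv hve
    have h1 : inner ℝ e v < 1 := by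
      have hv' : ‖v‖ ≤ 1 := by simpa using hv
      have h2 : 0 < ‖e - v‖ ^ 2 := by
        have := norm_pos_iff.2 (sub_ne_zero.2 hve.symm)
        positivity
      rw [norm_sub_sq_real, he] at h2
      nlinarith [norm_nonneg v]
    have h2 : max (inner ℝ e v) 0 < 1 := max_lt h1 one_pos
    have h3 : 0 ≤ max (inner ℝ e v) 0 := le_max_right _ _
    have : Real.exp (-(max (inner ℝ e e) 0) ^ 2 / 2) < Real.exp (-(max (inner ℝ e v) 0) ^ 2 / 2) := by
      rw [Real.exp_lt_exp, hee, max_eq_left zero_le_one]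
      nlinarith
    simp only [hc]; linarith
  have hcl : e ∈ closure (interior (Metric.closedBall (0 : W) 1)) := by
    rw [interior_closedBall _ one_ne_zero, closure_ball _ one_ne_zero]
    simp [he]
  have lim : ∀ g : W → ℝ, Continuous g → _ := fun g hg =>
    tendsto_setIntegral_pow_smul_of_unique_maximum_of_isCompact_of_continuousOn
      (μ := (volume : Measure W)) (isCompact_closedBall (0 : W) 1) hcc.continuousOn hmax
      (fun v _ => hc0 v) hce hcl hg.continuousOn
  have l1 := lim (fun v => (max (inner ℝ e v) 0) ^ 2) (by fun_prop)
  have l2 := lim (fun v => ‖v - e‖ * (max (inner ℝ e v) 0) ^ 2) (by fun_prop)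
  simp only [hee, sub_self, norm_zero, zero_mul, max_eq_left zero_le_one, one_pow,
    smul_eq_mul] at l1 l2
  have ev1 := l1.eventually_const_lt (show (1 / 2 : ℝ) < 1 by norm_num)
  have ev2 := l2.eventually_lt_const (show (0 : ℝ) < ε / 2 by positivity)
  obtain ⟨k, hk1, hk2⟩ := (ev1.and ev2).exists
  have e1 : ∀ v, c v ^ k * (‖v - e‖ * (max (inner ℝ e v) 0) ^ 2) =
      ‖v - e‖ * peakKernel k (inner ℝ e v) := fun v => by rw [hpk]; ring
  simp only [← hpk] at hk1
  simp only [e1] at hk2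
  change 1 / 2 < _ * ∫ v, peakKernel k (inner ℝ e v) ∂(ballMeasure W) at hk1
  change _ * (∫ v, ‖v - e‖ * peakKernel k (inner ℝ e v) ∂(ballMeasure W)) < _ at hk2
  set I := ∫ x in Metric.closedBall (0 : W) 1, c x ^ k
  have hI0 : 0 ≤ I := setIntegral_nonneg measurableSet_closedBall fun v _ => pow_nonneg (hc0 v) k
  have hI : 0 < I := by
    rcases hI0.eq_or_lt with h | h
    · rw [← h] at hk1; norm_num at hk1
    · exact h
  rw [lt_inv_mul_iff₀ hI] at hk1
  rw [inv_mul_lt_iff₀ hI] at hk2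
  refine ⟨k, by linarith, ?_⟩
  nlinarith

omit [MeasurableSpace W] [BorelSpace W] in
/-- A Minkowski class is everything. -/
theorem IsMinkowskiClass.mem {G : Set (ConvexBody W)} (hG : IsMinkowskiClass G)
    (K : ConvexBody W) : K ∈ G := by
  borelize W
  rcases subsingleton_or_nontrivial W with hW | hW
  · have : K = point 0 := supp_injective fun x => by
      rw [Subsingleton.elim x 0, supp_zero_right, supp_zero_right]
    rw [this]; exact hG.point_mem 0
  obtain ⟨e, he⟩ := exists_norm_eq W zero_le_one
  suffices H : ∀ K : ConvexBody W, 0 ∈ K → K ∈ G by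
    obtain ⟨a, ha⟩ := K.nonempty
    have h0 : (0 : W) ∈ K.translate (-a) := mem_translate.2 (by simpa using ha)
    have : K = (K.translate (-a)).translate a := by
      refine supp_injective fun x => ?_
      rw [supp_translate, supp_translate, inner_neg_right]; ring
    rw [this]
    exact hG.translate_mem (H _ h0) a
  intro K hK
  obtain ⟨r, hr0, hr⟩ := K.exists_norm_le
  rw [← hG.isClosed.closure_eq, Metric.mem_closure_iff]
  intro ε hε
  set ε' := ε / (4 * (r + 1)) with hε'
  have hε'0 : 0 < ε' := by positivity
  obtain ⟨k, hk, hk'⟩ := exists_peakKernel_ratio_lt he hε'0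
  set I := ∫ v, peakKernel k (inner ℝ e v) ∂(ballMeasure W) with hI
  set vol := (ballMeasure W).real Set.univ
  obtain ⟨κ, hκG, hκ⟩ := exists_isKernel_near_peakKernel hG k
    (η := ε' * I / (2 * (vol + 1))) (by positivity)
  set η := ε' * I / (2 * (vol + 1)) with hη
  have hη0 : 0 < η := by positivity
  have hκ0 : ∀ s, |s| ≤ 1 → 0 ≤ κ s := fun s hs => (peakKernel_nonneg k s).trans (hκ s hs).1
  obtain ⟨C, hC⟩ := exists_supp_eq_smoothing hK hκG.1 hκ0 he
  have hCG : C ∈ G := by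
    refine IsSuppDiff.mem hG ?_
    rw [funext hC]
    exact hκG.2 _ K.continuous_supp (supp_nonneg hK)
  have hκc := hκG.1
  have hpc : Continuous (peakKernel k) := by unfold peakKernel; fun_prop
  set c := ∫ v, κ (inner ℝ e v) ∂(ballMeasure W) with hc
  set D := ∫ v, ‖v - e‖ * κ (inner ℝ e v) ∂(ballMeasure W) with hD
  have hcI : I ≤ c := integral_ballMeasure_mono (by fun_prop) (by fun_prop)
    fun v hv => (hκ _ (abs_inner_le_one he hv)).1
  have hc0 : 0 < c := hk.trans_le hcI
  have hDle : D ≤ 2 * ε' * I := by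
    have h1 : D ≤ ∫ v, (‖v - e‖ * peakKernel k (inner ℝ e v) + 2 * η) ∂(ballMeasure W) := by
      refine integral_ballMeasure_mono (by fun_prop) (by fun_prop) fun v hv => ?_
      have h2 := (hκ _ (abs_inner_le_one he hv)).2
      have hv' : ‖v‖ ≤ 1 := by simpa using hv
      have h3 : ‖v - e‖ ≤ 2 := (norm_sub_le _ _).trans (by linarith)
      have h4 := mul_le_mul_of_nonneg_left h2 (norm_nonneg (v - e))
      have h5 := mul_le_mul_of_nonneg_right h3 hη0.le
      linarith
    rw [integral_add (Continuous.integrable_ballMeasure (by fun_prop)) (integrable_const _),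
      integral_const, smul_eq_mul] at h1
    have h2 : vol * (2 * η) ≤ ε' * I := by
      have hv : 0 ≤ vol := measureReal_nonneg
      rw [hη]
      have : vol * (2 * (ε' * I / (2 * (vol + 1)))) = (vol / (vol + 1)) * (ε' * I) := by
        field_simp
      rw [this]
      exact mul_le_of_le_one_left (by positivity) ((div_le_one (by positivity)).2 (by linarith))
    linarith
  refine ⟨c⁻¹ • C, hG.smul_mem (by positivity) hCG, ?_⟩
  refine (dist_le_of_supp (ε := ε / 2) (by positivity) fun x => ?_).trans_lt (half_lt_self hε)
  have h1 := abs_smoothing_supp_sub_le hr hκc hκ0 he x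
  rw [supp_smul (by positivity), hC]
  have e1 : K.supp x - c⁻¹ * smoothing K.supp κ x =
      -(c⁻¹ * (smoothing K.supp κ x - c * K.supp x)) := by
    field_simp; ring
  rw [e1, abs_neg, abs_mul, abs_of_pos (inv_pos.2 hc0), inv_mul_le_iff₀ hc0]
  refine h1.trans ?_
  rw [← mul_assoc]
  refine mul_le_mul_of_nonneg_right ?_ (norm_nonneg x)
  calc r * D ≤ r * (2 * ε' * I) := by gcongr
    _ ≤ r * (2 * ε' * c) := by gcongr
    _ = (r / (r + 1)) * (c * (ε / 2)) := by rw [hε']; field_simp; ring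
    _ ≤ c * (ε / 2) := mul_le_of_le_one_left (by positivity)
        ((div_le_one (by positivity)).2 (by linarith))

end Density

section

open ConvexBody

/-- A functional on convex bodies vanishing on all bodies contained in a hyperplane. -/
def VanishesOnHyperplanes {V : Type*} [NormedAddCommGroup V] [NormedSpace ℝ V]
    (φ : ConvexBody V → ℝ) : Prop :=
  ∀ (l : V →L[ℝ] ℝ) (c : ℝ) (K : ConvexBody V), l ≠ 0 → (∀ x ∈ K, l x = c) → φ K = 0

open Classical in
/-- The extension of a functional on convex bodies by zero to arbitrary sets. -/
def extVal {V : Type*} [NormedAddCommGroup V] [NormedSpace ℝ V]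
    (φ : ConvexBody V → ℝ) (s : Set V) : ℝ :=
  if h : Convex ℝ s ∧ IsCompact s ∧ s.Nonempty then φ ⟨s, h.1, h.2.1, h.2.2⟩ else 0

section

variable {V : Type*} [NormedAddCommGroup V] [NormedSpace ℝ V] {φ : ConvexBody V → ℝ}

@[simp] theorem extVal_coe (K : ConvexBody V) : extVal φ (K : Set V) = φ K := by
  rw [extVal, dif_pos ⟨K.convex, K.isCompact, K.nonempty⟩]
  rfl

@[simp] theorem extVal_empty : extVal φ ∅ = 0 := by
  rw [extVal, dif_neg]; simp

theorem VanishesOnHyperplanes.extVal (h : VanishesOnHyperplanes φ) {l : V →L[ℝ] ℝ} (hl : l ≠ 0)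
    {c : ℝ} {s : Set V} (hs : ∀ x ∈ s, l x = c) : extVal φ s = 0 := by
  unfold _root_.extVal
  split_ifs with h'
  · exact h l c _ hl hs
  · rfl

theorem IsCTValuation.extVal_cut (h : IsCTValuation φ) (hH : VanishesOnHyperplanes φ)
    {l : V →L[ℝ] ℝ} (hl : l ≠ 0) (c : ℝ) {s : Set V} (hs : Convex ℝ s) (hs' : IsCompact s) :
    extVal φ s = extVal φ (s ∩ {x | c ≤ l x}) + extVal φ (s ∩ {x | l x ≤ c}) := by
  have hc1 : Convex ℝ {x : V | c ≤ l x} := convex_halfSpace_ge l.toLinearMap.isLinear c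
  have hc2 : Convex ℝ {x : V | l x ≤ c} := convex_halfSpace_le l.toLinearMap.isLinear c
  have hcl1 : IsClosed {x : V | c ≤ l x} := isClosed_le continuous_const l.continuous
  have hcl2 : IsClosed {x : V | l x ≤ c} := isClosed_le l.continuous continuous_const
  have hun : s ∩ {x | c ≤ l x} ∪ s ∩ {x | l x ≤ c} = s := by
    rw [← Set.inter_union_distrib_left, Set.inter_eq_left]
    intro x _
    exact le_total c (l x)
  rcases (s ∩ {x | c ≤ l x}).eq_empty_or_nonempty with h1 | h1
  · rw [h1, Set.empty_union] at hun
    rw [h1, hun]; simp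
  rcases (s ∩ {x | l x ≤ c}).eq_empty_or_nonempty with h2 | h2
  · rw [h2, Set.union_empty] at hun
    rw [h2, hun]; simp
  obtain ⟨x, hx⟩ := h1
  obtain ⟨y, hy⟩ := h2
  obtain ⟨z, -, hz⟩ := exists_mem_segment_inter (hs'.inter_right hcl1).isClosed
    (hs'.inter_right hcl2).isClosed (by rwa [hun]) hx hy
  let A : ConvexBody V := ⟨_, hs.inter hc1, hs'.inter_right hcl1, ⟨x, hx⟩⟩
  let B : ConvexBody V := ⟨_, hs.inter hc2, hs'.inter_right hcl2, ⟨y, hy⟩⟩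
  let S : ConvexBody V := ⟨s, hs, hs', ⟨x, hx.1⟩⟩
  have hI : φ (A.inter B ⟨z, hz⟩) = 0 := hH l c _ hl fun w hw => le_antisymm hw.2.2 hw.1.2
  have key := h.val' (U := S) (K := A) (L := B) (I := A.inter B ⟨z, hz⟩) hun.symm rfl
  rw [hI, add_zero] at key
  rw [← extVal_coe (φ := φ) S, ← extVal_coe (φ := φ) A, ← extVal_coe (φ := φ) B] at key
  exact key

/-- The simplex with given vertices. -/
def simplexOf {ι : Type*} [Fintype ι] (v : ι → V) : Set V :=
  (fun p : ι → ℝ => ∑ i, p i • v i) '' stdSimplex ℝ ι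

theorem mem_simplexOf {ι : Type*} [Fintype ι] {v : ι → V} {x : V} :
    x ∈ simplexOf v ↔ ∃ p : ι → ℝ, ((∀ i, 0 ≤ p i) ∧ ∑ i, p i = 1) ∧ ∑ i, p i • v i = x :=
  Iff.rfl

theorem isCompact_simplexOf {ι : Type*} [Fintype ι] (v : ι → V) : IsCompact (simplexOf v) :=
  (isCompact_stdSimplex ℝ ι).image (by fun_prop)

theorem convex_simplexOf {ι : Type*} [Fintype ι] (v : ι → V) : Convex ℝ (simplexOf v) := by
  refine (convex_stdSimplex ℝ ι).is_linear_image ⟨fun p q => ?_, fun c p => ?_⟩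
  · simp [add_smul, Finset.sum_add_distrib]
  · simp [Finset.smul_sum, smul_smul]

theorem map_sum_smul {ι : Type*} [Fintype ι] (l : V →L[ℝ] ℝ) (v : ι → V) (p : ι → ℝ) :
    l (∑ i, p i • v i) = ∑ i, p i * l (v i) := by
  simp [map_sum]

theorem VanishesOnHyperplanes.extVal_simplexOf (h : VanishesOnHyperplanes φ)
    {ι : Type*} [Fintype ι] {v : ι → V} {l : V →L[ℝ] ℝ} (hl : l ≠ 0)
    {c : ℝ} (hs : ∀ i, l (v i) = c) {s : Set V} (hsub : s ⊆ simplexOf v) : _root_.extVal φ s = 0 := by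
  refine h.extVal hl (c := c) fun x hx => ?_
  obtain ⟨p, ⟨-, hp⟩, rfl⟩ := mem_simplexOf.1 (hsub hx)
  rw [map_sum_smul]
  simp [hs, ← Finset.sum_mul, hp]

end

theorem vanishesOnHyperplanes_of_ker {V : Type*} [NormedAddCommGroup V] [NormedSpace ℝ V]
    {φ : ConvexBody V → ℝ} (h : IsCTValuation φ)
    (hker : ∀ l : V →L[ℝ] ℝ, l ≠ 0 →
      ∀ L : ConvexBody (LinearMap.ker l.toLinearMap),
        φ (L.mapCLM (LinearMap.ker l.toLinearMap).subtypeL) = 0) :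
    VanishesOnHyperplanes φ := by
  intro l c K hl hK
  obtain ⟨a, ha⟩ := K.nonempty
  have hsub : ((K.translate (-a) : ConvexBody V) : Set V) ⊆
      (LinearMap.ker l.toLinearMap : Set V) := by
    rintro _ ⟨x, hx, rfl⟩
    simp [hK x hx, hK a ha]
  have e : (bodyIn _ _ hsub).mapCLM (LinearMap.ker l.toLinearMap).subtypeL = K.translate (-a) := by
    refine ConvexBody.ext ?_
    exact Subtype.image_preimage_val _ _ |>.trans (Set.inter_eq_right.2 hsub)
  rw [← h.trans K (-a), ← e]
  exact hker l hl _

end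

section

open ConvexBody

variable {V : Type*} [NormedAddCommGroup V] [NormedSpace ℝ V]
  {φ : ConvexBody V → ℝ}

theorem exists_functional_of_nondegenerate [FiniteDimensional ℝ V] {ι : Type*} [Fintype ι] [Nonempty ι] {v : ι → V}
    (hcard : Fintype.card ι = finrank ℝ V + 1)
    (hv : ∀ l : V →L[ℝ] ℝ, l ≠ 0 → ∀ c, ∃ i, l (v i) ≠ c) (a : ι → ℝ) :
    ∃ (m : V →L[ℝ] ℝ) (d : ℝ), ∀ i, m (v i) = a i + d := by
  let Φ : (Dual ℝ V × ℝ) →ₗ[ℝ] (ι → ℝ) :=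
    { toFun := fun q i => q.1 (v i) - q.2
      map_add' := by intro p q; ext i; simp; ring
      map_smul' := by intro c q; ext i; simp; ring }
  have hinj : Function.Injective Φ := by
    rw [← LinearMap.ker_eq_bot, LinearMap.ker_eq_bot']
    rintro ⟨m, d⟩ h
    have h' : ∀ i, m (v i) = d := fun i => sub_eq_zero.1 (congrFun h i)
    have hm : m = 0 := by
      by_contra hm
      obtain ⟨i, hi⟩ := hv m.toContinuousLinearMap (by simpa using hm) d
      exact hi (h' i)
    subst hm
    obtain ⟨i⟩ := ‹Nonempty ι›
    simp [← h' i]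
  have hfin : finrank ℝ (Dual ℝ V × ℝ) = finrank ℝ (ι → ℝ) := by
    rw [finrank_prod, Subspace.dual_finrank_eq, finrank_self, finrank_fintype_fun_eq_card, hcard]
  obtain ⟨⟨m, d⟩, h⟩ := (LinearMap.injective_iff_surjective_of_finrank_eq_finrank hfin).1 hinj a
  refine ⟨m.toContinuousLinearMap, d, fun i => ?_⟩
  have := congrFun h i
  change m (v i) - d = a i at this
  change m (v i) = _
  linarith

theorem exists_basis_of_nondegenerate [FiniteDimensional ℝ V] {n : ℕ} (hn : finrank ℝ V = n) {v : Fin (n + 1) → V}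
    (hv : ∀ l : V →L[ℝ] ℝ, l ≠ 0 → ∀ c, ∃ i, l (v i) ≠ c) :
    ∃ b : Basis (Fin n) ℝ V, ∀ i, b i = v i.succ - v 0 := by
  have hspan : ⊤ ≤ Submodule.span ℝ (Set.range fun i : Fin n => v i.succ - v 0) := by
    by_contra hcon
    obtain ⟨f, hf, hle⟩ := Submodule.exists_le_ker_of_lt_top _ (lt_top_iff_ne_top.2 fun h => hcon h.ge)
    obtain ⟨i, hi⟩ := hv f.toContinuousLinearMap (by simpa using hf) (f (v 0))
    refine hi ?_
    change f (v i) = f (v 0)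
    induction i using Fin.cases with
    | zero => rfl
    | succ i =>
      have : f (v i.succ - v 0) = 0 := hle (Submodule.subset_span ⟨i, rfl⟩)
      rw [map_sub] at this; linarith
  exact ⟨basisOfTopLeSpanOfCardEqFinrank _ hspan (by simp [hn]), fun i => by simp⟩

/-- The standard simplex of a basis. -/
def basisSimplex {n : ℕ} (b : Basis (Fin n) ℝ V) : Set V :=
  {x | (∀ i, 0 ≤ b.repr x i) ∧ ∑ i, b.repr x i ≤ 1}

theorem simplexOf_eq_image {n : ℕ} {v : Fin (n + 1) → V} {b : Basis (Fin n) ℝ V}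
    (hb : ∀ i, b i = v i.succ - v 0) :
    simplexOf v = (fun y => v 0 + y) '' basisSimplex b := by
  ext x
  rw [mem_simplexOf]
  constructor
  · rintro ⟨p, ⟨hp, hs⟩, rfl⟩
    rw [Fin.sum_univ_succ] at hs
    have e : ∑ i, p i • v i = v 0 + ∑ i : Fin n, p i.succ • b i := by
      rw [Fin.sum_univ_succ, show p 0 = 1 - ∑ i : Fin n, p i.succ by linarith]
      simp only [hb, smul_sub, Finset.sum_sub_distrib, ← Finset.sum_smul]
      module
    refine ⟨_, ⟨fun i => ?_, ?_⟩, e.symm⟩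
    · rw [b.repr_sum_self]; exact hp _
    · rw [b.repr_sum_self]; linarith [hp 0]
  · rintro ⟨y, ⟨hy, hs⟩, rfl⟩
    refine ⟨Fin.cons (1 - ∑ i, b.repr y i) (b.repr y), ⟨fun i => ?_, ?_⟩, ?_⟩
    · induction i using Fin.cases with
      | zero => simpa using hs
      | succ i => simpa using hy i
    · simp [Fin.sum_univ_succ]
    · rw [Fin.sum_univ_succ]
      simp only [Fin.cons_zero, Fin.cons_succ]
      conv_rhs => rw [← b.sum_repr y]
      simp only [hb, smul_sub, Finset.sum_sub_distrib, ← Finset.sum_smul]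
      module

end

section

open ConvexBody

variable {V : Type*} [NormedAddCommGroup V] [NormedSpace ℝ V]
  {φ : ConvexBody V → ℝ} {n : ℕ}

/-- The centered unit cube of a basis. -/
def basisCube (b : Basis (Fin n) ℝ V) : ConvexBody V :=
  ⟨b.equivFun.symm '' Set.Icc (fun _ => -(1 / 2)) (fun _ => 1 / 2),
    (convex_Icc _ _).linear_image b.equivFun.symm.toLinearMap,
    isCompact_Icc.image (LinearMap.continuous_of_finiteDimensional b.equivFun.symm.toLinearMap),
    (Set.nonempty_Icc.2 fun _ => by norm_num).image _⟩

theorem mem_basisCube {b : Basis (Fin n) ℝ V} {x : V} :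
    x ∈ basisCube b ↔ ∀ i, -(1 / 2) ≤ b.repr x i ∧ b.repr x i ≤ 1 / 2 := by
  constructor
  · rintro ⟨y, ⟨h1, h2⟩, rfl⟩ i
    have := b.equivFun.apply_symm_apply y
    rw [← Basis.equivFun_apply, this]
    exact ⟨h1 i, h2 i⟩
  · intro h
    exact ⟨b.equivFun x, ⟨fun i => (h i).1, fun i => (h i).2⟩, b.equivFun.symm_apply_apply x⟩

/-- The standard simplex of a basis as a convex body. -/
def basisSimplexBody (b : Basis (Fin n) ℝ V) : ConvexBody V :=
  have e : basisSimplex b = simplexOf (Fin.cons 0 b : Fin (n + 1) → V) := by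
    rw [simplexOf_eq_image (b := b) (by simp)]; simp
  ⟨basisSimplex b, e ▸ convex_simplexOf _, e ▸ isCompact_simplexOf _, ⟨0, by simp [basisSimplex]⟩⟩

theorem mem_basisSimplexBody {b : Basis (Fin n) ℝ V} {x : V} :
    x ∈ basisSimplexBody b ↔ (∀ i, 0 ≤ b.repr x i) ∧ ∑ i, b.repr x i ≤ 1 := Iff.rfl

theorem IsCTValuation.basisSimplexBody_eq_zero [FiniteDimensional ℝ V] (h : IsCTValuation φ)
    (hH : VanishesOnHyperplanes φ) (hev : ∀ K, φ K.neg = φ K) (hsym : ∀ K, K.neg = K → φ K = 0)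
    (b : Basis (Fin n) ℝ V) : φ (basisSimplexBody b) = 0 := by
  set T := basisSimplexBody b
  set e : V := ∑ i, (1 / 2 : ℝ) • b i with he
  have hre : ∀ i, b.repr e i = 1 / 2 := fun i => by rw [he, b.repr_sum_self]
  rcases Nat.lt_or_ge n 2 with hn | hn
  · rw [← h.trans T (-e)]
    refine hsym _ (SetLike.ext fun x => ?_)
    rw [mem_neg_body, mem_translate, mem_translate, mem_basisSimplexBody, mem_basisSimplexBody]
    simp only [map_sub, map_neg, Finsupp.sub_apply, Finsupp.neg_apply, hre]
    clear_value T e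
    obtain rfl | rfl : n = 0 ∨ n = 1 := by omega
    · simp
    · simp only [Fin.forall_fin_one, Fin.sum_univ_one]
      constructor <;> rintro ⟨h1, h2⟩ <;> constructor <;> linarith
  · let f : V →L[ℝ] ℝ := (∑ i, b.coord i).toContinuousLinearMap
    have hf : ∀ x, f x = ∑ i, b.repr x i := fun x => by
      change (∑ i, b.coord i) x = _
      simp
    have hfe : f e = n / 2 := by simp [hf, hre]; ring
    have hn2 : (2 : ℝ) ≤ n := by exact_mod_cast hn
    have hf0 : f ≠ 0 := by
      intro h0; rw [h0] at hfe; simp at hfe; linarith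
    set P := basisCube b
    set c : ℝ := n / 2 - 1
    have hc : 0 ≤ c := by simp only [c]; linarith
    have hneg : P.neg = P := SetLike.ext fun x => by
      rw [mem_neg_body, mem_basisCube, mem_basisCube]
      simp only [map_neg, Finsupp.neg_apply]
      constructor <;> intro h i <;> constructor <;> linarith [h i]
    have hsum : ∀ x : V, (∀ i, 0 ≤ b.repr x i) → ∑ i, b.repr x i ≤ 1 → ∀ i, b.repr x i ≤ 1 :=
      fun x h1 h2 i => (Finset.single_le_sum (fun i _ => h1 i) (Finset.mem_univ i)).trans h2
    have hcap1 : (P : Set V) ∩ {x | c ≤ f x} = (T.neg.translate e : ConvexBody V) := by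
      ext x
      change (x ∈ P ∧ c ≤ f x) ↔ x ∈ T.neg.translate e
      rw [mem_translate, mem_neg_body, mem_basisSimplexBody, ← hf, map_neg f, map_sub f, hfe,
        mem_basisCube]
      constructor
      · rintro ⟨h1, h2⟩
        refine ⟨fun i => ?_, by simp only [c] at h2; linarith⟩
        simp only [map_sub, map_neg, Finsupp.sub_apply, Finsupp.neg_apply, hre]
        linarith [h1 i]
      · rintro ⟨h1, h2⟩
        refine ⟨fun i => ?_, by simp only [c]; linarith⟩
        have h3 := hsum _ h1 (by rw [← hf]; simpa [hfe] using h2) i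
        have h1 := h1 i
        simp only [map_sub, map_neg, Finsupp.sub_apply, Finsupp.neg_apply, hre] at h1 h3
        constructor <;> linarith
    have hcap2 : (P : Set V) ∩ {x | f x ≤ -c} = (T.translate (-e) : ConvexBody V) := by
      ext x
      change (x ∈ P ∧ f x ≤ -c) ↔ x ∈ T.translate (-e)
      rw [mem_translate, mem_basisSimplexBody, ← hf, map_sub f, map_neg f, hfe, mem_basisCube]
      constructor
      · rintro ⟨h1, h2⟩
        refine ⟨fun i => ?_, by simp only [c] at h2; linarith⟩
        simp only [map_sub, map_neg, Finsupp.sub_apply, Finsupp.neg_apply, hre]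
        linarith [h1 i]
      · rintro ⟨h1, h2⟩
        refine ⟨fun i => ?_, by simp only [c]; linarith⟩
        have h3 := hsum _ h1 (by rw [← hf]; simpa [hfe] using h2) i
        have h1 := h1 i
        simp only [map_sub, map_neg, Finsupp.sub_apply, Finsupp.neg_apply, hre] at h1 h3
        constructor <;> linarith
    have cut1 := h.extVal_cut hH hf0 c P.convex P.isCompact
    have cut2 : extVal φ ((P : Set V) ∩ {x | f x ≤ c}) =
        extVal φ ((P : Set V) ∩ {x | f x ≤ c} ∩ {x | -c ≤ f x}) +
          extVal φ ((P : Set V) ∩ {x | f x ≤ c} ∩ {x | f x ≤ -c}) := h.extVal_cut hH hf0 (-c)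
      (P.convex.inter (convex_halfSpace_le f.toLinearMap.isLinear c))
      (P.isCompact.inter_right (isClosed_le f.continuous continuous_const))
    let M : ConvexBody V := ⟨(P : Set V) ∩ {x | f x ≤ c} ∩ {x | -c ≤ f x},
      (P.convex.inter (convex_halfSpace_le f.toLinearMap.isLinear c)).inter
        (convex_halfSpace_ge f.toLinearMap.isLinear (-c)),
      (P.isCompact.inter_right (isClosed_le f.continuous continuous_const)).inter_right
        (isClosed_le continuous_const f.continuous),
      ⟨0, ⟨mem_basisCube.2 fun i => by simp, by simpa using hc⟩, by simpa using hc⟩⟩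
    have hM : φ M = 0 := hsym M <| SetLike.ext fun x => by
      rw [mem_neg_body]
      change ((-x ∈ P ∧ f (-x) ≤ c) ∧ -c ≤ f (-x)) ↔ ((x ∈ P ∧ f x ≤ c) ∧ -c ≤ f x)
      rw [← mem_neg_body, hneg, map_neg]
      constructor <;> rintro ⟨⟨h1, h2⟩, h3⟩ <;> exact ⟨⟨h1, by linarith⟩, by linarith⟩
    rw [← extVal_coe (φ := φ) M] at hM
    have e2 : (P : Set V) ∩ {x | f x ≤ c} ∩ {x | f x ≤ -c} = (P : Set V) ∩ {x | f x ≤ -c} := by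
      rw [Set.inter_assoc]
      congr 1
      exact Set.inter_eq_right.2 fun x (hx : f x ≤ -c) => show f x ≤ c by linarith
    rw [e2, hcap2, extVal_coe, h.trans] at cut2
    rw [hcap1, extVal_coe, extVal_coe, h.trans, hev, hsym P hneg] at cut1
    change extVal φ ((P : Set V) ∩ {x | f x ≤ c} ∩ {x | -c ≤ f x}) = 0 at hM
    linarith

theorem IsCTValuation.extVal_simplexOf_eq_zero [FiniteDimensional ℝ V] (h : IsCTValuation φ)
    (hH : VanishesOnHyperplanes φ) (hev : ∀ K, φ K.neg = φ K) (hsym : ∀ K, K.neg = K → φ K = 0)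
    (hn : finrank ℝ V = n) (v : Fin (n + 1) → V) : extVal φ (simplexOf v) = 0 := by
  by_cases hv : ∀ l : V →L[ℝ] ℝ, l ≠ 0 → ∀ c, ∃ i, l (v i) ≠ c
  · obtain ⟨b, hb⟩ := exists_basis_of_nondegenerate hn hv
    have e : simplexOf v = ((basisSimplexBody b).translate (v 0) : ConvexBody V) :=
      simplexOf_eq_image hb
    rw [e, extVal_coe, h.trans]
    exact h.basisSimplexBody_eq_zero hH hev hsym b
  · push Not at hv
    obtain ⟨l, hl, c, hc⟩ := hv
    exact hH.extVal_simplexOf hl hc subset_rfl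

end

section

open ConvexBody

variable {V : Type*} [NormedAddCommGroup V] [NormedSpace ℝ V] {φ : ConvexBody V → ℝ}
  {ι : Type*} [Fintype ι] [DecidableEq ι]

theorem sum_transfer_smul (q : ι → ℝ) (v : ι → V) (i j : ι) (t : ℝ) :
    ∑ k, (q + Pi.single i (-t) + Pi.single j t : ι → ℝ) k • v k = ∑ k, q k • v k + t • (v j - v i) := by
  simp only [Pi.add_apply, add_smul, Finset.sum_add_distrib, Pi.single_apply, ite_smul, zero_smul,
    Finset.sum_ite_eq', Finset.mem_univ, if_true]
  module

theorem sum_transfer (q : ι → ℝ) (i j : ι) (t : ℝ) :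
    ∑ k, (q + Pi.single i (-t) + Pi.single j t : ι → ℝ) k = ∑ k, q k := by
  simp [Finset.sum_add_distrib]

theorem sum_smul_update (q : ι → ℝ) (v : ι → V) (i : ι) (w : V) :
    ∑ k, q k • Function.update v i w k = ∑ k, q k • v k + q i • (w - v i) := by
  have : ∀ k, q k • Function.update v i w k = q k • v k + if k = i then q i • (w - v i) else 0 := by
    intro k
    by_cases h : k = i
    · subst h; simp only [Function.update_self, if_true]; module
    · simp [h]
  simp [this, Finset.sum_add_distrib]

theorem simplexOf_inter_halfSpace {v : ι → V} {i j : ι} (hij : i ≠ j) {s : ℝ} (hs : 0 < s)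
    (hs1 : s < 1) {m : V →L[ℝ] ℝ} {d : ℝ}
    (hm : ∀ k, m (v k) = (Pi.single i s + Pi.single j (-(1 - s)) : ι → ℝ) k + d) :
    simplexOf v ∩ {x | m x ≤ d} = simplexOf (Function.update v i ((1 - s) • v i + s • v j)) := by
  have hval : ∀ p : ι → ℝ, ∑ k, p k = 1 → m (∑ k, p k • v k) = p i * s - p j * (1 - s) + d := by
    intro p hp
    rw [map_sum_smul]
    simp only [hm, mul_add, Finset.sum_add_distrib, ← Finset.sum_mul, hp, Pi.add_apply,
      Pi.single_apply, mul_ite, mul_zero, Finset.sum_ite_eq', Finset.mem_univ, if_true]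
    ring
  have hw : (1 - s) • v i + s • v j - v i = s • (v j - v i) := by module
  have h1s : 0 < 1 - s := by linarith
  ext x
  constructor
  · rintro ⟨⟨p, ⟨hp, hsum⟩, rfl⟩, hle⟩
    simp only [Set.mem_ofPred_eq] at hle
    rw [hval p hsum] at hle
    set t := -(s * p i / (1 - s)) with ht
    have hti : (1 - s) * t = - (s * p i) := by rw [ht]; field_simp
    have htn : t ≤ 0 := by nlinarith [mul_nonneg hs.le (hp i)]
    have hqi : (p + Pi.single i (-t) + Pi.single j t : ι → ℝ) i = p i - t := by
      simp [hij]; ring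
    refine mem_simplexOf.2 ⟨p + Pi.single i (-t) + Pi.single j t, ⟨fun k => ?_, ?_⟩, ?_⟩
    · by_cases hk : k = i
      · subst hk; rw [hqi]; linarith [hp k]
      · by_cases hk' : k = j
        · subst hk'
          simp only [Pi.add_apply, Pi.single_eq_same, Pi.single_eq_of_ne hk]
          by_contra hcon
          nlinarith
        · simp [hk, hk', hp k]
    · rw [sum_transfer, hsum]
    · rw [sum_smul_update, sum_transfer_smul, hqi, hw, smul_smul, add_assoc, ← add_smul]
      rw [show t + (p i - t) * s = 0 by linarith]
      simp
  · intro hx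
    obtain ⟨q, ⟨hq, hsum⟩, rfl⟩ := mem_simplexOf.1 hx
    have e : ∑ k, q k • Function.update v i ((1 - s) • v i + s • v j) k =
        ∑ k, (q + Pi.single i (-(q i * s)) + Pi.single j (q i * s) : ι → ℝ) k • v k := by
      rw [sum_smul_update, sum_transfer_smul, hw, smul_smul]
    have hsum' := (sum_transfer q i j (q i * s)).trans hsum
    have hp1 : (q + Pi.single i (-(q i * s)) + Pi.single j (q i * s) : ι → ℝ) i = q i * (1 - s) := by
      simp [hij]; ring
    have hp2 : (q + Pi.single i (-(q i * s)) + Pi.single j (q i * s) : ι → ℝ) j = q j + q i * s := by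
      simp [hij.symm]
    have := mul_nonneg (hq i) hs.le
    rw [e]
    refine ⟨mem_simplexOf.2 ⟨_, ⟨fun k => ?_, hsum'⟩, rfl⟩, ?_⟩
    · by_cases hk : k = i
      · subst hk; rw [hp1]; exact mul_nonneg (hq k) h1s.le
      · by_cases hk' : k = j
        · subst hk'; rw [hp2]; linarith [hq k]
        · simp [hk, hk', hq k]
    · simp only [Set.mem_ofPred_eq]
      rw [hval _ hsum', hp1, hp2]
      nlinarith [hq j, mul_nonneg (hq j) h1s.le]

/-- The extension of `φ` vanishes on the intersection of `C` with any simplex. -/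
def KillsSimplices (φ : ConvexBody V → ℝ) (n : ℕ) (C : Set V) : Prop :=
  ∀ v : Fin (n + 1) → V, extVal φ (simplexOf v ∩ C) = 0

theorem KillsSimplices.inter_halfSpace [FiniteDimensional ℝ V] (h : IsCTValuation φ)
    (hH : VanishesOnHyperplanes φ) {n : ℕ} (hn : finrank ℝ V = n) {C : Set V} (hC : Convex ℝ C)
    (hC' : IsClosed C) (hK : KillsSimplices φ n C) {l : V →L[ℝ] ℝ} (hl : l ≠ 0) (c : ℝ) :
    KillsSimplices φ n (C ∩ {x | c ≤ l x}) := by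
  intro v
  induction hN : (Finset.univ.filter fun k => l (v k) ≠ c).card using Nat.strong_induction_on
    generalizing v with
  | _ N ih =>
  have hcH : Convex ℝ (C ∩ {x | c ≤ l x}) := hC.inter (convex_halfSpace_ge l.toLinearMap.isLinear c)
  have hclH : IsClosed (C ∩ {x | c ≤ l x}) := hC'.inter (isClosed_le continuous_const l.continuous)
  by_cases hv : ∀ l : V →L[ℝ] ℝ, l ≠ 0 → ∀ c, ∃ i, l (v i) ≠ c
  swap
  · push Not at hv
    obtain ⟨l', hl', c', hc'⟩ := hv
    exact hH.extVal_simplexOf hl' hc' Set.inter_subset_left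
  by_cases hge : ∀ k, c ≤ l (v k)
  · have : simplexOf v ∩ (C ∩ {x | c ≤ l x}) = simplexOf v ∩ C := by
      rw [← Set.inter_assoc, Set.inter_eq_left]
      rintro x ⟨hx, -⟩
      obtain ⟨p, ⟨hp, hs⟩, rfl⟩ := mem_simplexOf.1 hx
      simp only [Set.mem_ofPred_eq]
      rw [map_sum_smul]
      calc c = ∑ k, p k * c := by rw [← Finset.sum_mul, hs, one_mul]
        _ ≤ _ := Finset.sum_le_sum fun k _ => mul_le_mul_of_nonneg_left (hge k) (hp k)
    rw [this]; exact hK v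
  by_cases hle : ∀ k, l (v k) ≤ c
  · refine hH.extVal hl (c := c) ?_
    rintro x ⟨hx, -, hx'⟩
    refine le_antisymm ?_ hx'
    obtain ⟨p, ⟨hp, hs⟩, rfl⟩ := mem_simplexOf.1 hx
    rw [map_sum_smul]
    calc _ ≤ ∑ k, p k * c :=
          Finset.sum_le_sum fun k _ => mul_le_mul_of_nonneg_left (hle k) (hp k)
      _ = c := by rw [← Finset.sum_mul, hs, one_mul]
  push Not at hge hle
  obtain ⟨i, hi⟩ := hge
  obtain ⟨j, hj⟩ := hle
  have hij : i ≠ j := by rintro rfl; linarith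
  set s := (c - l (v i)) / (l (v j) - l (v i)) with hs
  have hpos : 0 < l (v j) - l (v i) := by linarith
  have hs0 : 0 < s := div_pos (by linarith) hpos
  have hs1 : s < 1 := (div_lt_one hpos).2 (by linarith)
  have hsm : s * (l (v j) - l (v i)) = c - l (v i) := div_mul_cancel₀ _ hpos.ne'
  set w := (1 - s) • v i + s • v j with hw
  have hlw : l w = c := by simp [hw]; linarith
  obtain ⟨m, d, hm⟩ := exists_functional_of_nondegenerate (v := v) (by simp [hn]) hv
    (Pi.single i s + Pi.single j (-(1 - s)))
  have hm0 : m ≠ 0 := by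
    rintro rfl
    have h1 := hm i
    have h2 := hm j
    simp [hij] at h1
    simp [hij.symm] at h2
    linarith
  have hcount : ∀ k, l (v k) ≠ c → extVal φ
      (simplexOf (Function.update v k w) ∩ (C ∩ {x | c ≤ l x})) = 0 := by
    intro k hk
    refine ih _ ?_ _ rfl
    rw [← hN]
    refine Finset.card_lt_card (Finset.ssubset_iff_subset_ne.2 ⟨fun k' hk' => ?_, fun e => ?_⟩)
    · simp only [Finset.mem_filter, Finset.mem_univ, true_and] at hk' ⊢
      by_cases hkk : k' = k
      · subst hkk; exact hk
      · rwa [Function.update_of_ne hkk] at hk'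
    · have : k ∈ Finset.univ.filter fun k => l (v k) ≠ c := by simpa using hk
      rw [← e] at this
      simp [hlw] at this
  have e1 : simplexOf v ∩ (C ∩ {x | c ≤ l x}) ∩ {x | m x ≤ d} =
      simplexOf (Function.update v i w) ∩ (C ∩ {x | c ≤ l x}) := by
    rw [Set.inter_right_comm, simplexOf_inter_halfSpace hij hs0 hs1 hm]
  have e2 : simplexOf v ∩ (C ∩ {x | c ≤ l x}) ∩ {x | d ≤ m x} =
      simplexOf (Function.update v j w) ∩ (C ∩ {x | c ≤ l x}) := by
    have := simplexOf_inter_halfSpace (v := v) hij.symm (s := 1 - s) (by linarith) (by linarith)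
      (m := -m) (d := -d) fun k => by
        rw [neg_apply, hm, add_comm (Pi.single j _)]
        simp only [Pi.add_apply, sub_sub_cancel, Pi.single_neg, Pi.neg_apply]
        ring
    rw [sub_sub_cancel, add_comm (s • v j), ← hw] at this
    rw [Set.inter_right_comm, ← this]
    simp
  rw [h.extVal_cut hH hm0 d ((convex_simplexOf v).inter hcH)
    ((isCompact_simplexOf v).inter_right hclH), e1, e2, hcount i hi.ne, hcount j hj.ne', add_zero]

end

section

open ConvexBody

section

variable {V : Type*} [NormedAddCommGroup V] [NormedSpace ℝ V] {φ : ConvexBody V → ℝ}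

theorem killsSimplices_iInter [FiniteDimensional ℝ V] (h : IsCTValuation φ)
    (hH : VanishesOnHyperplanes φ) {n : ℕ} (hn : finrank ℝ V = n)
    (huniv : KillsSimplices φ n Set.univ)
    {α : Type*} (t : Finset α) (l : α → V →L[ℝ] ℝ) (hl : ∀ a, l a ≠ 0) (c : α → ℝ) :
    KillsSimplices φ n (⋂ a ∈ t, {x | c a ≤ l a x}) := by
  classical
  induction t using Finset.induction_on with
  | empty => simpa using huniv
  | insert a t ha ih =>
    rw [Finset.set_biInter_insert, Set.inter_comm]
    refine ih.inter_halfSpace h hH hn ?_ ?_ (hl a) (c a)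
    · exact convex_iInter₂ fun b _ => convex_halfSpace_ge (l b).toLinearMap.isLinear (c b)
    · exact isClosed_biInter fun b _ => isClosed_le continuous_const (l b).continuous

theorem exists_subset_simplexOf [FiniteDimensional ℝ V] {n : ℕ} (hn : finrank ℝ V = n)
    (K : ConvexBody V) : ∃ v : Fin (n + 1) → V, (K : Set V) ⊆ simplexOf v := by
  let b := finBasisOfFinrankEq ℝ V hn
  obtain ⟨R, hR⟩ := K.isCompact.exists_bound_of_continuousOn
    (f := b.equivFun) (LinearMap.continuous_of_finiteDimensional b.equivFun.toLinearMap).continuousOn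
  have hR' : ∀ x ∈ K, ∀ i, |b.repr x i| ≤ R := fun x hx i => by
    have := (norm_le_pi_norm (b.equivFun x) i).trans (hR x hx)
    simpa using this
  have hR0 : 0 ≤ R := by
    obtain ⟨x, hx⟩ := K.nonempty
    exact (norm_nonneg _).trans (hR x hx)
  set M : ℝ := 2 * R * n + 1
  have hM : 0 < M := by positivity
  set v0 : V := -∑ i, R • b i with hv0
  refine ⟨Fin.cons v0 fun i => v0 + M • b i, fun x hx => ?_⟩
  set q : Fin n → ℝ := fun i => (b.repr x i + R) / M
  have hq : ∀ i, 0 ≤ q i := fun i => div_nonneg (by linarith [neg_le_of_abs_le (hR' x hx i)]) hM.le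
  have hqs : ∑ i, q i ≤ 1 := by
    simp only [q, ← Finset.sum_div]
    rw [div_le_one hM]
    calc ∑ i, (b.repr x i + R) ≤ ∑ _i : Fin n, 2 * R :=
          Finset.sum_le_sum fun i _ => by linarith [le_of_abs_le (hR' x hx i)]
      _ ≤ M := by simp [M]; linarith
  refine mem_simplexOf.2 ⟨Fin.cons (1 - ∑ i, q i) q, ⟨fun i => ?_, ?_⟩, ?_⟩
  · induction i using Fin.cases with
    | zero => simpa using hqs
    | succ i => simpa using hq i
  · simp [Fin.sum_univ_succ]
  · rw [Fin.sum_univ_succ]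
    simp only [Fin.cons_zero, Fin.cons_succ, smul_add, Finset.sum_add_distrib, ← Finset.sum_smul]
    have e : ∀ i, q i • M • b i = b.repr x i • b i + R • b i := fun i => by
      rw [smul_smul, ← add_smul]; congr 1; simp only [q]; field_simp
    simp only [e, Finset.sum_add_distrib, b.sum_repr]
    rw [show ∑ i, R • b i = -v0 by simp [hv0]]
    module

theorem exists_finset_halfSpaces [FiniteDimensional ℝ V] (K : ConvexBody V) {T : Set V}
    (hT : IsCompact T) {ε : ℝ} (hε : 0 < ε) :
    ∃ t : Finset {q : (V →L[ℝ] ℝ) × ℝ // q.1 ≠ 0 ∧ ∀ a ∈ K, q.2 ≤ q.1 a},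
      T ∩ (⋂ a ∈ t, {x | a.1.2 ≤ a.1.1 x}) ⊆ Metric.thickening ε K := by
  obtain ⟨t, ht⟩ := (hT.diff Metric.isOpen_thickening (t := Metric.thickening ε (K : Set V))).elim_finite_subcover
    (fun q : {q : (V →L[ℝ] ℝ) × ℝ // q.1 ≠ 0 ∧ ∀ a ∈ K, q.2 ≤ q.1 a} => {x | q.1.1 x < q.1.2})
    (fun q => isOpen_lt q.1.1.continuous continuous_const) (by
      rintro y ⟨-, hy⟩
      have hyK : y ∉ (K : Set V) := fun h => hy (Metric.self_subset_thickening hε _ h)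
      obtain ⟨f, u, h1, h2⟩ := geometric_hahn_banach_point_closed K.convex K.isClosed hyK
      refine Set.mem_iUnion.2 ⟨⟨(f, u), ?_, fun a ha => (h2 a ha).le⟩, h1⟩
      rintro (rfl : f = 0)
      obtain ⟨x, hx⟩ := K.nonempty
      have := h2 x hx
      simp at this h1
      linarith)
  refine ⟨t, ?_⟩
  rintro x ⟨hxT, hx⟩
  by_contra hcon
  obtain ⟨a, ha, hxa⟩ := Set.mem_iUnion₂.1 (ht ⟨hxT, hcon⟩)
  have := Set.mem_iInter₂.1 hx a ha
  simp only [Set.mem_ofPred_eq] at this hxa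
  linarith

theorem IsCTValuation.eq_zero_of_vanishesOnHyperplanes [FiniteDimensional ℝ V]
    (h : IsCTValuation φ) (hH : VanishesOnHyperplanes φ) (hev : ∀ K, φ K.neg = φ K)
    (hsym : ∀ K, K.neg = K → φ K = 0) (K : ConvexBody V) : φ K = 0 := by
  obtain ⟨v, hv⟩ := exists_subset_simplexOf rfl K
  have huniv : KillsSimplices φ (finrank ℝ V) Set.univ := fun v => by
    rw [Set.inter_univ]; exact h.extVal_simplexOf_eq_zero hH hev hsym rfl v
  have hcl : IsClosed {L : ConvexBody V | φ L = 0} := isClosed_eq h.cont continuous_const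
  refine hcl.closure_subset (Metric.mem_closure_iff.2 fun ε hε => ?_)
  obtain ⟨t, ht⟩ := exists_finset_halfSpaces K (isCompact_simplexOf v) (half_pos hε)
  have hsub : (K : Set V) ⊆ simplexOf v ∩ ⋂ a ∈ t, {x | a.1.2 ≤ a.1.1 x} := fun x hx =>
    ⟨hv hx, Set.mem_iInter₂.2 fun a _ => a.2.2 x hx⟩
  let L : ConvexBody V := ⟨simplexOf v ∩ ⋂ a ∈ t, {x | a.1.2 ≤ a.1.1 x},
    (convex_simplexOf v).inter
      (convex_iInter₂ fun b _ => convex_halfSpace_ge b.1.1.toLinearMap.isLinear b.1.2),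
    (isCompact_simplexOf v).inter_right
      (isClosed_biInter fun b _ => isClosed_le continuous_const b.1.1.continuous),
    K.nonempty.mono hsub⟩
  refine ⟨L, ?_, ?_⟩
  · have := killsSimplices_iInter h hH rfl huniv t (fun a => a.1.1) (fun a => a.2.1)
      (fun a => a.1.2) v
    change φ L = 0
    rw [← extVal_coe (φ := φ) L]
    exact this
  · refine lt_of_le_of_lt ?_ (half_lt_self hε)
    refine (dist_le_iff (half_pos hε).le).2 ⟨fun x hx => ⟨x, hsub hx, by rw [dist_self]; positivity⟩,
      fun y hy => ?_⟩
    obtain ⟨x, hx, hd⟩ := Metric.mem_thickening_iff.1 (ht hy)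
    exact ⟨x, hx, hd.le⟩

end

/-- An even continuous translation invariant valuation vanishing on symmetric bodies is zero. -/
theorem IsCTValuation.eq_zero_of_even.{u} {V : Type u} [NormedAddCommGroup V] [NormedSpace ℝ V]
    [FiniteDimensional ℝ V] {φ : ConvexBody V → ℝ} (h : IsCTValuation φ)
    (hev : ∀ K, φ K.neg = φ K) (hsym : ∀ K, K.neg = K → φ K = 0) (K : ConvexBody V) : φ K = 0 := by
  induction hN : finrank ℝ V using Nat.strong_induction_on generalizing V with
  | _ N ih =>
  refine h.eq_zero_of_vanishesOnHyperplanes (vanishesOnHyperplanes_of_ker h fun l hl L => ?_)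
    hev hsym K
  refine ih (finrank ℝ (LinearMap.ker l.toLinearMap)) ?_
    (h.comp_mapCLM (LinearMap.ker l.toLinearMap).subtypeL) (fun K => ?_) (fun K hK => ?_) L rfl
  · rw [← hN]
    refine Submodule.finrank_lt fun e => hl ?_
    ext x
    exact LinearMap.mem_ker.1 (e ▸ Submodule.mem_top : x ∈ LinearMap.ker l.toLinearMap)
  · rw [mapCLM_neg, hev]
  · exact hsym _ (by rw [← mapCLM_neg, hK])

end

section

open ConvexBody

section Neutral

variable {V : Type*} [NormedAddCommGroup V] [NormedSpace ℝ V] {φ : ConvexBody V → ℝ} {j : ℕ}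
  {K L : ConvexBody V}

theorem IsNeutralFor.add (hK : IsNeutralFor φ K) (hL : IsNeutralFor φ L) :
    IsNeutralFor φ (K + L) := fun M => by rw [← add_assoc, hL, hK]

theorem IsNeutralFor.cancel {C : ConvexBody V} (e : C + K = L) (hK : IsNeutralFor φ K)
    (hL : IsNeutralFor φ L) : IsNeutralFor φ C := fun M => by
  rw [← hK (M + C), add_assoc, e, hL]

theorem IsNeutralFor.smul (hφ : IsHomogeneousOfDegree φ j) (hL : IsNeutralFor φ L) {t : ℝ}
    (ht : 0 ≤ t) : IsNeutralFor φ (t • L) := fun M => by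
  rcases ht.eq_or_lt with rfl | ht
  · rw [zero_smul_body, add_zero]
  have e : M = t • t⁻¹ • M := by rw [smul_smul, mul_inv_cancel₀ ht.ne', one_smul]
  conv_lhs => rw [e]
  rw [← smul_add, hφ _ _ ht.le, hL, ← hφ _ _ ht.le, ← e]

theorem isNeutralFor_point (h : IsCTValuation φ) (a : V) : IsNeutralFor φ (point a) := fun M => by
  rw [add_comm, point_add, h.trans]

theorem isClosed_isNeutralFor (h : IsCTValuation φ) : IsClosed {L | IsNeutralFor φ L} := by
  have : {L | IsNeutralFor φ L} = ⋂ K, {L | φ (K + L) = φ K} := by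
    ext L; simp [IsNeutralFor]
  rw [this]
  exact isClosed_iInter fun K => isClosed_eq (h.const_add K).cont continuous_const

end Neutral

section

variable {W : Type*} [NormedAddCommGroup W] [InnerProductSpace ℝ W]
  {φ : ConvexBody W → ℝ} {j : ℕ}

theorem isMinkowskiClass_isNeutralFor (h : IsCTValuation φ) (hφ : IsHomogeneousOfDegree φ j)
    (htri : ∀ a b, IsNeutralFor φ (tri a b)) : IsMinkowskiClass {L | IsNeutralFor φ L} where
  add_mem hK hL := hK.add hL
  smul_mem ht hK := hK.smul hφ ht
  isClosed := isClosed_isNeutralFor h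
  cancel e hK hL := IsNeutralFor.cancel e hK hL
  point_mem := isNeutralFor_point h
  tri_mem := htri

theorem tri_add_neg [FiniteDimensional ℝ W] (a b : W) :
    tri a b + (tri a b).neg = (seg a + seg b + seg (a - b)) + point (-a) := by
  refine supp_injective fun x => ?_
  simp only [supp_add, supp_neg, supp_tri, supp_seg, supp_point, inner_neg_left, inner_neg_right,
    inner_sub_right]
  generalize inner ℝ x a = p
  generalize inner ℝ x b = q
  simp only [max_def]
  split_ifs <;> linarith

theorem isMinkowskiClass_isNeutralFor_add_neg [FiniteDimensional ℝ W] (h : IsCTValuation φ)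
    (hφ : IsHomogeneousOfDegree φ j) (hseg : ∀ a, IsNeutralFor φ (seg a)) :
    IsMinkowskiClass {L | IsNeutralFor φ (L + L.neg)} where
  add_mem {K L} hK hL := by
    change IsNeutralFor φ _
    rw [neg_add_body, add_add_add_comm]
    exact hK.add hL
  smul_mem {t K} ht hK := by
    change IsNeutralFor φ _
    rw [neg_smul', ← smul_add]
    exact hK.smul hφ ht
  isClosed := (isClosed_isNeutralFor h).preimage (continuous_id.add continuous_neg')
  cancel {C K L} e hK hL := by
    refine IsNeutralFor.cancel (φ := φ) ?_ hK hL
    rw [← e, neg_add_body, add_add_add_comm]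
  point_mem a := by
    change IsNeutralFor φ _
    rw [show (point a).neg = point (-a) from mapCLM_point _ _]
    exact (isNeutralFor_point h _).add (isNeutralFor_point h _)
  tri_mem a b := by
    change IsNeutralFor φ _
    rw [tri_add_neg]
    exact (((hseg _).add (hseg _)).add (hseg _)).add (isNeutralFor_point h _)

theorem isNeutralFor_of_symmetric [FiniteDimensional ℝ W] (h : IsCTValuation φ)
    (hφ : IsHomogeneousOfDegree φ j) (hseg : ∀ a, IsNeutralFor φ (seg a)) {K : ConvexBody W}
    (hK : K.neg = K) : IsNeutralFor φ K := by
  have h1 : IsNeutralFor φ (K + K.neg) :=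
    (isMinkowskiClass_isNeutralFor_add_neg h hφ hseg).mem K
  have h2 := h1.smul hφ (t := 1 / 2) (by norm_num)
  rwa [hK, smul_add, ← add_smul_body K (by norm_num) (by norm_num), add_halves, one_smul] at h2

end

section BodyDim

variable {V V' : Type*} [NormedAddCommGroup V] [NormedSpace ℝ V]
  [NormedAddCommGroup V'] [NormedSpace ℝ V']

theorem bodyDim_add_le [FiniteDimensional ℝ V] (K L : ConvexBody V) : bodyDim (K + L) ≤ bodyDim K + bodyDim L := by
  have : vectorSpan ℝ ((K + L : ConvexBody V) : Set V) ≤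
      vectorSpan ℝ (K : Set V) ⊔ vectorSpan ℝ (L : Set V) := by
    refine Submodule.span_le.2 ?_
    rintro _ ⟨_, ⟨x, hx, y, hy, rfl⟩, _, ⟨x', hx', y', hy', rfl⟩, rfl⟩
    refine Submodule.mem_sup.2 ⟨x - x', vsub_mem_vectorSpan ℝ hx hx', y - y',
      vsub_mem_vectorSpan ℝ hy hy', ?_⟩
    simp only [vsub_eq_sub]
    abel
  exact (Submodule.finrank_mono this).trans (Submodule.finrank_add_le_finrank_add_finrank _ _)

theorem bodyDim_mapCLM_le [FiniteDimensional ℝ V] (f : V →L[ℝ] V') (K : ConvexBody V) :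
    bodyDim (K.mapCLM f) ≤ bodyDim K := by
  have := f.toLinearMap.toAffineMap.map_vectorSpan (s := (K : Set V))
  unfold bodyDim
  change finrank ℝ (vectorSpan ℝ (f.toLinearMap.toAffineMap '' (K : Set V))) ≤ _
  rw [← this]
  exact Submodule.finrank_map_le _ _

theorem bodyDim_neg_le [FiniteDimensional ℝ V] (K : ConvexBody V) : bodyDim K.neg ≤ bodyDim K := bodyDim_mapCLM_le _ _

theorem bodyDim_le_finrank [FiniteDimensional ℝ V] (K : ConvexBody V) : bodyDim K ≤ finrank ℝ V := Submodule.finrank_le _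

theorem bodyDim_seg_le (a : V) : bodyDim (seg a) ≤ 1 :=
  (bodyDim_mapCLM_le _ _).trans ((bodyDim_le_finrank _).trans (by simp))

theorem bodyDim_tri_le (a b : V) : bodyDim (tri a b) ≤ 2 :=
  (bodyDim_mapCLM_le _ _).trans ((bodyDim_le_finrank _).trans (by simp))

theorem bodyDim_zero : bodyDim (0 : ConvexBody V) = 0 := by
  change finrank ℝ (vectorSpan ℝ ({0} : Set V)) = 0
  simp

end BodyDim

section

variable {W : Type*} [NormedAddCommGroup W] [InnerProductSpace ℝ W] [FiniteDimensional ℝ W]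

theorem odd_and_eq_zero_of_vanishing (j : ℕ) :
    (∀ φ : ConvexBody W → ℝ, IsCTValuation φ → IsHomogeneousOfDegree φ j →
      (∀ K, bodyDim K ≤ j → φ K = 0) → ∀ K, φ K.neg = -φ K) ∧
    (∀ φ : ConvexBody W → ℝ, IsCTValuation φ → IsHomogeneousOfDegree φ j →
      (∀ K, bodyDim K ≤ j + 1 → φ K = 0) → ∀ K, φ K = 0) := by
  induction j with
  | zero =>
    have key : ∀ φ : ConvexBody W → ℝ, IsHomogeneousOfDegree φ 0 →
        (∀ K, bodyDim K ≤ 0 → φ K = 0) → ∀ K, φ K = 0 := fun φ hφ h0 K => by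
      have := hφ K 0 le_rfl
      rw [zero_smul_body, pow_zero, one_mul, h0 0 bodyDim_zero.le] at this
      exact this.symm
    refine ⟨fun φ _ hφ h0 K => ?_, fun φ _ hφ h0 K => ?_⟩
    · rw [key φ hφ h0, key φ hφ h0, neg_zero]
    · exact key φ hφ (fun K hK => h0 K (by omega)) K
  | succ j ih =>
    have hodd : ∀ φ : ConvexBody W → ℝ, IsCTValuation φ → IsHomogeneousOfDegree φ (j + 1) →
        (∀ K, bodyDim K ≤ j + 1 → φ K = 0) → ∀ K, φ K.neg = -φ K := by
      intro φ h hφ h0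
      set ψ : ConvexBody W → ℝ := fun K => φ K + φ K.neg with hψ
      have hψc : IsCTValuation ψ := h.add h.comp_neg
      have hψh : IsHomogeneousOfDegree ψ (j + 1) := fun K t ht => by
        simp only [hψ, neg_smul', hφ _ _ ht]; ring
      have hψ0 : ∀ K, bodyDim K ≤ j + 1 → ψ K = 0 := fun K hK => by
        simp only [hψ, h0 K hK, h0 K.neg ((bodyDim_neg_le K).trans hK), add_zero]
      have hev : ∀ K, ψ K.neg = ψ K := fun K => by simp only [hψ, neg_neg', add_comm]
      have hseg : ∀ a, IsNeutralFor ψ (seg a) := fun a K => by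
        have h1 := ih.1 _ (hψc.diff (seg a)) (hψc.diff_seg_homogeneous hψh a) (fun K hK => by
          have := (bodyDim_add_le K (seg a)).trans (add_le_add hK (bodyDim_seg_le a))
          simp only [hψ0 _ this, hψ0 K (by omega), sub_zero]) K
        have e : ψ (K.neg + seg a) = ψ (K + seg a) := by
          rw [← hev, neg_add_body, neg_neg', seg_neg, add_comm, translate_add_body, hψc.trans,
            add_comm]
        simp only [e, hev] at h1
        linarith
      have hzero := hψc.eq_zero_of_even hev fun K hK => by
        have := isNeutralFor_of_symmetric hψc hψh hseg hK 0
        rwa [zero_add, hψ0 0 (by rw [bodyDim_zero]; omega)] at this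
      intro K
      have := hzero K
      simp only [hψ] at this
      linarith
    refine ⟨hodd, fun φ h hφ h0 => ?_⟩
    have hφo := hodd φ h hφ fun K hK => h0 K (by omega)
    have hseg : ∀ a, IsNeutralFor φ (seg a) := fun a K => by
      have h1 := ih.2 _ (h.diff (seg a)) (h.diff_seg_homogeneous hφ a) (fun K hK => by
        have := (bodyDim_add_le K (seg a)).trans (add_le_add hK (bodyDim_seg_le a))
        simp only [h0 _ this, h0 K (by omega), sub_zero]) K
      linarith
    have htri : ∀ a b, IsNeutralFor φ (tri a b) := fun a b K => by
      have h1 := ih.1 _ (h.diff (tri a b)) (h.diff_tri_homogeneous hφ hseg a b) (fun K hK => by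
        have := (bodyDim_add_le K (tri a b)).trans (add_le_add hK (bodyDim_tri_le a b))
        simp only [h0 _ this, h0 K (by omega), sub_zero]) K
      have h2 := h.diff_tri_add_diff_tri_neg hseg a b K
      have e : φ (K.neg + tri a b) = -φ (K + (tri a b).neg) := by
        rw [← hφo, neg_add_body, neg_neg']
      simp only [e, hφo] at h1
      linarith
    intro K
    have : IsNeutralFor φ K := (isMinkowskiClass_isNeutralFor h hφ htri).mem K
    have := this 0
    rwa [zero_add, h0 0 (by rw [bodyDim_zero]; omega)] at this

end

section

variable {V : Type*} [NormedAddCommGroup V] [NormedSpace ℝ V] {φ : ConvexBody V → ℝ}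

theorem bodyDim_add_seg [FiniteDimensional ℝ V] {K : ConvexBody V} {a : V} (ha : a ∉ vectorSpan ℝ (K : Set V)) :
    bodyDim (K + seg a) = bodyDim K + 1 := by
  refine le_antisymm ((bodyDim_add_le _ _).trans (add_le_add_right (bodyDim_seg_le a) _)) ?_
  refine Submodule.finrank_lt_finrank_of_lt (SetLike.lt_iff_le_and_exists.2 ⟨?_, a, ?_, ha⟩)
  · refine vectorSpan_mono ℝ fun x hx => ⟨x, hx, 0, mem_seg.2 ⟨0, by simp⟩, by simp⟩
  · obtain ⟨x, hx⟩ := K.nonempty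
    have := vsub_mem_vectorSpan ℝ (s := ((K + seg a : ConvexBody V) : Set V))
      (p₁ := x + a) (p₂ := x + 0) ⟨x, hx, a, mem_seg.2 ⟨1, by simp⟩, rfl⟩
      ⟨x, hx, 0, mem_seg.2 ⟨0, by simp⟩, rfl⟩
    simpa using this

theorem eq_zero_of_bodyDim_succ [FiniteDimensional ℝ V] (hc : Continuous φ) {d : ℕ} (hd : d < finrank ℝ V)
    (h : ∀ K, bodyDim K = d + 1 → φ K = 0) (K : ConvexBody V) (hK : bodyDim K = d) : φ K = 0 := by
  obtain ⟨a, ha⟩ : ∃ a, a ∉ vectorSpan ℝ (K : Set V) := by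
    by_contra! hcon
    have : vectorSpan ℝ (K : Set V) = ⊤ := (Submodule.eq_top_iff').2 hcon
    rw [bodyDim, this, finrank_top] at hK
    omega
  have hlim : Filter.Tendsto (fun t : ℝ => φ (K + t • seg a)) (nhdsWithin 0 (Set.Ioi 0))
      (nhds (φ K)) := by
    have : Continuous fun t : ℝ => φ (K + t • seg a) :=
      hc.comp (continuous_const.add (continuous_smul_const _))
    have := this.tendsto 0
    rw [zero_smul_body, add_zero] at this
    exact this.mono_left nhdsWithin_le_nhds
  refine tendsto_nhds_unique (hlim.congr' ?_) tendsto_const_nhds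
  filter_upwards [self_mem_nhdsWithin] with t ht
  refine h _ ?_
  have ht : 0 < t := ht
  rw [IsCTValuation.smul_seg, bodyDim_add_seg, hK]
  intro hmem
  have := Submodule.smul_mem _ t⁻¹ hmem
  exact ha (by rwa [smul_smul, inv_mul_cancel₀ ht.ne', one_smul] at this)

theorem eq_zero_of_bodyDim_le [FiniteDimensional ℝ V] (hc : Continuous φ) {d : ℕ} (hd : d ≤ finrank ℝ V)
    (h : ∀ K, bodyDim K = d → φ K = 0) (K : ConvexBody V) (hK : bodyDim K ≤ d) : φ K = 0 := by
  induction d with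
  | zero => exact h K (by omega)
  | succ d ih =>
    rcases hK.eq_or_lt with hK | hK
    · exact h K hK
    · exact ih (by omega) (eq_zero_of_bodyDim_succ hc (by omega) h) (by omega)

theorem comp_mapCLM_homogeneous {V' : Type*} [NormedAddCommGroup V'] [NormedSpace ℝ V'] {j : ℕ}
    (hφ : IsHomogeneousOfDegree φ j) (f : V' →L[ℝ] V) :
    IsHomogeneousOfDegree (fun K => φ (K.mapCLM f)) j := fun K t ht => by
  simp only [mapCLM_smul, hφ _ _ ht]

theorem mapCLM_symm (e : V ≃L[ℝ] EuclideanSpace ℝ (Fin (finrank ℝ V))) (K : ConvexBody V) :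
    (K.mapCLM (e : V →L[ℝ] EuclideanSpace ℝ (Fin (finrank ℝ V)))).mapCLM
      (e.symm : EuclideanSpace ℝ (Fin (finrank ℝ V)) →L[ℝ] V) = K := by
  ext1
  simp [Set.image_image]

end

end

/-- Klain; Schneider–Schuster. Let `V` be an `n`-dimensional real
vector space, `j ∈ {0, 1, …, n-1}`, and `φ : 𝒦(V) → ℝ` a continuous, translation
invariant valuation homogeneous of degree `j`.
(a) If `φ(K) = 0` whenever `dim K = j`, then `φ(K) + φ(-K) = 0` for all `K ∈ 𝒦(V)`.
(b) If `φ(K) = 0` whenever `dim K = j + 1`, then `φ ≡ 0`. -/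
theorem vanishing_on_low_dimensional_bodies
    {V : Type*} [NormedAddCommGroup V] [NormedSpace ℝ V] [FiniteDimensional ℝ V]
    (n : ℕ) (hn : Module.finrank ℝ V = n)
    (j : ℕ) (hj : j < n)
    (φ : ConvexBody V → ℝ) (hφc : Continuous φ)
    (hφt : IsTranslationInvariant φ) (hφv : IsValuation φ)
    (hhom : ∀ (K : ConvexBody V) (t : ℝ), 0 ≤ t → φ (t • K) = t ^ j * φ K) :
    ((∀ K : ConvexBody V, bodyDim K = j → φ K = 0) →
      ∀ K : ConvexBody V, φ K + φ K.neg = 0) ∧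
    ((∀ K : ConvexBody V, bodyDim K = j + 1 → φ K = 0) →
      ∀ K : ConvexBody V, φ K = 0) := by
  subst hn
  have h : IsCTValuation φ := ⟨hφc, hφt, hφv⟩
  have hφ : IsHomogeneousOfDegree φ j := hhom
  let e : V ≃L[ℝ] EuclideanSpace ℝ (Fin (finrank ℝ V)) :=
    ContinuousLinearEquiv.ofFinrankEq (by simp)
  have hc := h.comp_mapCLM (e.symm : EuclideanSpace ℝ (Fin (finrank ℝ V)) →L[ℝ] V)
  have hh := comp_mapCLM_homogeneous hφ (e.symm : EuclideanSpace ℝ (Fin (finrank ℝ V)) →L[ℝ] V)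
  obtain ⟨h1, h2⟩ := odd_and_eq_zero_of_vanishing (W := EuclideanSpace ℝ (Fin (finrank ℝ V))) j
  refine ⟨fun h0 K => ?_, fun h0 K => ?_⟩
  · have := h1 _ hc hh (fun L hL => eq_zero_of_bodyDim_le h.cont hj.le h0 _
      ((bodyDim_mapCLM_le _ _).trans hL)) (K.mapCLM e)
    simp only [ConvexBody.mapCLM_neg, mapCLM_symm] at this
    linarith
  · have := h2 _ hc hh (fun L hL => eq_zero_of_bodyDim_le h.cont hj h0 _
      ((bodyDim_mapCLM_le _ _).trans hL)) (K.mapCLM e)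
    simpa only [mapCLM_symm] using this
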